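/- arXiv:1806.08484 — 2 statements merged into one kernel-verified Lean document; each statement's English description precedes it below -/
import Mathlib

section
/- Let k be a field and (A, d, h) a cdga over k, with τ the twisting cochain equal to s^{−1} on (ΣA)^{⊗1} and zero elsewhere. Then the endomorphism d_⊗ − [τ, −] of A ⊗_k T (where [τ, ω] := τ·ω − (−1)^{|ω|}ω·τ using the bimodule actions) squares to zero and makes A ⊗_k T a left differential graded module over the dga (Hom_k(T,A), ⋆, d_τ); moreover, under the identification A ⊗_k T = Hoch(A), the differential d_⊗ − [τ, −] coincides with the Hochschild differential b = b₂ + b₁ + b₀. -/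
noncomputable section

open Finset

/-- The grading group `Γ` (to be thought of as `ℤ` or `ℤ/2ℤ`): an additive
commutative group with one, together with its parity homomorphism to `ℤ/2ℤ`
(through which all Koszul signs are computed). -/
class GradingGroup (Γ : Type) extends AddCommGroupWithOne Γ where
  parity : Γ →+ ZMod 2
  parity_one : parity 1 = 1

/-- The Koszul sign `(−1)^{|γ|}` in `k`. -/
def gsign (k : Type) [Field k] {Γ : Type} [GradingGroup Γ] (γ : Γ) : k :=
  (-1 : k) ^ (GradingGroup.parity γ).val

/-- The Koszul sign `(−1)^{|γ|·|γ'|}` in `k`. -/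
def gsign2 (k : Type) [Field k] {Γ : Type} [GradingGroup Γ] (γ γ' : Γ) : k :=
  (-1 : k) ^ (GradingGroup.parity γ * GradingGroup.parity γ').val

/-- `degSum g j = g 0 + ⋯ + g (j-1)` : the sum of the first `j` degrees. -/
def degSum {Γ : Type} [GradingGroup Γ] (g : ℕ → Γ) (j : ℕ) : Γ :=
  ∑ t ∈ Finset.range j, g t

/-- Read a sequence cyclically with period `m + 1`. -/
def cyc {α : Type} (m : ℕ) (X : ℕ → α) : ℕ → α := fun i => X (i % (m + 1))

/-- Contract a chain at position `j`, multiplying the `j`-th and `(j+1)`-st entries. -/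
def contractChain {E : Type} [Mul E] (a : ℕ → E) (j : ℕ) : ℕ → E :=
  fun i => if i < j then a i else if i = j then a j * a (j + 1) else a (i + 1)

/-- Omit the `(j+1)`-st term of a sequence of objects. -/
def dropIdx {α : Type} (X : ℕ → α) (j : ℕ) : ℕ → α :=
  fun i => if i ≤ j then X i else X (i + 1)

/-- Insert `x` into a chain after position `j`. -/
def insertChain {E : Type} (a : ℕ → E) (j : ℕ) (x : E) : ℕ → E :=
  fun i => if i ≤ j then a i else if i = j + 1 then x else a (i - 1)

/-- Insert `x` into a chain so that it occupies position `j`. -/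
def insertAt {E : Type} (a : ℕ → E) (j : ℕ) (x : E) : ℕ → E :=
  fun i => if i < j then a i else if i = j then x else a (i - 1)

/-- Duplicate the `(j+1)`-st term of a sequence of objects. -/
def dupIdx {α : Type} (X : ℕ → α) (j : ℕ) : ℕ → α :=
  fun i => if i ≤ j + 1 then X i else X (i - 1)

/-- The ordered product `f 0 * f 1 * ⋯ * f m`. -/
def chainProd {E : Type} [Mul E] (f : ℕ → E) : ℕ → E
  | 0 => f 0
  | m + 1 => chainProd f m * f (m + 1)

/-- Extend a `Fin (n+1)`-tuple of naturals by zero. -/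
def extTuple {n : ℕ} (v : Fin (n + 1) → ℕ) : ℕ → ℕ :=
  fun t => if h : t < n + 1 then v ⟨t, h⟩ else 0


/-- A curved differential `Γ`-graded algebra `(A, d, h)` over `k`: a unital `Γ`-graded
`k`-algebra `A` with a degree-one `k`-linear derivation `d` and a degree-two curvature
element `h` satisfying `d² = [h,−]` and `d(h) = 0`. -/
structure CurvedDGA (k Γ : Type) [Field k] [GradingGroup Γ] where
  A : Type
  [ringA : Ring A]
  [algA : Algebra k A]
  deg : Γ → Submodule k A
  one_mem : (1 : A) ∈ deg 0
  mul_mem : ∀ {γ γ' : Γ} {a b : A}, a ∈ deg γ → b ∈ deg γ' → a * b ∈ deg (γ + γ')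
  d : A →ₗ[k] A
  hEl : A
  d_deg : ∀ {γ : Γ} {a : A}, a ∈ deg γ → d a ∈ deg (γ + 1)
  d_leibniz : ∀ {γ : Γ} {a : A}, a ∈ deg γ → ∀ b : A,
      d (a * b) = d a * b + gsign k γ • (a * d b)
  h_deg : hEl ∈ deg 2
  d_sq : ∀ a : A, d (d a) = hEl * a - a * hEl
  d_h : d hEl = 0

attribute [instance] CurvedDGA.ringA CurvedDGA.algA

variable {k Γ : Type} [Field k] [GradingGroup Γ]

/-- Each `a i` (for `i ≤ n`) is homogeneous of degree `g i`. -/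
def CurvedDGA.Homog (R : CurvedDGA k Γ) (n : ℕ) (g : ℕ → Γ) (a : ℕ → R.A) : Prop :=
  ∀ i ≤ n, a i ∈ R.deg (g i)


open TensorProduct

/-- The sign `(−1)^{p·q}` for parities `p, q : ℤ/2`. -/
def psign (k : Type) [Field k] (p q : ZMod 2) : k := (-1 : k) ^ (p * q).val

variable {k Γ : Type} [Field k] [GradingGroup Γ]

/-- Each `a i` (for `i < n`) is homogeneous of degree `g i` (bar-chain version:
`tgen n a` models `[a₀|⋯|a_{n−1}]`, of degree `∑|aᵢ| − n`). -/
def CurvedDGA.HomogBar (R : CurvedDGA k Γ) (n : ℕ) (g : ℕ → Γ) (a : ℕ → R.A) : Prop :=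
  ∀ i < n, a i ∈ R.deg (g i)

/-- A model of the components `T n = (ΣA)^{⊗n}` of the tensor (bar) coalgebra
`T = T(A) = ⊕ₙ (ΣA)^{⊗n}` of a cdga `(A, d, h)`, together with:
the deconcatenation coproduct `Δ`, recorded through its components
`cop n i : T n → T i ⊗ T (n−i)`; the `Γ`-grading `tdeg`; the parity sign operators
`sgnOp n p` (multiplying the degree-`γ` part by `(−1)^{p·|γ|}`, which encode the
Koszul signs of `f ⊗ g`); and the three coderivations `δ⁽²⁾, δ⁽¹⁾, δ⁽⁰⁾` determined
by `[a|b] ↦ (−1)^{|a|−1}[ab]`, `[a] ↦ −[da]`, `[] ↦ [h]`, with their explicit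
formulas on homogeneous generators. -/
structure BarParts (k Γ : Type) [Field k] [GradingGroup Γ] (R : CurvedDGA k Γ) where
  T : ℕ → Type
  [addT : ∀ n, AddCommGroup (T n)]
  [modT : ∀ n, Module k (T n)]
  tgen : (n : ℕ) → (ℕ → R.A) → T n
  tgen_ext : ∀ {n : ℕ} {a a' : ℕ → R.A}, (∀ i < n, a i = a' i) → tgen n a = tgen n a'
  tgen_add : ∀ (n : ℕ) (a : ℕ → R.A) (i : ℕ), i < n → ∀ x y : R.A,
      tgen n (Function.update a i (x + y)) =
        tgen n (Function.update a i x) + tgen n (Function.update a i y)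
  tgen_smul : ∀ (n : ℕ) (a : ℕ → R.A) (i : ℕ), i < n → ∀ (c : k) (x : R.A),
      tgen n (Function.update a i (c • x)) = c • tgen n (Function.update a i x)
  span_tgen : ∀ n : ℕ, Submodule.span k
      {w : T n | ∃ a g, R.HomogBar n g a ∧ w = tgen n a} = ⊤
  tdeg : (n : ℕ) → Γ → Submodule k (T n)
  tgen_deg : ∀ {n : ℕ} {a : ℕ → R.A} {g : ℕ → Γ}, R.HomogBar n g a →
      tgen n a ∈ tdeg n (degSum g n - (n : Γ))
  cop : (n i j : ℕ) → T n →ₗ[k] (T i ⊗[k] T j)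
  cop_gen : ∀ (i j : ℕ) (a : ℕ → R.A),
      cop (i + j) i j (tgen (i + j) a) = tgen i a ⊗ₜ[k] tgen j (fun t => a (t + i))
  cop_zero : ∀ {n i j : ℕ}, n ≠ i + j → cop n i j = 0
  sgnOp : (n : ℕ) → ZMod 2 → T n →ₗ[k] T n
  sgnOp_apply : ∀ (n : ℕ) (p : ZMod 2) {γ : Γ} (x : T n), x ∈ tdeg n γ →
      sgnOp n p x = psign k p (GradingGroup.parity γ) • x
  d2 : (n : ℕ) → T (n + 1) →ₗ[k] T n
  d1 : (n : ℕ) → T n →ₗ[k] T n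
  d0 : (n : ℕ) → T n →ₗ[k] T (n + 1)
  d2_gen : ∀ (n : ℕ) (a : ℕ → R.A) (g : ℕ → Γ), R.HomogBar (n + 1) g a →
      d2 n (tgen (n + 1) a) = ∑ j ∈ Finset.range n,
        gsign k (degSum g (j + 1) - ((j + 1 : ℕ) : Γ)) • tgen n (contractChain a j)
  d1_gen : ∀ (n : ℕ) (a : ℕ → R.A) (g : ℕ → Γ), R.HomogBar n g a →
      d1 n (tgen n a) = ∑ j ∈ Finset.range n,
        gsign k (degSum g j - ((j + 1 : ℕ) : Γ)) •
          tgen n (Function.update a j (R.d (a j)))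
  d0_gen : ∀ (n : ℕ) (a : ℕ → R.A) (g : ℕ → Γ), R.HomogBar n g a →
      d0 n (tgen n a) = ∑ j ∈ Finset.range (n + 1),
        gsign k (degSum g j - (j : Γ)) • tgen (n + 1) (insertAt a j R.hEl)

attribute [instance] BarParts.addT BarParts.modT

variable {k Γ : Type} [Field k] [GradingGroup Γ] {R : CurvedDGA k Γ}

/-- The convolution product `f ⋆ g` on `Hom_k(T, A)` (elements recorded by their
components `T n →ₗ A`), for `g` of parity `p`: `f ⋆ g = μ ∘ (f ⊗ g) ∘ Δ`, the Koszul
sign `(−1)^{|g||x|}` in the evaluation of `f ⊗ g` being implemented by the sign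
operator `sgnOp − p` applied on the first tensor factor. -/
def convP (P : BarParts k Γ R) (p : ZMod 2) (f g : ∀ n, P.T n →ₗ[k] R.A) :
    ∀ n, P.T n →ₗ[k] R.A :=
  fun n => ∑ i ∈ Finset.range (n + 1),
    (LinearMap.mul' k R.A) ∘ₗ
      (TensorProduct.map ((f i) ∘ₗ (P.sgnOp i p)) (g (n - i))) ∘ₗ (P.cop n i (n - i))

/-- The component family of `f ∘ δ_T`. -/
def compDelta (P : BarParts k Γ R) (f : ∀ n, P.T n →ₗ[k] R.A) :
    ∀ n, P.T n →ₗ[k] R.A :=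
  fun n =>
    match n with
    | 0 => (f 1) ∘ₗ (P.d0 0) + (f 0) ∘ₗ (P.d1 0)
    | m + 1 => (f m) ∘ₗ (P.d2 m) + (f (m + 1)) ∘ₗ (P.d1 (m + 1)) +
        (f (m + 2)) ∘ₗ (P.d0 (m + 1))

/-- The differential `d_Hom(f) = d ∘ f − (−1)^{|f|} f ∘ δ_T` on `Hom_k(T, A)`, for
`f` homogeneous of degree `γf`. -/
def dHomP (P : BarParts k Γ R) (γf : Γ) (f : ∀ n, P.T n →ₗ[k] R.A) :
    ∀ n, P.T n →ₗ[k] R.A :=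
  fun n => R.d ∘ₗ f n - gsign k γf • compDelta P f n

/-- `f : Hom_k(T, A)` is homogeneous of degree `γf`. -/
def HomogMap (P : BarParts k Γ R) (γf : Γ) (f : ∀ n, P.T n →ₗ[k] R.A) : Prop :=
  ∀ (n : ℕ) (γ : Γ) (x : P.T n), x ∈ P.tdeg n γ → f n x ∈ R.deg (γ + γf)

/-- The deformed differential `d_τ = d_Hom − [τ, −]⋆` on `Hom_k(T, A)`, for an
argument homogeneous of degree `γf`:
`d_τ(f) = d_Hom(f) − (τ ⋆ f − (−1)^{|τ||f|} f ⋆ τ)`. -/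
def dTauP (P : BarParts k Γ R) (tauH : ∀ n, P.T n →ₗ[k] R.A) (γf : Γ)
    (f : ∀ n, P.T n →ₗ[k] R.A) : ∀ n, P.T n →ₗ[k] R.A :=
  dHomP P γf f -
    (convP P (GradingGroup.parity γf) tauH f -
      gsign2 k 1 γf • convP P (GradingGroup.parity (1 : Γ)) f tauH)


variable {k Γ : Type} [Field k] [GradingGroup Γ] {R : CurvedDGA k Γ}

/-- `sgnA p` is the operator multiplying the degree-`γ` part of `A` by `(−1)^{p·|γ|}`
(used to implement Koszul signs). -/
def IsSgnA (R : CurvedDGA k Γ) (sgnA : ZMod 2 → R.A →ₗ[k] R.A) : Prop :=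
  ∀ (p : ZMod 2) {γ : Γ} (a : R.A), a ∈ R.deg γ →
    sgnA p a = psign k p (GradingGroup.parity γ) • a

/-- The component `A ⊗ T (n+1) → A ⊗ T n` of `d_⊗ = d_A ⊗ id + id ⊗ δ_T`
(the Koszul sign of `id ⊗ δ_T` is implemented by `sgnA 1` on the `A` factor). -/
def dOt2 (P : BarParts k Γ R) (sgnA : ZMod 2 → R.A →ₗ[k] R.A) (n : ℕ) :
    (R.A ⊗[k] P.T (n + 1)) →ₗ[k] (R.A ⊗[k] P.T n) :=
  TensorProduct.map (sgnA 1) (P.d2 n)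

/-- The component `A ⊗ T n → A ⊗ T n` of `d_⊗`. -/
def dOt1 (P : BarParts k Γ R) (sgnA : ZMod 2 → R.A →ₗ[k] R.A) (n : ℕ) :
    (R.A ⊗[k] P.T n) →ₗ[k] (R.A ⊗[k] P.T n) :=
  TensorProduct.map R.d LinearMap.id + TensorProduct.map (sgnA 1) (P.d1 n)

/-- The component `A ⊗ T n → A ⊗ T (n+1)` of `d_⊗`. -/
def dOt0 (P : BarParts k Γ R) (sgnA : ZMod 2 → R.A →ₗ[k] R.A) (n : ℕ) :
    (R.A ⊗[k] P.T n) →ₗ[k] (R.A ⊗[k] P.T (n + 1)) :=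
  TensorProduct.map (sgnA 1) (P.d0 n)

/-- The differential `d_⊗ = d_A ⊗ id + id ⊗ δ_T` on `A ⊗ T = ⊕ₙ A ⊗ Tₙ`. -/
def dAll (P : BarParts k Γ R) (sgnA : ZMod 2 → R.A →ₗ[k] R.A)
    (x : ∀ n, R.A ⊗[k] P.T n) : ∀ n, R.A ⊗[k] P.T n :=
  fun n => dOt2 P sgnA n (x (n + 1)) + dOt1 P sgnA n (x n) +
    (match n with
      | 0 => 0
      | m + 1 => dOt0 P sgnA m (x m))

/-- `lact p f n i : A ⊗ Tₙ → A ⊗ Tᵢ` is the weight-`(n,i)` component of the left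
action `f · (a ⊗ t) = ∑ᵢ (−1)^{(|a|+|t′|)|t″|} f(t″)a ⊗ t′` of `Hom_k(T,A)` on
`A ⊗ T` (for `f` of parity `p`). -/
def IsLact (P : BarParts k Γ R)
    (lact : ZMod 2 → (∀ n, P.T n →ₗ[k] R.A) → (n i : ℕ) →
      (R.A ⊗[k] P.T n) →ₗ[k] (R.A ⊗[k] P.T i)) : Prop :=
  (∀ (p : ZMod 2) (f : ∀ n, P.T n →ₗ[k] R.A) (n i : ℕ), n < i → lact p f n i = 0) ∧
  (∀ (p : ZMod 2) (f : ∀ n, P.T n →ₗ[k] R.A) (n i : ℕ) (γ₀ : Γ) (a₀ : R.A)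
      (a : ℕ → R.A) (g : ℕ → Γ), a₀ ∈ R.deg γ₀ → R.HomogBar n g a → i ≤ n →
    lact p f n i (a₀ ⊗ₜ[k] P.tgen n a) =
      gsign2 k (γ₀ + (degSum g i - (i : Γ)))
          ((∑ t ∈ Finset.Ico i n, g t) - ((n - i : ℕ) : Γ)) •
        ((f (n - i) (P.tgen (n - i) (fun t => a (t + i))) * a₀) ⊗ₜ[k] P.tgen i a))

/-- `ract p f n j : A ⊗ Tₙ → A ⊗ Tⱼ` is the weight-`(n,j)` component of the right
action `(a ⊗ t) · f = ∑ (−1)^{|f||t|} a f(t′) ⊗ t″` of `Hom_k(T,A)` on `A ⊗ T`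
(for `f` of parity `p`). -/
def IsRact (P : BarParts k Γ R)
    (ract : ZMod 2 → (∀ n, P.T n →ₗ[k] R.A) → (n j : ℕ) →
      (R.A ⊗[k] P.T n) →ₗ[k] (R.A ⊗[k] P.T j)) : Prop :=
  (∀ (p : ZMod 2) (f : ∀ n, P.T n →ₗ[k] R.A) (n j : ℕ), n < j → ract p f n j = 0) ∧
  (∀ (p : ZMod 2) (f : ∀ n, P.T n →ₗ[k] R.A) (n j : ℕ) (γ₀ : Γ) (a₀ : R.A)
      (a : ℕ → R.A) (g : ℕ → Γ), a₀ ∈ R.deg γ₀ → R.HomogBar n g a → j ≤ n →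
    ract p f n j (a₀ ⊗ₜ[k] P.tgen n a) =
      psign k p (GradingGroup.parity (degSum g n - (n : Γ))) •
        ((a₀ * f (n - j) (P.tgen (n - j) a)) ⊗ₜ[k]
          P.tgen j (fun t => a (t + (n - j)))))

/-- `sgnAT p n` multiplies the degree-`γ` part of `A ⊗ Tₙ` by `(−1)^{p·|γ|}`. -/
def IsSgnAT (P : BarParts k Γ R)
    (sgnAT : ZMod 2 → (n : ℕ) → (R.A ⊗[k] P.T n) →ₗ[k] (R.A ⊗[k] P.T n)) : Prop :=
  ∀ (p : ZMod 2) (n : ℕ) (γ₀ : Γ) (a₀ : R.A) (a : ℕ → R.A) (g : ℕ → Γ),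
    a₀ ∈ R.deg γ₀ → R.HomogBar n g a →
    sgnAT p n (a₀ ⊗ₜ[k] P.tgen n a) =
      psign k p (GradingGroup.parity (γ₀ + (degSum g n - (n : Γ)))) •
        (a₀ ⊗ₜ[k] P.tgen n a)

/-- The deformed differential `d_⊗ − [τ, −]` on `A ⊗ T`, where
`[τ, ω] = τ·ω − (−1)^{|ω|} ω·τ`. -/
def bAll (P : BarParts k Γ R) (sgnA : ZMod 2 → R.A →ₗ[k] R.A)
    (lact ract : ZMod 2 → (∀ n, P.T n →ₗ[k] R.A) → (n i : ℕ) →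
      (R.A ⊗[k] P.T n) →ₗ[k] (R.A ⊗[k] P.T i))
    (sgnAT : ZMod 2 → (n : ℕ) → (R.A ⊗[k] P.T n) →ₗ[k] (R.A ⊗[k] P.T n))
    (tauH : ∀ n, P.T n →ₗ[k] R.A)
    (x : ∀ n, R.A ⊗[k] P.T n) : ∀ n, R.A ⊗[k] P.T n :=
  fun n => dAll P sgnA x n - lact 1 tauH (n + 1) n (x (n + 1)) +
    ract 1 tauH (n + 1) n (sgnAT 1 (n + 1) (x (n + 1)))

/-! ### Signs -/

/-- The sign `(−1)^z` for a parity `z : ℤ/2`. -/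
def zsign (k : Type) [Field k] (z : ZMod 2) : k := (-1 : k) ^ z.val

lemma zsign_add (k : Type) [Field k] (a b : ZMod 2) :
    zsign k (a + b) = zsign k a * zsign k b := by
  unfold zsign
  rw [ZMod.val_add, ← neg_one_pow_eq_pow_mod_two, pow_add]

lemma zsign_zero (k : Type) [Field k] : zsign k 0 = 1 := by simp [zsign]

lemma zsign_one (k : Type) [Field k] : zsign k 1 = -1 := by simp [zsign, ZMod.val_one]

lemma neg_eq_zsign_smul {k M : Type} [Field k] [AddCommGroup M] [Module k M] (x : M) :
    -x = zsign k 1 • x := by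
  rw [zsign_one, neg_one_smul]

/-- The parity of a degree. -/
abbrev par (γ : Γ) : ZMod 2 := GradingGroup.parity γ

lemma gsign_eq (γ : Γ) : gsign k γ = zsign k (par γ) := rfl

lemma gsign2_eq (γ γ' : Γ) : gsign2 k γ γ' = zsign k (par γ * par γ') := rfl

lemma psign_eq (p q : ZMod 2) : psign k p q = zsign k (p * q) := rfl

lemma par_one : par (1 : Γ) = 1 := GradingGroup.parity_one

lemma par_natCast (n : ℕ) : par (n : Γ) = n :=
  map_natCast' (GradingGroup.parity (Γ := Γ)) GradingGroup.parity_one n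

lemma par_two : par (2 : Γ) = 0 := by
  have h := par_natCast (Γ := Γ) 2
  rw [Nat.cast_ofNat] at h
  rw [h]; rfl

/-- The parity of a bar chain of length `n` whose entries have degrees `g`. -/
def barPar (g : ℕ → Γ) (n : ℕ) : ZMod 2 := ∑ t ∈ range n, (par (g t) + 1)

lemma barPar_zero (g : ℕ → Γ) : barPar g 0 = 0 := by simp [barPar]

lemma barPar_succ (g : ℕ → Γ) (n : ℕ) :
    barPar g (n + 1) = barPar g n + (par (g n) + 1) := sum_range_succ _ _

lemma barPar_succ' (g : ℕ → Γ) (n : ℕ) :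
    barPar g (n + 1) = barPar (fun t => g (t + 1)) n + (par (g 0) + 1) := sum_range_succ' _ _

lemma barPar_add (g : ℕ → Γ) (m l : ℕ) :
    barPar g (m + l) = barPar g m + barPar (fun t => g (t + m)) l := by
  rw [barPar, sum_range_add]
  simp only [barPar, add_comm m]

lemma barPar_congr {g g' : ℕ → Γ} {n : ℕ} (h : ∀ i < n, g i = g' i) :
    barPar g n = barPar g' n :=
  sum_congr rfl fun i hi => by rw [h i (mem_range.1 hi)]

lemma par_degSum (g : ℕ → Γ) (n : ℕ) : par (degSum g n) = barPar g n + n := by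
  unfold degSum barPar par
  rw [map_sum, sum_add_distrib, sum_const, card_range, nsmul_one, add_assoc,
    CharTwo.add_self_eq_zero, add_zero]

lemma par_degSum_sub (g : ℕ → Γ) (n : ℕ) : par (degSum g n - (n : Γ)) = barPar g n := by
  unfold par
  rw [map_sub]
  change par (degSum g n) - par (n : Γ) = _
  rw [par_degSum, par_natCast, add_sub_cancel_right]

lemma par_add (γ γ' : Γ) : par (γ + γ') = par γ + par γ' := map_add _ _ _

lemma par_degSum_sub_succ (g : ℕ → Γ) (j : ℕ) :
    par (degSum g j - ((j + 1 : ℕ) : Γ)) = barPar g j + 1 := by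
  unfold par
  rw [map_sub]
  change par (degSum g j) - par ((j + 1 : ℕ) : Γ) = _
  rw [par_degSum, par_natCast, Nat.cast_add, Nat.cast_one, CharTwo.sub_eq_add,
    ← add_assoc, add_assoc (barPar g j), CharTwo.add_self_eq_zero, add_zero]

/-! ### Chains -/

/-- Put `x` in front of a chain. -/
def consChain {E : Type} (x : E) (a : ℕ → E) : ℕ → E
  | 0 => x
  | i + 1 => a i

lemma consChain_succ {E : Type} (x : E) (a : ℕ → E) (i : ℕ) : consChain x a (i + 1) = a i := rfl

lemma consChain_zero {E : Type} (x : E) (a : ℕ → E) : consChain x a 0 = x := rfl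

lemma consChain_one {E : Type} (x : E) (a : ℕ → E) : consChain x a 1 = a 0 := rfl

lemma consChain_tail {E : Type} (a : ℕ → E) : consChain (a 0) (fun t => a (t + 1)) = a := by
  funext i; cases i <;> rfl

lemma insertAt_zero {E : Type} (a : ℕ → E) (x : E) : insertAt a 0 x = consChain x a := by
  funext i; cases i <;> simp [insertAt, consChain]

lemma insertAt_consChain {E : Type} (y : E) (a : ℕ → E) (j : ℕ) (x : E) :
    insertAt (consChain y a) (j + 1) x = consChain y (insertAt a j x) := by
  funext i
  rcases i with _ | i
  · simp [insertAt, consChain]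
  · rcases i with _ | i
    · simp only [insertAt, consChain]; grind
    · simp only [insertAt, consChain]; grind [consChain]

lemma contractChain_zero {E : Type} [Mul E] (a : ℕ → E) :
    contractChain a 0 = consChain (a 0 * a 1) (fun t => a (t + 2)) := by
  funext i; cases i <;> simp [contractChain, consChain]

lemma contractChain_consChain {E : Type} [Mul E] (y : E) (a : ℕ → E) (j : ℕ) :
    contractChain (consChain y a) (j + 1) = consChain y (contractChain a j) := by
  funext i; cases i <;> simp [contractChain, consChain]

lemma update_consChain_zero {E : Type} (y : E) (a : ℕ → E) (x : E) :
    Function.update (consChain y a) 0 x = consChain x a := by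
  funext i; cases i <;> simp [consChain]

lemma update_consChain_succ {E : Type} (y : E) (a : ℕ → E) (j : ℕ) (x : E) :
    Function.update (consChain y a) (j + 1) x = consChain y (Function.update a j x) := by
  funext i; cases i <;> simp [consChain, Function.update_apply]

lemma insertAt_of_lt {E : Type} (a : ℕ → E) {i j : ℕ} (x : E) (h : i < j) :
    insertAt a j x i = a i := if_pos h

lemma insertAt_shift {E : Type} (a : ℕ → E) (m j : ℕ) (x : E) (i : ℕ) :
    insertAt a (m + j) x (i + m) = insertAt (fun t => a (t + m)) j x i := by
  unfold insertAt
  split_ifs <;> first | rfl | omega | (congr 1; omega)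

lemma insertAt_shift_of_lt {E : Type} (a : ℕ → E) {m j : ℕ} (h : j < m + 1) (x : E) (i : ℕ) :
    insertAt a j x (i + (m + 1)) = a (i + m) := by
  unfold insertAt
  split_ifs <;> first | rfl | omega

lemma contractChain_of_lt {E : Type} [Mul E] (a : ℕ → E) {i j : ℕ} (h : i < j) :
    contractChain a j i = a i := if_pos h

lemma contractChain_shift {E : Type} [Mul E] (a : ℕ → E) (m j : ℕ) (i : ℕ) :
    contractChain a (m + j) (i + m) = contractChain (fun t => a (t + m)) j i := by
  unfold contractChain
  split_ifs <;> first | rfl | omega | (congr 1; omega) | (congr 2 <;> omega)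

lemma contractChain_shift_of_lt {E : Type} [Mul E] (a : ℕ → E) {m j : ℕ} (h : j < m) (i : ℕ) :
    contractChain a j (i + m) = a (i + (m + 1)) := by
  unfold contractChain
  split_ifs <;> first | rfl | omega

/-- The degrees of the contraction of a chain with degrees `g`. -/
def contractDeg (g : ℕ → Γ) (j : ℕ) : ℕ → Γ :=
  fun i => if i < j then g i else if i = j then g j + g (j + 1) else g (i + 1)

lemma barPar_contractDeg (g : ℕ → Γ) {j m : ℕ} (h : j < m) :
    barPar (contractDeg g j) m = barPar g (m + 1) + 1 := by
  induction m, h using Nat.le_induction with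
  | base =>
    rw [barPar_succ, barPar_succ, barPar_succ,
      barPar_congr (g := contractDeg g j) (g' := g) fun i hi => by simp [contractDeg, hi]]
    have : contractDeg g j j = g j + g (j + 1) := by simp [contractDeg]
    rw [this, par_add]
    linear_combination (-1 : ZMod 2) * (CharTwo.two_eq_zero (R := ZMod 2))
  | succ m hm ih =>
    have : contractDeg g j m = g (m + 1) := by
      simp only [contractDeg]; rw [if_neg (by omega), if_neg (by omega)]
    rw [barPar_succ, ih, barPar_succ g (m + 1), this]; ring

lemma barPar_update (g : ℕ → Γ) {j m : ℕ} (h : j < m) :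
    barPar (Function.update g j (g j + 1)) m = barPar g m + 1 := by
  induction m, h using Nat.le_induction with
  | base =>
    rw [barPar_succ, barPar_succ,
      barPar_congr (g := Function.update g j (g j + 1)) (g' := g) fun i hi => by
        rw [Function.update_of_ne hi.ne], Function.update_self, par_add, par_one]
    ring
  | succ m hm ih =>
    rw [barPar_succ, ih, barPar_succ g m, Function.update_of_ne (by omega)]; ring

lemma barPar_insertAt (g : ℕ → Γ) {j m : ℕ} (h : j ≤ m) :
    barPar (insertAt g j 2) (m + 1) = barPar g m + 1 := by
  induction m, h using Nat.le_induction with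
  | base =>
    rw [barPar_succ,
      barPar_congr (g := insertAt g j 2) (g' := g) fun i hi => insertAt_of_lt g 2 hi]
    simp [insertAt, par_two]
  | succ m hm ih =>
    have : insertAt g j 2 (m + 1) = g m := by
      simp only [insertAt]; rw [if_neg (by omega), if_neg (by omega)]; rfl
    rw [barPar_succ, ih, barPar_succ g m, this]; ring

namespace CurvedDGA

lemma HomogBar.contractChain {n : ℕ} {g : ℕ → Γ} {a : ℕ → R.A} (ha : R.HomogBar (n + 1) g a)
    (j : ℕ) : R.HomogBar n (contractDeg g j) (contractChain a j) := by
  intro i hi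
  simp only [_root_.contractChain, contractDeg]
  split_ifs
  · exact ha _ (by omega)
  · exact R.mul_mem (ha _ (by omega)) (ha _ (by omega))
  · exact ha _ (by omega)

lemma HomogBar.update {n : ℕ} {g : ℕ → Γ} {a : ℕ → R.A} (ha : R.HomogBar n g a)
    {j : ℕ} (hj : j < n) :
    R.HomogBar n (Function.update g j (g j + 1)) (Function.update a j (R.d (a j))) := by
  intro i hi
  by_cases h : i = j
  · subst h; simpa using R.d_deg (ha i hi)
  · simpa [h] using ha i hi

lemma HomogBar.insertAt {n : ℕ} {g : ℕ → Γ} {a : ℕ → R.A} (ha : R.HomogBar n g a)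
    {j : ℕ} (hj : j ≤ n) : R.HomogBar (n + 1) (insertAt g j 2) (insertAt a j R.hEl) := by
  intro i hi
  simp only [_root_.insertAt]
  split_ifs
  · exact ha _ (by omega)
  · exact R.h_deg
  · exact ha _ (by omega)

lemma HomogBar.tail {n : ℕ} {g : ℕ → Γ} {a : ℕ → R.A} (ha : R.HomogBar (n + 1) g a) :
    R.HomogBar n (fun t => g (t + 1)) (fun t => a (t + 1)) :=
  fun i hi => ha (i + 1) (by omega)

lemma HomogBar.mono {m n : ℕ} {g : ℕ → Γ} {a : ℕ → R.A} (ha : R.HomogBar n g a) (h : m ≤ n) :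
    R.HomogBar m g a :=
  fun i hi => ha i (by omega)

lemma HomogBar.shift {m l : ℕ} {g : ℕ → Γ} {a : ℕ → R.A} (ha : R.HomogBar (m + l) g a) :
    R.HomogBar l (fun t => g (t + m)) (fun t => a (t + m)) :=
  fun i hi => ha (i + m) (by omega)

end CurvedDGA

/-! ### Generators -/

lemma span_homogeneous_eq_top (P : BarParts k Γ R) (tauH : ∀ n, P.T n →ₗ[k] R.A)
    (tauH1 : ∀ a : ℕ → R.A, tauH 1 (P.tgen 1 a) = a 0) :
    Submodule.span k {x : R.A | ∃ γ, x ∈ R.deg γ} = ⊤ := by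
  rw [eq_top_iff]
  intro x _
  have hx : P.tgen 1 (fun _ => x) ∈ Submodule.span k
      {w : P.T 1 | ∃ a g, R.HomogBar 1 g a ∧ w = P.tgen 1 a} := by
    rw [P.span_tgen]; trivial
  have := Submodule.mem_map_of_mem (f := tauH 1) hx
  rw [tauH1, Submodule.map_span] at this
  refine Submodule.span_mono ?_ this
  rintro _ ⟨_, ⟨a, g, ha, rfl⟩, rfl⟩
  exact ⟨g 0, by rw [tauH1]; exact ha 0 one_pos⟩

lemma tensor_hom_ext (P : BarParts k Γ R)
    (hA : Submodule.span k {x : R.A | ∃ γ, x ∈ R.deg γ} = ⊤)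
    {M : Type} [AddCommGroup M] [Module k M] {n : ℕ} {F G : (R.A ⊗[k] P.T n) →ₗ[k] M}
    (h : ∀ (γ₀ : Γ) (a₀ : R.A) (a : ℕ → R.A) (g : ℕ → Γ), a₀ ∈ R.deg γ₀ → R.HomogBar n g a →
      F (a₀ ⊗ₜ[k] P.tgen n a) = G (a₀ ⊗ₜ[k] P.tgen n a)) : F = G := by
  refine TensorProduct.ext (LinearMap.ext_on hA ?_)
  rintro a₀ ⟨γ₀, h₀⟩
  refine LinearMap.ext_on (P.span_tgen n) ?_
  rintro _ ⟨a, g, ha, rfl⟩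
  exact h γ₀ a₀ a g h₀ ha

/-! ### The bar coderivation squares to zero -/

section BarWord

variable {M : Type} [AddCommGroup M]

/-- The contribution of the product of the first two letters to `barWord`. -/
def contractHead (R : CurvedDGA k Γ) (s : R.A → R.A) :
    (n : ℕ) → (ℕ → (ℕ → R.A) → M) → (ℕ → R.A) → M
  | 0, _, _ => 0
  | n + 1, W, a => W (n + 1) (consChain (s (a 0) * a 1) (fun t => a (t + 2)))

/-- The value on the word `[a₀|⋯|a_{n−1}]` of the coderivation `δ_T` transposed to act on
functions `W` of words, where `s` is the operator `x ↦ (−1)^{|x|−1} x`. -/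
def barWord (R : CurvedDGA k Γ) (s : R.A → R.A) :
    (n : ℕ) → (ℕ → (ℕ → R.A) → M) → (ℕ → R.A) → M
  | 0, W, a => W 1 (consChain R.hEl a)
  | n + 1, W, a =>
    W (n + 2) (consChain R.hEl a) - W (n + 1) (consChain (R.d (a 0)) (fun t => a (t + 1))) +
      contractHead R s n W a +
      barWord R s n (fun m b => W (m + 1) (consChain (s (a 0)) b)) (fun t => a (t + 1))

/-- `W n` is additive in each of the first `n` entries of a word. -/
def IsAdditiveWord (R : CurvedDGA k Γ) (W : ℕ → (ℕ → R.A) → M) : Prop :=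
  ∀ n i, i < n → ∀ (a : ℕ → R.A) (x y : R.A),
    W n (Function.update a i (x + y)) = W n (Function.update a i x) + W n (Function.update a i y)

namespace IsAdditiveWord

variable {W : ℕ → (ℕ → R.A) → M}

lemma cons (hW : IsAdditiveWord R W) (x : R.A) :
    IsAdditiveWord R (fun m b => W (m + 1) (consChain x b)) := by
  intro n i hi a y z
  simpa only [update_consChain_succ] using hW (n + 1) (i + 1) (by omega) (consChain x a) y z

lemma cons_add (hW : IsAdditiveWord R W) (n : ℕ) (x y : R.A) (b : ℕ → R.A) :
    W (n + 1) (consChain (x + y) b) = W (n + 1) (consChain x b) + W (n + 1) (consChain y b) := by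
  simpa only [update_consChain_zero] using hW (n + 1) 0 (by omega) (consChain x b) x y

lemma cons_zero (hW : IsAdditiveWord R W) (n : ℕ) (b : ℕ → R.A) :
    W (n + 1) (consChain 0 b) = 0 := by
  simpa using hW.cons_add n 0 0 b

lemma cons_neg (hW : IsAdditiveWord R W) (n : ℕ) (x : R.A) (b : ℕ → R.A) :
    W (n + 1) (consChain (-x) b) = -W (n + 1) (consChain x b) := by
  rw [eq_neg_iff_add_eq_zero, ← hW.cons_add, neg_add_cancel, hW.cons_zero]

lemma cons_sub (hW : IsAdditiveWord R W) (n : ℕ) (x y : R.A) (b : ℕ → R.A) :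
    W (n + 1) (consChain (x - y) b) = W (n + 1) (consChain x b) - W (n + 1) (consChain y b) := by
  rw [sub_eq_add_neg, hW.cons_add, hW.cons_neg, sub_eq_add_neg]

end IsAdditiveWord

variable (s : R.A → R.A)

lemma barWord_zero (W : ℕ → (ℕ → R.A) → M) (a : ℕ → R.A) :
    barWord R s 0 W a = W 1 (consChain R.hEl a) := rfl

lemma barWord_succ (n : ℕ) (W : ℕ → (ℕ → R.A) → M) (a : ℕ → R.A) :
    barWord R s (n + 1) W a =
      W (n + 2) (consChain R.hEl a) - W (n + 1) (consChain (R.d (a 0)) (fun t => a (t + 1))) +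
        contractHead R s n W a +
        barWord R s n (fun m b => W (m + 1) (consChain (s (a 0)) b)) (fun t => a (t + 1)) := rfl

lemma contractHead_zero (W : ℕ → (ℕ → R.A) → M) (a : ℕ → R.A) :
    contractHead R s 0 W a = 0 := rfl

lemma contractHead_succ (n : ℕ) (W : ℕ → (ℕ → R.A) → M) (a : ℕ → R.A) :
    contractHead R s (n + 1) W a =
      W (n + 1) (consChain (s (a 0) * a 1) (fun t => a (t + 2))) := rfl

lemma barWord_map {N : Type} [AddCommGroup N] (θ : M →+ N) (n : ℕ)
    (W : ℕ → (ℕ → R.A) → M) (a : ℕ → R.A) :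
    θ (barWord R s n W a) = barWord R s n (fun m b => θ (W m b)) a := by
  induction n generalizing W a with
  | zero => rfl
  | succ n ih =>
    rw [barWord_succ, barWord_succ, map_add, map_add, map_sub, ih]
    rcases n with _ | n
    · rw [contractHead_zero, contractHead_zero, map_zero]
    · rfl

lemma barWord_add (n : ℕ) (V W : ℕ → (ℕ → R.A) → M) (a : ℕ → R.A) :
    barWord R s n (fun m b => V m b + W m b) a = barWord R s n V a + barWord R s n W a := by
  induction n generalizing V W a with
  | zero => rfl
  | succ n ih =>
    rw [barWord_succ, barWord_succ, barWord_succ, ih]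
    rcases n with _ | n
    · simp only [contractHead_zero]; abel
    · simp only [contractHead_succ]; abel

lemma barWord_neg (n : ℕ) (W : ℕ → (ℕ → R.A) → M) (a : ℕ → R.A) :
    barWord R s n (fun m b => -W m b) a = -barWord R s n W a :=
  (barWord_map s (-AddMonoidHom.id M) n W a).symm

lemma barWord_sub (n : ℕ) (V W : ℕ → (ℕ → R.A) → M) (a : ℕ → R.A) :
    barWord R s n (fun m b => V m b - W m b) a = barWord R s n V a - barWord R s n W a := by
  simp only [sub_eq_add_neg, barWord_add, barWord_neg]

lemma barWord_contractHead (hss : ∀ x, s (s x) = x)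
    (hsd : ∀ x, s (R.d x) = -R.d (s x)) (hsm : ∀ x y, s (x * y) = -(s x * s y))
    (hd : ∀ x y, R.d (s x * y) = R.d (s x) * y - x * R.d y)
    (n : ℕ) (W : ℕ → (ℕ → R.A) → M) (hW : IsAdditiveWord R W) (x : R.A) (b : ℕ → R.A) :
    barWord R s n (fun m c => contractHead R s m W (consChain (s x) c)) b =
      W (n + 1) (consChain (x * R.hEl) b) +
        contractHead R s n (fun m c => W (m + 1) (consChain R.hEl c)) (consChain x b) +
        contractHead R s n W (consChain (R.d x) b) -
        contractHead R s n (fun m c => barWord R s m W c) (consChain x b) := by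
  rcases n with _ | n
  · rw [barWord_zero, contractHead_succ]
    simp only [contractHead_zero, consChain_zero, consChain_succ, hss]
    abel
  · have h₁ : barWord R s n (fun m c => contractHead R s (m + 1) W
          (consChain (s x) (consChain (s (b 0)) c))) (fun t => b (t + 1)) =
        -barWord R s n (fun m c => W (m + 1) (consChain (s (s x * b 0)) c))
          (fun t => b (t + 1)) := by
      rw [← barWord_neg]
      congr 1
      funext m c
      rw [contractHead_succ, consChain_zero, consChain_one, consChain_zero, hss, hsm, hss,
        hW.cons_neg, neg_neg]
      rfl
    have h₂ : contractHead R s n (fun m c => contractHead R s m W (consChain (s x) c)) b =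
        -contractHead R s n W (consChain (s x * b 0) (fun t => b (t + 1))) := by
      rcases n with _ | n
      · simp only [contractHead_zero, neg_zero]
      · simp only [contractHead_succ, consChain_zero, consChain_succ, hss, hsm,
          neg_mul, hW.cons_neg, neg_neg, mul_assoc]
    rw [barWord_succ, h₁, h₂]
    simp only [contractHead_succ, consChain_zero, consChain_succ]
    rw [barWord_succ]
    simp only [consChain_zero, consChain_succ, hsd, hss, hd, neg_mul, hW.cons_neg, hW.cons_sub]
    abel

lemma barWord_barWord (hss : ∀ x, s (s x) = x)
    (hsd : ∀ x, s (R.d x) = -R.d (s x)) (hsh : s R.hEl = -R.hEl)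
    (hsm : ∀ x y, s (x * y) = -(s x * s y))
    (hd : ∀ x y, R.d (s x * y) = R.d (s x) * y - x * R.d y)
    (n : ℕ) (W : ℕ → (ℕ → R.A) → M) (hW : IsAdditiveWord R W) (a : ℕ → R.A) :
    barWord R s n (fun m b => barWord R s m W b) a = 0 := by
  induction n generalizing W a with
  | zero =>
    simp only [barWord_zero, barWord_succ, consChain_succ, consChain_zero, contractHead_zero,
      R.d_h, hsh, hW.cons_neg, hW.cons_zero]
    abel
  | succ n ih =>
    have h₁ : (fun m b => barWord R s (m + 1) W (consChain (s (a 0)) b)) = fun m b =>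
        W (m + 2) (consChain R.hEl (consChain (s (a 0)) b)) -
          W (m + 1) (consChain (R.d (s (a 0))) b) + contractHead R s m W (consChain (s (a 0)) b) +
          barWord R s m (fun m b => W (m + 1) (consChain (a 0) b)) b := by
      funext m b
      rw [barWord_succ]
      simp only [consChain_zero, consChain_succ, hss]
    have h₂ : barWord R s (n + 2) W (consChain R.hEl a) =
        W (n + 2) (consChain R.hEl (consChain (R.d (a 0)) (fun t => a (t + 1)))) -
          W (n + 1) (consChain (R.hEl * a 0) (fun t => a (t + 1))) -
          contractHead R s n (fun m b => W (m + 1) (consChain R.hEl b)) a -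
          barWord R s n (fun m b => W (m + 2) (consChain R.hEl (consChain (s (a 0)) b)))
            (fun t => a (t + 1)) := by
      rw [barWord_succ]
      simp only [consChain_zero, consChain_succ, hsh, hW.cons_neg, R.d_h,
        hW.cons_zero, contractHead_succ, neg_mul, barWord_neg]
      rw [barWord_succ]
      abel
    have h₃ : barWord R s (n + 1) W (consChain (R.d (a 0)) (fun t => a (t + 1))) =
        W (n + 2) (consChain R.hEl (consChain (R.d (a 0)) (fun t => a (t + 1)))) -
          W (n + 1) (consChain (R.hEl * a 0) (fun t => a (t + 1))) +
          W (n + 1) (consChain (a 0 * R.hEl) (fun t => a (t + 1))) +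
          contractHead R s n W (consChain (R.d (a 0)) (fun t => a (t + 1))) -
          barWord R s n (fun m b => W (m + 1) (consChain (R.d (s (a 0))) b))
            (fun t => a (t + 1)) := by
      rw [barWord_succ]
      simp only [consChain_zero, consChain_succ, hsd, R.d_sq, hW.cons_sub, hW.cons_neg,
        barWord_neg]
      abel
    rw [barWord_succ, h₁, h₂, h₃, barWord_add, ih _ (hW.cons _), barWord_add, barWord_sub,
      barWord_contractHead s hss hsd hsm hd n W hW, consChain_tail]
    abel

end BarWord

lemma barWord_congr (s : R.A → R.A) (hs : ∀ (γ : Γ) (x : R.A), x ∈ R.deg γ → s x ∈ R.deg γ)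
    {M : Type} [AddCommGroup M] {V W : ℕ → (ℕ → R.A) → M}
    (h : ∀ n a g, R.HomogBar n g a → V n a = W n a)
    (n : ℕ) (a : ℕ → R.A) (g : ℕ → Γ) (ha : R.HomogBar n g a) :
    barWord R s n V a = barWord R s n W a := by
  have hcons : ∀ {n : ℕ} {γ : Γ} {g : ℕ → Γ} {x : R.A} {a : ℕ → R.A}, x ∈ R.deg γ →
      R.HomogBar n g a → R.HomogBar (n + 1) (consChain γ g) (consChain x a) := by
    intro n γ g x a hx ha i hi
    cases i with
    | zero => exact hx
    | succ i => exact ha i (by omega)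
  induction n generalizing V W a g with
  | zero => exact h _ _ _ (hcons R.h_deg ha)
  | succ n ih =>
    rw [barWord_succ, barWord_succ, h _ _ _ (hcons R.h_deg ha),
      h _ _ _ (hcons (R.d_deg (ha 0 (by omega))) ha.tail),
      ih (fun m b g' hb => h _ _ _ (hcons (hs _ _ (ha 0 (by omega))) hb)) _ _ ha.tail]
    congr 2
    rcases n with _ | n
    · rfl
    · exact h _ _ _ (hcons (R.mul_mem (hs _ _ (ha 0 (by omega))) (ha 1 (by omega)))
        ha.tail.tail)

lemma barWord_eq_sum (s : R.A → R.A)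
    (hs : ∀ (γ : Γ) (x : R.A), x ∈ R.deg γ → s x = zsign k (par γ + 1) • x)
    {M : Type} [AddCommGroup M] [Module k M] {W : ℕ → (ℕ → R.A) → M}
    (hW : ∀ n i, i < n → ∀ (a : ℕ → R.A) (c : k) (x : R.A),
      W n (Function.update a i (c • x)) = c • W n (Function.update a i x))
    (n : ℕ) (a : ℕ → R.A) (g : ℕ → Γ) (ha : R.HomogBar n g a) :
    barWord R s n W a =
      ∑ j ∈ range (n + 1), zsign k (barPar g j) • W (n + 1) (insertAt a j R.hEl) +
      ∑ j ∈ range n, zsign k (barPar g j + 1) • W n (Function.update a j (R.d (a j))) +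
      ∑ j ∈ range (n - 1), zsign k (barPar g (j + 1)) • W (n - 1) (contractChain a j) := by
  have hcons : ∀ (W : ℕ → (ℕ → R.A) → M), (∀ n i, i < n → ∀ (a : ℕ → R.A) (c : k) (x : R.A),
      W n (Function.update a i (c • x)) = c • W n (Function.update a i x)) →
      ∀ (n : ℕ) (c : k) (x : R.A) (b : ℕ → R.A), W (n + 1) (consChain (c • x) b) = c • W (n + 1) (consChain x b) := by
    intro W hW n c x b
    simpa only [update_consChain_zero] using hW (n + 1) 0 (by omega) (consChain x b) c x
  induction n generalizing W a g with
  | zero =>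
    simp [barWord_zero, barPar_zero, zsign_zero, insertAt_zero]
  | succ n ih =>
    have hW' : ∀ n i, i < n → ∀ (b : ℕ → R.A) (c : k) (x : R.A),
        W (n + 1) (consChain (a 0) (Function.update b i (c • x))) =
          c • W (n + 1) (consChain (a 0) (Function.update b i x)) := by
      intro n i hi b c x
      simpa only [update_consChain_succ] using hW (n + 1) (i + 1) (by omega) (consChain (a 0) b) c x
    have h₁ : (fun m b => W (m + 1) (consChain (s (a 0)) b)) = fun m b =>
        (DistribSMul.toAddMonoidHom M (zsign k (par (g 0) + 1)))
          (W (m + 1) (consChain (a 0) b)) := by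
      funext m b
      rw [hs _ _ (ha 0 (by omega)), hcons W hW]
      rfl
    rw [barWord_succ, h₁, ← barWord_map, ih hW' _ _ ha.tail, DistribSMul.toAddMonoidHom_apply,
      sum_range_succ' _ (n + 1),
      sum_range_succ' (fun j => zsign k (barPar g j + 1) • _)]
    have h₂ : ∀ j, insertAt a (j + 1) R.hEl =
        consChain (a 0) (insertAt (fun t => a (t + 1)) j R.hEl) := fun j => by
      rw [← insertAt_consChain, consChain_tail]
    have h₃ : ∀ j, Function.update a (j + 1) (R.d (a (j + 1))) =
        consChain (a 0) (Function.update (fun t => a (t + 1)) j (R.d (a (j + 1)))) := fun j => by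
      rw [← update_consChain_succ, consChain_tail]
    have h₄ : ∀ j, contractChain a (j + 1) =
        consChain (a 0) (contractChain (fun t => a (t + 1)) j) := fun j => by
      rw [← contractChain_consChain, consChain_tail]
    have h₅ : Function.update a 0 (R.d (a 0)) = consChain (R.d (a 0)) (fun t => a (t + 1)) := by
      rw [← update_consChain_zero (a 0), consChain_tail]
    have h₆ : ∀ j, zsign k (barPar g (j + 1)) =
        zsign k (par (g 0) + 1) * zsign k (barPar (fun t => g (t + 1)) j) := fun j => by
      rw [← zsign_add, barPar_succ', add_comm]
    have h₇ : ∀ j, zsign k (barPar g (j + 1) + 1) =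
        zsign k (par (g 0) + 1) * zsign k (barPar (fun t => g (t + 1)) j + 1) := fun j => by
      rw [← zsign_add, barPar_succ', add_comm _ (par (g 0) + 1), add_assoc]
    rcases n with _ | n
    · simp [contractHead_zero, h₂, h₅, h₆, mul_smul, barPar_zero, zsign_zero, zsign_one,
        insertAt_zero]
      abel
    · simp only [Nat.add_sub_cancel]
      rw [sum_range_succ' (fun j => zsign k (barPar g (j + 1)) • W (n + 1) (contractChain a j))]
      simp only [h₂, h₃, h₄, h₆, h₇, h₅, mul_smul, ← smul_sum, smul_add, barPar_zero, zsign_zero,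
        insertAt_zero, one_smul, zero_add, zsign_one, neg_smul, contractHead_succ,
        contractChain_zero, hs _ _ (ha 0 (by omega)), smul_mul_assoc, hcons W hW]
      abel

/-- The coderivation `δ_T` on `∏ₙ Tₙ`. -/
def barDelta (P : BarParts k Γ R) : (∀ n, P.T n) →ₗ[k] (∀ n, P.T n) :=
  LinearMap.pi fun n => P.d2 n ∘ₗ LinearMap.proj (n + 1) + P.d1 n ∘ₗ LinearMap.proj n +
    (match n with
      | 0 => 0
      | m + 1 => P.d0 m ∘ₗ LinearMap.proj m)

lemma barDelta_single_zero (P : BarParts k Γ R) (x : P.T 0) :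
    barDelta P (Pi.single 0 x) = Pi.single 1 (P.d0 0 x) + Pi.single 0 (P.d1 0 x) := by
  funext m
  rcases m with _ | _ | m <;> simp [barDelta]

lemma barDelta_single_succ (P : BarParts k Γ R) (n : ℕ) (x : P.T (n + 1)) :
    barDelta P (Pi.single (n + 1) x) = Pi.single (n + 2) (P.d0 (n + 1) x) +
      Pi.single (n + 1) (P.d1 (n + 1) x) + Pi.single n (P.d2 n x) := by
  funext m
  by_cases h₀ : m = n
  · subst h₀
    rcases m with _ | m <;> simp (disch := omega) [barDelta, Pi.single_eq_of_ne]
  by_cases h₁ : m = n + 1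
  · subst h₁
    simp [barDelta]
  by_cases h₂ : m = n + 2
  · subst h₂
    simp [barDelta]
  rcases m with _ | m
  · simp (disch := omega) [barDelta, Pi.single_eq_of_ne]
  · simp (disch := omega) [barDelta, Pi.single_eq_of_ne]

/-- The word `[a₀|⋯|a_{n−1}]` as an element of `∏ₙ Tₙ`. -/
def barElt (P : BarParts k Γ R) (n : ℕ) (a : ℕ → R.A) : ∀ n, P.T n := Pi.single n (P.tgen n a)

lemma barDelta_barElt (P : BarParts k Γ R) (s : R.A → R.A)
    (hs : ∀ (γ : Γ) (x : R.A), x ∈ R.deg γ → s x = zsign k (par γ + 1) • x)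
    (n : ℕ) (a : ℕ → R.A) (g : ℕ → Γ) (ha : R.HomogBar n g a) :
    barDelta P (barElt P n a) = barWord R s n (barElt P) a := by
  have hsum : ∀ (n m : ℕ) (c : ℕ → k) (f : ℕ → P.T m),
      Pi.single (M := P.T) m (∑ j ∈ range n, c j • f j) = ∑ j ∈ range n, c j • Pi.single m (f j) := by
    intro n m c f
    change LinearMap.single k P.T m _ = _
    simp only [map_sum, map_smul]
    rfl
  rw [barWord_eq_sum s hs (fun n i hi a c x => by
    simp only [barElt]; rw [P.tgen_smul n a i hi, Pi.single_smul]) n a g ha]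
  rcases n with _ | n
  · rw [barElt, barDelta_single_zero, P.d0_gen _ _ _ ha, P.d1_gen _ _ _ ha, hsum, hsum]
    simp [barElt, gsign_eq, par_degSum_sub]
  · rw [barElt, barDelta_single_succ, P.d0_gen _ _ _ ha, P.d1_gen _ _ _ ha, P.d2_gen _ _ _ ha,
      hsum, hsum, hsum]
    simp only [gsign_eq, par_degSum_sub, par_degSum_sub_succ]
    rfl

/-! ### The parity operator on `A` -/

lemma homogeneous_induction (hA : Submodule.span k {x : R.A | ∃ γ, x ∈ R.deg γ} = ⊤)
    {p : R.A → Prop} (mem : ∀ γ x, x ∈ R.deg γ → p x) (hadd : ∀ x y, p x → p y → p (x + y))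
    (smul : ∀ (c : k) x, p x → p (c • x)) (x : R.A) : p x := by
  have hx : x ∈ Submodule.span k {x : R.A | ∃ γ, x ∈ R.deg γ} := by rw [hA]; trivial
  induction hx using Submodule.span_induction with
  | mem x h => exact mem _ _ h.choose_spec
  | zero => exact mem 0 0 (zero_mem _)
  | add x y _ _ hx hy => exact hadd x y hx hy
  | smul c x _ hx => exact smul c x hx

lemma IsSgnA.apply_one {sgnA : ZMod 2 → R.A →ₗ[k] R.A} (hσ : IsSgnA R sgnA) {γ : Γ} {x : R.A}
    (hx : x ∈ R.deg γ) : sgnA 1 x = zsign k (par γ) • x := by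
  rw [hσ 1 x hx, psign_eq, one_mul]

lemma zsign_mul_self (k : Type) [Field k] (z : ZMod 2) : zsign k z * zsign k z = 1 := by
  rw [← zsign_add, CharTwo.add_self_eq_zero, zsign_zero]

section Sgn

variable {sgnA : ZMod 2 → R.A →ₗ[k] R.A} (hσ : IsSgnA R sgnA)
  (hA : Submodule.span k {x : R.A | ∃ γ, x ∈ R.deg γ} = ⊤)

include hσ

lemma sgnA_hEl : sgnA 1 R.hEl = R.hEl := by
  rw [hσ.apply_one R.h_deg, par_two, zsign_zero, one_smul]

include hA

lemma sgnA_sgnA (x : R.A) : sgnA 1 (sgnA 1 x) = x := by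
  induction x using homogeneous_induction hA with
  | mem γ x hx => rw [hσ.apply_one hx, map_smul, hσ.apply_one hx, smul_smul, zsign_mul_self, one_smul]
  | hadd x y hx hy => rw [map_add, map_add, hx, hy]
  | smul c x hx => rw [map_smul, map_smul, hx]

lemma sgnA_d (x : R.A) : sgnA 1 (R.d x) = -R.d (sgnA 1 x) := by
  induction x using homogeneous_induction hA with
  | mem γ x hx =>
    rw [hσ.apply_one hx, hσ.apply_one (R.d_deg hx), par_add, par_one, zsign_add, zsign_one,
      map_smul, mul_neg_one, neg_smul]
  | hadd x y hx hy => rw [map_add, map_add, hx, hy, map_add, map_add, neg_add]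
  | smul c x hx => rw [map_smul, map_smul, hx, map_smul, map_smul, smul_neg]

lemma sgnA_mul (x y : R.A) : sgnA 1 (x * y) = sgnA 1 x * sgnA 1 y := by
  induction x using homogeneous_induction hA with
  | mem γ x hx =>
    induction y using homogeneous_induction hA with
    | mem γ' y hy =>
      rw [hσ.apply_one hx, hσ.apply_one hy, hσ.apply_one (R.mul_mem hx hy), par_add, zsign_add,
        smul_mul_smul_comm]
    | hadd y z hy hz => rw [mul_add, map_add, map_add, hy, hz, mul_add]
    | smul c y hy => rw [mul_smul_comm, map_smul, map_smul, hy, mul_smul_comm]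
  | hadd x z hx hz => rw [add_mul, map_add, map_add, hx, hz, add_mul]
  | smul c x hx => rw [smul_mul_assoc, map_smul, map_smul, hx, smul_mul_assoc]

lemma d_mul (x y : R.A) : R.d (x * y) = R.d x * y + sgnA 1 x * R.d y := by
  induction x using homogeneous_induction hA with
  | mem γ x hx => rw [R.d_leibniz hx, hσ.apply_one hx, smul_mul_assoc]; rfl
  | hadd x z hx hz => simp only [add_mul, map_add, hx, hz]; abel
  | smul c x hx => simp only [smul_mul_assoc, map_smul, hx, smul_add]

/-! ### The components of `δ_T² = 0` -/

lemma barDelta_barDelta (P : BarParts k Γ R) (n : ℕ) (x : P.T n) :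
    barDelta P (barDelta P (Pi.single n x)) = 0 := by
  have hs : ∀ (γ : Γ) (x : R.A), x ∈ R.deg γ → -sgnA 1 x = zsign k (par γ + 1) • x := by
    intro γ x hx
    rw [hσ.apply_one hx, zsign_add, zsign_one, mul_neg_one, neg_smul]
  suffices h : barDelta P ∘ₗ barDelta P ∘ₗ LinearMap.single k P.T n = 0 from
    LinearMap.congr_fun h x
  refine LinearMap.ext_on (P.span_tgen n) ?_
  rintro _ ⟨a, g, ha, rfl⟩
  change barDelta P (barDelta P (barElt P n a)) = 0
  rw [barDelta_barElt P (fun x => -sgnA 1 x) hs n a g ha]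
  have h₁ := barWord_map (fun x => -sgnA 1 x) (barDelta P).toAddMonoidHom n (barElt P) a
  rw [LinearMap.toAddMonoidHom_coe] at h₁
  rw [h₁, barWord_congr (fun x => -sgnA 1 x)
    (fun γ x hx => by rw [hs γ x hx]; exact (R.deg γ).smul_mem _ hx)
    (fun m b g' hb => barDelta_barElt P (fun x => -sgnA 1 x) hs m b g' hb) n a g ha]
  refine barWord_barWord (fun x => -sgnA 1 x) ?_ ?_ ?_ ?_ ?_ n (barElt P) ?_ a
  · intro x; rw [map_neg, neg_neg, sgnA_sgnA hσ hA]
  · intro x; rw [sgnA_d hσ hA, map_neg]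
  · rw [sgnA_hEl hσ]
  · intro x y; rw [sgnA_mul hσ hA, neg_mul_neg]
  · intro x y; rw [d_mul hσ hA]; simp only [map_neg, neg_mul, sgnA_sgnA hσ hA]; abel
  · intro n i hi a x y
    rw [barElt, P.tgen_add n a i hi, Pi.single_add]; rfl

variable (P : BarParts k Γ R)

lemma d0_d0 (n : ℕ) (x : P.T n) : P.d0 (n + 1) (P.d0 n x) = 0 := by
  have h := congr_fun (barDelta_barDelta hσ hA P n x) (n + 2)
  rcases n with _ | n
  · simpa [barDelta] using h
  · simpa (disch := omega) [barDelta, Pi.single_eq_of_ne] using h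

lemma d1_d0 (n : ℕ) (x : P.T n) : P.d1 (n + 1) (P.d0 n x) + P.d0 n (P.d1 n x) = 0 := by
  have h := congr_fun (barDelta_barDelta hσ hA P n x) (n + 1)
  rcases n with _ | n
  · simpa [barDelta] using h
  · simpa (disch := omega) [barDelta, Pi.single_eq_of_ne] using h

lemma d2_d0_zero (x : P.T 0) : P.d2 0 (P.d0 0 x) + P.d1 0 (P.d1 0 x) = 0 := by
  have h := congr_fun (barDelta_barDelta hσ hA P 0 x) 0
  simpa [barDelta] using h

lemma d2_d0_succ (n : ℕ) (x : P.T (n + 1)) :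
    P.d2 (n + 1) (P.d0 (n + 1) x) + P.d1 (n + 1) (P.d1 (n + 1) x) + P.d0 n (P.d2 n x) = 0 := by
  have h := congr_fun (barDelta_barDelta hσ hA P (n + 1) x) (n + 1)
  rcases n with _ | n
  · simpa [barDelta] using h
  · simpa (disch := omega) [barDelta, Pi.single_eq_of_ne] using h

lemma d2_d1 (n : ℕ) (x : P.T (n + 1)) : P.d2 n (P.d1 (n + 1) x) + P.d1 n (P.d2 n x) = 0 := by
  have h := congr_fun (barDelta_barDelta hσ hA P (n + 1) x) n
  rcases n with _ | _ | n
  · simpa [barDelta] using h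
  · simpa (disch := omega) [barDelta, Pi.single_eq_of_ne] using h
  · simpa (disch := omega) [barDelta, Pi.single_eq_of_ne] using h

lemma d2_d2 (n : ℕ) (x : P.T (n + 2)) : P.d2 n (P.d2 (n + 1) x) = 0 := by
  have h := congr_fun (barDelta_barDelta hσ hA P (n + 2) x) n
  rcases n with _ | _ | n
  · simpa [barDelta] using h
  · simpa (disch := omega) [barDelta, Pi.single_eq_of_ne] using h
  · simpa (disch := omega) [barDelta, Pi.single_eq_of_ne] using h

end Sgn
/-! ### Formulas on generators -/

lemma smul_mul_tmul {M : Type} [AddCommGroup M] [Module k M] (c : k) (x y : R.A) (t : M) :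
    ((c • x) * y) ⊗ₜ[k] t = c • ((x * y) ⊗ₜ[k] t) := by
  rw [smul_mul_assoc, TensorProduct.smul_tmul']

lemma dOt2_tmul_tgen (P : BarParts k Γ R) {sgnA : ZMod 2 → R.A →ₗ[k] R.A} {n : ℕ} {z : ZMod 2}
    {x : R.A} {a : ℕ → R.A} {g : ℕ → Γ} (hx : sgnA 1 x = zsign k z • x)
    (ha : R.HomogBar (n + 1) g a) :
    dOt2 P sgnA n (x ⊗ₜ[k] P.tgen (n + 1) a) = ∑ j ∈ range n,
      zsign k (z + barPar g (j + 1)) • (x ⊗ₜ[k] P.tgen n (contractChain a j)) := by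
  rw [dOt2, TensorProduct.map_tmul, hx, P.d2_gen n a g ha, TensorProduct.tmul_sum]
  refine sum_congr rfl fun j _ => ?_
  rw [gsign_eq, par_degSum_sub, TensorProduct.tmul_smul, ← TensorProduct.smul_tmul', smul_smul,
    ← zsign_add, add_comm]

lemma dOt1_tmul_tgen (P : BarParts k Γ R) {sgnA : ZMod 2 → R.A →ₗ[k] R.A} {n : ℕ} {z : ZMod 2}
    {x : R.A} {a : ℕ → R.A} {g : ℕ → Γ} (hx : sgnA 1 x = zsign k z • x)
    (ha : R.HomogBar n g a) :
    dOt1 P sgnA n (x ⊗ₜ[k] P.tgen n a) = R.d x ⊗ₜ[k] P.tgen n a + ∑ j ∈ range n,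
      zsign k (z + (barPar g j + 1)) •
        (x ⊗ₜ[k] P.tgen n (Function.update a j (R.d (a j)))) := by
  rw [dOt1, LinearMap.add_apply, TensorProduct.map_tmul, TensorProduct.map_tmul, hx,
    P.d1_gen n a g ha, TensorProduct.tmul_sum, LinearMap.id_apply]
  congr 1
  refine sum_congr rfl fun j _ => ?_
  rw [gsign_eq, par_degSum_sub_succ, TensorProduct.tmul_smul, ← TensorProduct.smul_tmul',
    smul_smul, ← zsign_add, add_comm]

lemma dOt0_tmul_tgen (P : BarParts k Γ R) {sgnA : ZMod 2 → R.A →ₗ[k] R.A} {n : ℕ} {z : ZMod 2}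
    {x : R.A} {a : ℕ → R.A} {g : ℕ → Γ} (hx : sgnA 1 x = zsign k z • x)
    (ha : R.HomogBar n g a) :
    dOt0 P sgnA n (x ⊗ₜ[k] P.tgen n a) = ∑ j ∈ range (n + 1),
      zsign k (z + barPar g j) • (x ⊗ₜ[k] P.tgen (n + 1) (insertAt a j R.hEl)) := by
  rw [dOt0, TensorProduct.map_tmul, hx, P.d0_gen n a g ha, TensorProduct.tmul_sum]
  refine sum_congr rfl fun j _ => ?_
  rw [gsign_eq, par_degSum_sub, TensorProduct.tmul_smul, ← TensorProduct.smul_tmul', smul_smul,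
    ← zsign_add, add_comm z]

section Lact

variable {P : BarParts k Γ R}
  {lact : ZMod 2 → (∀ n, P.T n →ₗ[k] R.A) → (n i : ℕ) →
    (R.A ⊗[k] P.T n) →ₗ[k] (R.A ⊗[k] P.T i)} (hL : IsLact P lact)

include hL

lemma IsLact.apply_tgen {p : ZMod 2} {f : ∀ n, P.T n →ₗ[k] R.A} {n m l : ℕ} (h : n = m + l)
    {γ₀ : Γ} {a₀ : R.A} {a : ℕ → R.A} {g : ℕ → Γ} (h₀ : a₀ ∈ R.deg γ₀)
    (ha : R.HomogBar n g a) :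
    lact p f n m (a₀ ⊗ₜ[k] P.tgen n a) =
      zsign k ((par γ₀ + barPar g m) * barPar (fun t => g (t + m)) l) •
        ((f l (P.tgen l (fun t => a (t + m))) * a₀) ⊗ₜ[k] P.tgen m a) := by
  subst h
  rw [hL.2 p f (m + l) m γ₀ a₀ a g h₀ ha (by omega), Nat.add_sub_cancel_left, gsign2_eq, par_add,
    par_degSum_sub]
  congr 4
  rw [sum_Ico_eq_sum_range, Nat.add_sub_cancel_left, ← par_degSum_sub]
  simp only [degSum, add_comm m]

variable (hA : Submodule.span k {x : R.A | ∃ γ, x ∈ R.deg γ} = ⊤)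

include hA

lemma IsLact.eq_zero {p : ZMod 2} {f : ∀ n, P.T n →ₗ[k] R.A} {n m l : ℕ} (h : n = m + l)
    (hf : f l = 0) : lact p f n m = 0 :=
  tensor_hom_ext P hA fun γ₀ a₀ a g h₀ ha => by
    rw [hL.apply_tgen h h₀ ha, hf]; simp

lemma IsLact.congr (p q : ZMod 2) {f f' : ∀ n, P.T n →ₗ[k] R.A} {n m l : ℕ} (h : n = m + l)
    (hf : f l = f' l) : lact p f n m = lact q f' n m :=
  tensor_hom_ext P hA fun γ₀ a₀ a g h₀ ha => by
    rw [hL.apply_tgen h h₀ ha, hL.apply_tgen h h₀ ha, hf]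

lemma IsLact.map_add (p : ZMod 2) (f f' : ∀ n, P.T n →ₗ[k] R.A) (n m : ℕ) :
    lact p (f + f') n m = lact p f n m + lact p f' n m := by
  rcases lt_or_ge n m with h | h
  · simp [hL.1 _ _ _ _ h]
  obtain ⟨l, rfl⟩ := Nat.exists_eq_add_of_le h
  refine tensor_hom_ext P hA fun γ₀ a₀ a g h₀ ha => ?_
  rw [LinearMap.add_apply, hL.apply_tgen rfl h₀ ha, hL.apply_tgen rfl h₀ ha,
    hL.apply_tgen rfl h₀ ha, Pi.add_apply, LinearMap.add_apply, add_mul (f l _), TensorProduct.add_tmul,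
    smul_add]

lemma IsLact.map_smul (p : ZMod 2) (c : k) (f : ∀ n, P.T n →ₗ[k] R.A) (n m : ℕ) :
    lact p (c • f) n m = c • lact p f n m := by
  rcases lt_or_ge n m with h | h
  · simp [hL.1 _ _ _ _ h]
  obtain ⟨l, rfl⟩ := Nat.exists_eq_add_of_le h
  refine tensor_hom_ext P hA fun γ₀ a₀ a g h₀ ha => ?_
  rw [LinearMap.smul_apply, hL.apply_tgen rfl h₀ ha, hL.apply_tgen rfl h₀ ha, Pi.smul_apply,
    LinearMap.smul_apply, smul_mul_tmul, smul_comm]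

lemma IsLact.sub_apply (p : ZMod 2) (f f' : ∀ n, P.T n →ₗ[k] R.A) (n m : ℕ)
    (ω : R.A ⊗[k] P.T n) : lact p (f - f') n m ω = lact p f n m ω - lact p f' n m ω := by
  have h := hL.map_add hA p (f - f') f' n m
  rw [sub_add_cancel] at h
  rw [h, LinearMap.add_apply, add_sub_cancel_right]

end Lact

/-! ### The Leibniz rule for the left action -/

/-- `f` multiplies parities by `z`, as seen by the operator `sgnA` on homogeneous words. -/
def HasParity (P : BarParts k Γ R) (sgnA : ZMod 2 → R.A →ₗ[k] R.A) (z : ZMod 2)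
    (f : ∀ n, P.T n →ₗ[k] R.A) : Prop :=
  ∀ n a g, R.HomogBar n g a →
    sgnA 1 (f n (P.tgen n a)) = zsign k (barPar g n + z) • f n (P.tgen n a)

/-- The components of `f ∘ δ⁽²⁾`. -/
def compD2 (P : BarParts k Γ R) (f : ∀ n, P.T n →ₗ[k] R.A) : ∀ n, P.T n →ₗ[k] R.A
  | 0 => 0
  | n + 1 => f n ∘ₗ P.d2 n

/-- The components of `f ∘ δ⁽¹⁾`. -/
def compD1 (P : BarParts k Γ R) (f : ∀ n, P.T n →ₗ[k] R.A) : ∀ n, P.T n →ₗ[k] R.A :=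
  fun n => f n ∘ₗ P.d1 n

/-- The components of `f ∘ δ⁽⁰⁾`. -/
def compD0 (P : BarParts k Γ R) (f : ∀ n, P.T n →ₗ[k] R.A) : ∀ n, P.T n →ₗ[k] R.A :=
  fun n => f (n + 1) ∘ₗ P.d0 n

lemma compDelta_eq (P : BarParts k Γ R) (f : ∀ n, P.T n →ₗ[k] R.A) :
    compDelta P f = compD2 P f + compD1 P f + compD0 P f := by
  funext n
  rcases n with _ | n
  · simp [compDelta, compD2, compD1, compD0, add_comm]
  · rfl

section Leibniz

variable {P : BarParts k Γ R} {sgnA : ZMod 2 → R.A →ₗ[k] R.A} (hσ : IsSgnA R sgnA)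
  (hA : Submodule.span k {x : R.A | ∃ γ, x ∈ R.deg γ} = ⊤)
  {lact : ZMod 2 → (∀ n, P.T n →ₗ[k] R.A) → (n i : ℕ) →
    (R.A ⊗[k] P.T n) →ₗ[k] (R.A ⊗[k] P.T i)} (hL : IsLact P lact)
  {z : ZMod 2} {f : ∀ n, P.T n →ₗ[k] R.A} (hf : HasParity P sgnA z f) (p q : ZMod 2)

include hσ hA hf

lemma HasParity.mul {n : ℕ} {γ₀ : Γ} {a₀ : R.A} {a : ℕ → R.A} {g : ℕ → Γ} (h₀ : a₀ ∈ R.deg γ₀)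
    (ha : R.HomogBar n g a) :
    sgnA 1 (f n (P.tgen n a) * a₀) =
      zsign k (barPar g n + z + par γ₀) • (f n (P.tgen n a) * a₀) := by
  rw [sgnA_mul hσ hA, hf n a g ha, hσ.apply_one h₀, smul_mul_smul_comm, ← zsign_add]

include hL

lemma lact_dOt2 (n m : ℕ) :
    lact p f n m ∘ₗ dOt2 P sgnA n =
      zsign k z • (dOt2 P sgnA m ∘ₗ lact p f (n + 1) (m + 1)) +
        lact q (compD2 P f) (n + 1) m := by
  rcases lt_or_ge n m with h | h
  · rcases Nat.eq_or_lt_of_le (Nat.succ_le_of_lt h) with rfl | h'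
    · rw [hL.1 _ _ _ _ h, hL.1 _ _ _ _ (Nat.lt_succ_self _),
        hL.eq_zero hA (l := 0) (by omega) rfl]
      simp
    · rw [hL.1 _ _ _ _ h, hL.1 _ _ _ _ (by omega), hL.1 _ _ _ _ h']
      simp
  obtain ⟨l, rfl⟩ := Nat.exists_eq_add_of_le h
  refine tensor_hom_ext P hA fun γ₀ a₀ a g h₀ ha => ?_
  have hs := ha.mono (m := m + 1) (by omega)
  have ht : R.HomogBar l (fun t => g (t + (m + 1))) (fun t => a (t + (m + 1))) :=
    fun i hi => ha _ (by omega)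
  have ht' : R.HomogBar (l + 1) (fun t => g (t + m)) (fun t => a (t + m)) :=
    fun i hi => ha _ (by omega)
  rw [LinearMap.add_apply, LinearMap.smul_apply, LinearMap.comp_apply, LinearMap.comp_apply,
    dOt2_tmul_tgen P (hσ.apply_one h₀) ha, hL.apply_tgen (l := l) (by omega) h₀ ha,
    hL.apply_tgen (l := l + 1) (by omega) h₀ ha, map_smul,
    dOt2_tmul_tgen P (hf.mul hσ hA h₀ ht) hs, sum_range_add]
  simp only [map_add, map_sum, map_smul, smul_sum, smul_smul, ← zsign_add]
  congr 1
  · refine sum_congr rfl fun j hj => ?_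
    rw [mem_range] at hj
    rw [hL.apply_tgen (l := l) rfl h₀ (ha.contractChain j), smul_smul, ← zsign_add]
    have h₁ : (fun t => contractChain a j (t + m)) = fun t => a (t + (m + 1)) :=
      funext fun t => contractChain_shift_of_lt a hj t
    have h₂ : (fun t => contractDeg g j (t + m)) = fun t => g (t + (m + 1)) := by
      funext t
      simp only [contractDeg]; rw [if_neg (by omega), if_neg (by omega)]; rfl
    rw [h₁, h₂, barPar_contractDeg g hj]
    congr 2
    grind
  · rw [compD2, LinearMap.comp_apply, P.d2_gen l _ _ ht', map_sum, sum_mul,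
      TensorProduct.sum_tmul, smul_sum]
    refine sum_congr rfl fun i hi => ?_
    rw [mem_range] at hi
    rw [hL.apply_tgen (l := l) rfl h₀ (ha.contractChain (m + i)), smul_smul, ← zsign_add,
      map_smul, smul_mul_tmul, smul_smul, gsign_eq, par_degSum_sub, ← zsign_add]
    have h₁ : (fun t => contractChain a (m + i) (t + m)) =
        contractChain (fun t => a (t + m)) i := funext fun t => contractChain_shift a m i t
    have h₂ : (fun t => contractDeg g (m + i) (t + m)) = contractDeg (fun t => g (t + m)) i := by
      funext t
      simp only [contractDeg]
      split_ifs <;> first | rfl | omega | (congr 1; omega) | (congr 2 <;> omega)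
    have h₃ : P.tgen m (contractChain a (m + i)) = P.tgen m a :=
      P.tgen_ext fun t ht => contractChain_of_lt a (by omega)
    have h₄ : barPar (contractDeg g (m + i)) m = barPar g m :=
      barPar_congr fun t ht => if_pos (by omega)
    rw [h₁, h₂, h₃, h₄, barPar_contractDeg _ hi, add_assoc m, barPar_add]
    congr 2
    grind

lemma dOt1_lact (n m : ℕ) :
    dOt1 P sgnA m ∘ₗ lact p f n m + zsign k z • lact q (compD1 P f) n m =
      lact q (fun n => R.d ∘ₗ f n) n m + zsign k z • (lact p f n m ∘ₗ dOt1 P sgnA n) := by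
  rcases lt_or_ge n m with h | h
  · simp [hL.1 _ _ _ _ h]
  obtain ⟨l, rfl⟩ := Nat.exists_eq_add_of_le h
  refine tensor_hom_ext P hA fun γ₀ a₀ a g h₀ ha => ?_
  have hs := ha.mono (m := m) (by omega)
  have ht := ha.shift
  have hc : compD1 P f l (P.tgen l fun t => a (t + m)) = _ :=
    congrArg (f l) (P.d1_gen l _ _ ht)
  simp only [LinearMap.add_apply, LinearMap.smul_apply, LinearMap.comp_apply]
  rw [dOt1_tmul_tgen P (hσ.apply_one h₀) ha, hL.apply_tgen (l := l) rfl h₀ ha,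
    hL.apply_tgen (l := l) rfl h₀ ha, hL.apply_tgen (l := l) rfl h₀ ha, map_smul,
    dOt1_tmul_tgen P (hf.mul hσ hA h₀ ht) hs, sum_range_add, d_mul hσ hA, hf _ _ _ ht,
    map_add, hL.apply_tgen (l := l) rfl (R.d_deg h₀) ha, hc]
  simp only [map_add, map_sum, map_smul, smul_sum, smul_smul, ← zsign_add, smul_add,
    smul_mul_tmul, TensorProduct.add_tmul, sum_mul, TensorProduct.sum_tmul, gsign_eq,
    par_degSum_sub_succ, LinearMap.comp_apply]
  have h₁ : ∀ j ∈ range m, zsign k (z + (par γ₀ + (barPar g j + 1))) •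
      lact p f (m + l) m (a₀ ⊗ₜ[k] P.tgen (m + l) (Function.update a j (R.d (a j)))) =
      zsign k ((par γ₀ + barPar g m) * barPar (fun t => g (t + m)) l +
        (barPar (fun t => g (t + m)) l + z + par γ₀ + (barPar g j + 1))) •
        ((f l (P.tgen l (fun t => a (t + m))) * a₀) ⊗ₜ[k]
          P.tgen m (Function.update a j (R.d (a j)))) := by
    intro j hj
    rw [mem_range] at hj
    rw [hL.apply_tgen (l := l) rfl h₀ (ha.update (j := j) (by omega)), smul_smul, ← zsign_add]
    have h₂ : (fun t => Function.update a j (R.d (a j)) (t + m)) = fun t => a (t + m) :=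
      funext fun t => Function.update_of_ne (by omega) _ _
    have h₃ : (fun t => Function.update g j (g j + 1) (t + m)) = fun t => g (t + m) :=
      funext fun t => Function.update_of_ne (by omega) _ _
    rw [h₂, h₃, barPar_update g hj]
    congr 2
    grind
  have h₂ : ∀ i ∈ range l, zsign k (z + (par γ₀ + (barPar g (m + i) + 1))) •
      lact p f (m + l) m (a₀ ⊗ₜ[k] P.tgen (m + l)
        (Function.update a (m + i) (R.d (a (m + i))))) =
      zsign k (z + ((par γ₀ + barPar g m) * barPar (fun t => g (t + m)) l +
        (barPar (fun t => g (t + m)) i + 1))) •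
        ((f l (P.tgen l (Function.update (fun t => a (t + m)) i (R.d (a (i + m))))) * a₀) ⊗ₜ[k]
          P.tgen m a) := by
    intro i hi
    rw [mem_range] at hi
    rw [hL.apply_tgen (l := l) rfl h₀ (ha.update (j := m + i) (by omega)), smul_smul,
      ← zsign_add]
    have h₃ : (fun t => Function.update a (m + i) (R.d (a (m + i))) (t + m)) =
        Function.update (fun t => a (t + m)) i (R.d (a (i + m))) := by
      funext t
      rw [add_comm m i]
      by_cases h : t = i
      · subst h; simp
      · rw [Function.update_of_ne (by omega), Function.update_of_ne h]
    have h₄ : (fun t => Function.update g (m + i) (g (m + i) + 1) (t + m)) =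
        Function.update (fun t => g (t + m)) i (g (i + m) + 1) := by
      funext t
      rw [add_comm m i]
      by_cases h : t = i
      · subst h; simp
      · rw [Function.update_of_ne (by omega), Function.update_of_ne h]
    have h₅ : P.tgen m (Function.update a (m + i) (R.d (a (m + i)))) = P.tgen m a :=
      P.tgen_ext fun t ht => Function.update_of_ne (by omega) _ _
    have h₆ : barPar (Function.update g (m + i) (g (m + i) + 1)) m = barPar g m :=
      barPar_congr fun t ht => Function.update_of_ne (by omega) _ _
    rw [h₃, h₄, h₅, h₆, barPar_update _ hi, barPar_add]
    congr 2
    grind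
  rw [sum_congr rfl h₁, sum_congr rfl h₂]
  have h₃ : z + (GradingGroup.parity γ₀ + GradingGroup.parity (1 : Γ) + barPar g m) * barPar (fun t => g (t + m)) l =
      (par γ₀ + barPar g m) * barPar (fun t => g (t + m)) l +
        (barPar (fun t => g (t + m)) l + z) := by
    rw [show GradingGroup.parity (1 : Γ) = 1 from par_one]; ring
  rw [h₃]
  abel

omit hf in
lemma lact_dOt0_zero (n : ℕ) :
    lact p f (n + 1) 0 ∘ₗ dOt0 P sgnA n = lact q (compD0 P f) n 0 := by
  refine tensor_hom_ext P hA fun γ₀ a₀ a g h₀ ha => ?_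
  rw [LinearMap.comp_apply, dOt0_tmul_tgen P (hσ.apply_one h₀) ha,
    hL.apply_tgen (l := n) (by omega) h₀ ha, compD0, LinearMap.comp_apply]
  simp only [add_zero, P.d0_gen n _ _ ha, map_sum, map_smul, sum_mul, TensorProduct.sum_tmul,
    smul_sum, smul_mul_tmul, smul_smul, gsign_eq, par_degSum_sub, ← zsign_add, barPar_zero]
  refine sum_congr rfl fun j hj => ?_
  rw [mem_range] at hj
  rw [hL.apply_tgen (l := n + 1) (by omega) h₀ (ha.insertAt (j := j) (by omega)), smul_smul,
    ← zsign_add]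
  simp only [add_zero, barPar_zero]
  rw [barPar_insertAt _ (by omega), P.tgen_ext (n := 0) (a := insertAt a j R.hEl) (a' := a)
    fun i hi => absurd hi (by omega)]
  congr 2
  grind

lemma lact_dOt0_succ (n m : ℕ) :
    lact p f (n + 1) (m + 1) ∘ₗ dOt0 P sgnA n =
      zsign k z • (dOt0 P sgnA m ∘ₗ lact p f n m) + lact q (compD0 P f) n (m + 1) := by
  rcases lt_or_ge n m with h | h
  · rw [hL.1 _ _ _ _ h, hL.1 _ _ _ _ (by omega), hL.1 _ _ _ _ (by omega)]
    simp
  obtain ⟨l, rfl⟩ := Nat.exists_eq_add_of_le h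
  refine tensor_hom_ext P hA fun γ₀ a₀ a g h₀ ha => ?_
  have hs := ha.mono (m := m) (by omega)
  have ht := ha.shift
  rw [LinearMap.add_apply, LinearMap.smul_apply, LinearMap.comp_apply, LinearMap.comp_apply,
    dOt0_tmul_tgen P (hσ.apply_one h₀) ha, hL.apply_tgen (l := l) rfl h₀ ha, map_smul,
    dOt0_tmul_tgen P (hf.mul hσ hA h₀ ht) hs,
    congrArg range (show m + l + 1 = m + 1 + l by omega), sum_range_add]
  simp only [map_add, map_sum, map_smul, smul_sum, smul_smul, ← zsign_add]
  congr 1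
  · refine sum_congr rfl fun j hj => ?_
    rw [mem_range] at hj
    rw [hL.apply_tgen (l := l) (by omega) h₀ (ha.insertAt (j := j) (by omega)), smul_smul,
      ← zsign_add]
    have h₁ : (fun t => insertAt a j R.hEl (t + (m + 1))) = fun t => a (t + m) :=
      funext fun t => insertAt_shift_of_lt a hj _ t
    have h₂ : (fun t => insertAt g j 2 (t + (m + 1))) = fun t => g (t + m) :=
      funext fun t => insertAt_shift_of_lt g hj _ t
    rw [h₁, h₂, barPar_insertAt g (by omega)]
    congr 2
    grind
  · rcases l with _ | l
    · rw [hL.1 q _ (m + 0) (m + 1) (by omega)]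
      simp
    have ht : R.HomogBar l (fun t => g (t + (m + 1))) (fun t => a (t + (m + 1))) :=
      fun i hi => ha _ (by omega)
    rw [hL.apply_tgen (l := l) (by omega) h₀ ha, compD0, LinearMap.comp_apply, P.d0_gen l _ _ ht,
      map_sum, sum_mul, TensorProduct.sum_tmul, smul_sum]
    refine sum_congr rfl fun i hi => ?_
    rw [mem_range] at hi
    rw [hL.apply_tgen (l := l + 1) (by omega) h₀ (ha.insertAt (j := m + 1 + i) (by omega)),
      smul_smul, ← zsign_add, map_smul, smul_mul_tmul, smul_smul, gsign_eq, par_degSum_sub,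
      ← zsign_add]
    have h₁ : (fun t => insertAt a (m + 1 + i) R.hEl (t + (m + 1))) =
        insertAt (fun t => a (t + (m + 1))) i R.hEl := funext fun t => insertAt_shift a _ _ _ t
    have h₂ : (fun t => insertAt g (m + 1 + i) 2 (t + (m + 1))) =
        insertAt (fun t => g (t + (m + 1))) i 2 := funext fun t => insertAt_shift g _ _ _ t
    have h₃ : P.tgen (m + 1) (insertAt a (m + 1 + i) R.hEl) = P.tgen (m + 1) a :=
      P.tgen_ext fun t ht => insertAt_of_lt a _ (by omega)
    have h₄ : barPar (insertAt g (m + 1 + i) 2) (m + 1) = barPar g (m + 1) :=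
      barPar_congr fun t ht => insertAt_of_lt g _ (by omega)
    rw [h₁, h₂, h₃, h₄, barPar_insertAt _ (by omega), barPar_add]
    congr 2
    grind

end Leibniz
/-! ### The square of `d_⊗` -/

section OtSquare

variable {sgnA : ZMod 2 → R.A →ₗ[k] R.A} (hσ : IsSgnA R sgnA)
  (hA : Submodule.span k {x : R.A | ∃ γ, x ∈ R.deg γ} = ⊤) (P : BarParts k Γ R)

include hσ hA

lemma dOt2_dOt2 (n : ℕ) (ω : R.A ⊗[k] P.T (n + 2)) :
    dOt2 P sgnA n (dOt2 P sgnA (n + 1) ω) = 0 := by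
  induction ω using TensorProduct.induction_on with
  | zero => simp only [map_zero]
  | tmul x t => simp only [dOt2, TensorProduct.map_tmul, d2_d2 hσ hA, TensorProduct.tmul_zero]
  | add ω ω' h h' => simp only [map_add, h, h', add_zero]

lemma dOt0_dOt0 (n : ℕ) (ω : R.A ⊗[k] P.T n) :
    dOt0 P sgnA (n + 1) (dOt0 P sgnA n ω) = 0 := by
  induction ω using TensorProduct.induction_on with
  | zero => simp only [map_zero]
  | tmul x t => simp only [dOt0, TensorProduct.map_tmul, d0_d0 hσ hA, TensorProduct.tmul_zero]
  | add ω ω' h h' => simp only [map_add, h, h', add_zero]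

lemma dOt2_dOt1 (n : ℕ) (ω : R.A ⊗[k] P.T (n + 1)) :
    dOt2 P sgnA n (dOt1 P sgnA (n + 1) ω) + dOt1 P sgnA n (dOt2 P sgnA n ω) = 0 := by
  induction ω using TensorProduct.induction_on with
  | zero => simp only [map_zero, add_zero]
  | tmul x t =>
    simp only [dOt2, dOt1, LinearMap.add_apply, map_add, TensorProduct.map_tmul,
      LinearMap.id_apply, sgnA_d hσ hA, sgnA_sgnA hσ hA, TensorProduct.neg_tmul,
      eq_neg_of_add_eq_zero_left (d2_d1 hσ hA P n t), TensorProduct.tmul_neg]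
    abel
  | add ω ω' h h' => simp only [map_add]; rw [add_add_add_comm, h, h', add_zero]

lemma dOt1_dOt0 (n : ℕ) (ω : R.A ⊗[k] P.T n) :
    dOt1 P sgnA (n + 1) (dOt0 P sgnA n ω) + dOt0 P sgnA n (dOt1 P sgnA n ω) = 0 := by
  induction ω using TensorProduct.induction_on with
  | zero => simp only [map_zero, add_zero]
  | tmul x t =>
    simp only [dOt0, dOt1, LinearMap.add_apply, map_add, TensorProduct.map_tmul,
      LinearMap.id_apply, sgnA_d hσ hA, sgnA_sgnA hσ hA, TensorProduct.neg_tmul,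
      eq_neg_of_add_eq_zero_left (d1_d0 hσ hA P n t), TensorProduct.tmul_neg]
    abel
  | add ω ω' h h' => simp only [map_add]; rw [add_add_add_comm, h, h', add_zero]

/-- Left multiplication by the curvature on the coefficient factor. -/
def curvL (P : BarParts k Γ R) (n : ℕ) : (R.A ⊗[k] P.T n) →ₗ[k] (R.A ⊗[k] P.T n) :=
  TensorProduct.map (LinearMap.mulLeft k R.hEl) LinearMap.id

/-- Right multiplication by the curvature on the coefficient factor. -/
def curvR (P : BarParts k Γ R) (n : ℕ) : (R.A ⊗[k] P.T n) →ₗ[k] (R.A ⊗[k] P.T n) :=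
  TensorProduct.map (LinearMap.mulRight k R.hEl) LinearMap.id

lemma dOt_sq_zero (ω : R.A ⊗[k] P.T 0) :
    dOt2 P sgnA 0 (dOt0 P sgnA 0 ω) + dOt1 P sgnA 0 (dOt1 P sgnA 0 ω) + curvR P 0 ω =
      curvL P 0 ω := by
  induction ω using TensorProduct.induction_on with
  | zero => simp only [map_zero, add_zero]
  | tmul x t =>
    simp only [dOt2, dOt0, dOt1, curvL, curvR, LinearMap.add_apply, map_add,
      TensorProduct.map_tmul, LinearMap.id_apply, sgnA_d hσ hA, sgnA_sgnA hσ hA,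
      TensorProduct.neg_tmul, eq_neg_of_add_eq_zero_left (d2_d0_zero hσ hA P t),
      TensorProduct.tmul_neg, R.d_sq, TensorProduct.sub_tmul, LinearMap.mulLeft_apply,
      LinearMap.mulRight_apply]
    abel
  | add ω ω' h h' =>
    simp only [map_add, ← h, ← h']
    abel

lemma dOt_sq_succ (n : ℕ) (ω : R.A ⊗[k] P.T (n + 1)) :
    dOt2 P sgnA (n + 1) (dOt0 P sgnA (n + 1) ω) + dOt1 P sgnA (n + 1) (dOt1 P sgnA (n + 1) ω) +
      dOt0 P sgnA n (dOt2 P sgnA n ω) + curvR P (n + 1) ω = curvL P (n + 1) ω := by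
  induction ω using TensorProduct.induction_on with
  | zero => simp only [map_zero, add_zero]
  | tmul x t =>
    have h : P.d2 (n + 1) (P.d0 (n + 1) t) =
        -(P.d1 (n + 1) (P.d1 (n + 1) t) + P.d0 n (P.d2 n t)) :=
      eq_neg_of_add_eq_zero_left (by rw [← add_assoc]; exact d2_d0_succ hσ hA P n t)
    simp only [dOt2, dOt0, dOt1, curvL, curvR, LinearMap.add_apply, map_add,
      TensorProduct.map_tmul, LinearMap.id_apply, sgnA_d hσ hA, sgnA_sgnA hσ hA,
      TensorProduct.neg_tmul, h, TensorProduct.tmul_neg, TensorProduct.tmul_add, R.d_sq,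
      TensorProduct.sub_tmul, LinearMap.mulLeft_apply, LinearMap.mulRight_apply]
    abel
  | add ω ω' h h' =>
    simp only [map_add, ← h, ← h']
    abel

end OtSquare
/-! ### Products with the twisting cochain -/

/-- `f` raises degrees by `γf` on homogeneous bar chains. -/
def HomogOnChains (P : BarParts k Γ R) (γf : Γ) (f : ∀ n, P.T n →ₗ[k] R.A) : Prop :=
  ∀ n a g, R.HomogBar n g a → f n (P.tgen n a) ∈ R.deg (degSum g n - (n : Γ) + γf)

lemma HomogMap.homogOnChains {P : BarParts k Γ R} {γf : Γ} {f : ∀ n, P.T n →ₗ[k] R.A}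
    (hf : HomogMap P γf f) : HomogOnChains P γf f :=
  fun n _ _ ha => hf n _ _ (P.tgen_deg ha)

lemma HomogOnChains.hasParity {P : BarParts k Γ R} {γf : Γ} {f : ∀ n, P.T n →ₗ[k] R.A}
    (hf : HomogOnChains P γf f) {sgnA : ZMod 2 → R.A →ₗ[k] R.A} (hσ : IsSgnA R sgnA) :
    HasParity P sgnA (par γf) f := fun n a g ha => by
  rw [hσ.apply_one (hf n a g ha), par_add, par_degSum_sub]

/-- `τ` is the inverse suspension on words of length one and zero elsewhere. -/
structure IsTwistingCochain (P : BarParts k Γ R) (τ : ∀ n, P.T n →ₗ[k] R.A) : Prop where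
  one : ∀ a : ℕ → R.A, τ 1 (P.tgen 1 a) = a 0
  zero : τ 0 = 0
  add_two : ∀ n : ℕ, τ (n + 2) = 0

lemma IsTwistingCochain.homogOnChains {P : BarParts k Γ R} {τ : ∀ n, P.T n →ₗ[k] R.A}
    (hτ : IsTwistingCochain P τ) : HomogOnChains P 1 τ := by
  rintro (_ | _ | n) a g ha
  · rw [hτ.zero]; exact Submodule.zero_mem _
  · rw [hτ.one]
    simpa [degSum] using ha 0 one_pos
  · rw [hτ.add_two]; exact Submodule.zero_mem _

lemma convP_term (P : BarParts k Γ R) (p : ZMod 2) (f f' : ∀ n, P.T n →ₗ[k] R.A) {n i j : ℕ}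
    (h : n = i + j) {a : ℕ → R.A} {g : ℕ → Γ} (ha : R.HomogBar n g a) :
    (LinearMap.mul' k R.A ∘ₗ TensorProduct.map (f i ∘ₗ P.sgnOp i p) (f' (n - i)) ∘ₗ
      P.cop n i (n - i)) (P.tgen n a) =
      zsign k (p * barPar g i) •
        (f i (P.tgen i a) * f' j (P.tgen j (fun t => a (t + i)))) := by
  subst h
  obtain ⟨j', hj'⟩ : ∃ j', i + j - i = j' := ⟨_, rfl⟩
  rw [hj']
  obtain rfl : j = j' := by omega
  rw [LinearMap.comp_apply, LinearMap.comp_apply, P.cop_gen, TensorProduct.map_tmul,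
    LinearMap.comp_apply, P.sgnOp_apply i p _ (P.tgen_deg (ha.mono (Nat.le_add_right i j))),
    LinearMap.mul'_apply, map_smul, smul_mul_assoc, psign_eq]
  rw [show GradingGroup.parity _ = _ from par_degSum_sub g i]

lemma convP_zero {P : BarParts k Γ R} {p : ZMod 2} {f f' : ∀ n, P.T n →ₗ[k] R.A}
    (h : f 0 = 0 ∨ f' 0 = 0) : convP P p f f' 0 = 0 := by
  rcases h with h | h <;> simp [convP, h]

section Twisting

variable {P : BarParts k Γ R} {τ : ∀ n, P.T n →ₗ[k] R.A} (hτ : IsTwistingCochain P τ)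

include hτ

lemma convP_tau_left (p : ZMod 2) (f : ∀ n, P.T n →ₗ[k] R.A) {n : ℕ} {a : ℕ → R.A} {g : ℕ → Γ}
    (ha : R.HomogBar (n + 1) g a) :
    convP P p τ f (n + 1) (P.tgen (n + 1) a) =
      zsign k (p * (par (g 0) + 1)) • (a 0 * f n (P.tgen n (fun t => a (t + 1)))) := by
  rw [convP, LinearMap.sum_apply, sum_eq_single 1, convP_term P p τ f (add_comm n 1) ha, hτ.one,
    barPar_succ, barPar_zero, zero_add]
  · rintro (_ | _ | i) _ hi
    · rw [hτ.zero]; simp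
    · exact absurd rfl hi
    · rw [hτ.add_two]; simp
  · intro h
    simp at h

lemma convP_tau_right (p : ZMod 2) (f : ∀ n, P.T n →ₗ[k] R.A) {n : ℕ} {a : ℕ → R.A} {g : ℕ → Γ}
    (ha : R.HomogBar (n + 1) g a) :
    convP P p f τ (n + 1) (P.tgen (n + 1) a) =
      zsign k (p * barPar g n) • (f n (P.tgen n a) * a n) := by
  rw [convP, LinearMap.sum_apply, sum_eq_single n, convP_term P p f τ (j := 1) rfl ha, hτ.one,
    zero_add]
  · intro i hi hin
    rw [mem_range] at hi
    rcases Nat.lt_or_ge n i with h | h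
    · rw [show n + 1 - i = 0 by omega, hτ.zero]; simp
    · obtain ⟨j, hj⟩ : ∃ j, n + 1 - i = j + 2 := ⟨n - i - 1, by omega⟩
      rw [hj, hτ.add_two]; simp
  · intro h
    simp at h

variable {lact : ZMod 2 → (∀ n, P.T n →ₗ[k] R.A) → (n i : ℕ) →
    (R.A ⊗[k] P.T n) →ₗ[k] (R.A ⊗[k] P.T i)} (hL : IsLact P lact)
  (hA : Submodule.span k {x : R.A | ∃ γ, x ∈ R.deg γ} = ⊤)

include hL

lemma lact_tau_tgen (p : ZMod 2) {m : ℕ} {γ₀ : Γ} {a₀ : R.A} {a : ℕ → R.A} {g : ℕ → Γ}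
    (h₀ : a₀ ∈ R.deg γ₀) (ha : R.HomogBar (m + 1) g a) :
    lact p τ (m + 1) m (a₀ ⊗ₜ[k] P.tgen (m + 1) a) =
      zsign k ((par γ₀ + barPar g m) * (par (g m) + 1)) • ((a m * a₀) ⊗ₜ[k] P.tgen m a) := by
  rw [hL.apply_tgen rfl h₀ ha, hτ.one, barPar_succ, barPar_zero, zero_add, zero_add]

include hA

lemma lact_convP_tau_left {γf : Γ} {f : ∀ n, P.T n →ₗ[k] R.A} (hf : HomogOnChains P γf f)
    (p q r : ZMod 2) (n m : ℕ) :
    lact q (convP P (par γf) τ f) n m = lact r τ (m + 1) m ∘ₗ lact p f n (m + 1) := by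
  rcases lt_or_ge n m with h | h
  · rw [hL.1 q _ _ _ h, hL.1 p _ _ _ (by omega), LinearMap.comp_zero]
  obtain ⟨_ | l, rfl⟩ := Nat.exists_eq_add_of_le h
  · rw [hL.eq_zero hA (l := 0) (add_zero _).symm (convP_zero (Or.inl hτ.zero)), hL.1 p f _ _ (by omega),
      LinearMap.comp_zero]
  refine tensor_hom_ext P hA fun γ₀ a₀ a g h₀ ha => ?_
  have ht : R.HomogBar (l + 1) (fun t => g (t + m)) (fun t => a (t + m)) := ha.shift
  have ht' : R.HomogBar l (fun t => g (t + (m + 1))) (fun t => a (t + (m + 1))) :=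
    fun i hi => ha _ (by omega)
  rw [LinearMap.comp_apply, hL.apply_tgen (p := q) (l := l + 1) rfl h₀ ha,
    hL.apply_tgen (p := p) (l := l) (by omega) h₀ ha, convP_tau_left hτ _ f ht, map_smul,
    lact_tau_tgen hτ hL r (R.mul_mem (hf l _ _ ht') h₀) (ha.mono (by omega)), smul_mul_tmul,
    smul_smul, smul_smul, ← zsign_add, ← zsign_add, barPar_succ', par_add, par_add,
    par_degSum_sub, barPar_succ g m]
  simp only [add_assoc, add_comm 1 m, zero_add, mul_assoc]
  congr 2
  grind

lemma lact_convP_tau_right_zero (p q : ZMod 2) (f : ∀ n, P.T n →ₗ[k] R.A) (m : ℕ) :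
    lact q (convP P p f τ) 0 m = 0 := by
  rcases m with _ | m
  · exact hL.eq_zero hA rfl (convP_zero (Or.inr hτ.zero))
  · exact hL.1 _ _ _ _ (Nat.succ_pos m)

lemma lact_convP_tau_right (p q r : ZMod 2) (f : ∀ n, P.T n →ₗ[k] R.A) (n m : ℕ) :
    lact q (convP P 1 f τ) (n + 1) m = lact p f n m ∘ₗ lact r τ (n + 1) n := by
  rcases lt_or_ge n m with h | h
  · rw [hL.1 p f _ _ h, LinearMap.zero_comp]
    rcases Nat.eq_or_lt_of_le (Nat.succ_le_of_lt h) with rfl | h'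
    · exact hL.eq_zero hA (l := 0) rfl (convP_zero (Or.inr hτ.zero))
    · exact hL.1 _ _ _ _ h'
  obtain ⟨l, rfl⟩ := Nat.exists_eq_add_of_le h
  refine tensor_hom_ext P hA fun γ₀ a₀ a g h₀ ha => ?_
  have ht : R.HomogBar (l + 1) (fun t => g (t + m)) (fun t => a (t + m)) :=
    fun i hi => ha _ (by omega)
  rw [LinearMap.comp_apply, lact_tau_tgen hτ hL r h₀ ha, map_smul,
    hL.apply_tgen (l := l + 1) (add_assoc m l 1) h₀ ha,
    hL.apply_tgen rfl (R.mul_mem (ha _ (by omega)) h₀) (ha.mono (by omega)),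
    convP_tau_right hτ _ f ht, smul_mul_tmul,
    smul_smul, smul_smul, ← zsign_add, ← zsign_add, barPar_succ, par_add, barPar_add, add_comm l m,
    mul_assoc (f l _)]
  congr 2
  grind

end Twisting
/-! ### The right action of the twisting cochain -/

/-- The map `ω ↦ (−1)^{|ω|} ω·τ`, as a component `A ⊗ T (m+1) → A ⊗ T m`. -/
def rightTau (P : BarParts k Γ R)
    (ract : ZMod 2 → (∀ n, P.T n →ₗ[k] R.A) → (n j : ℕ) →
      (R.A ⊗[k] P.T n) →ₗ[k] (R.A ⊗[k] P.T j))
    (sgnAT : ZMod 2 → (n : ℕ) → (R.A ⊗[k] P.T n) →ₗ[k] (R.A ⊗[k] P.T n))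
    (τ : ∀ n, P.T n →ₗ[k] R.A) (m : ℕ) : (R.A ⊗[k] P.T (m + 1)) →ₗ[k] (R.A ⊗[k] P.T m) :=
  ract 1 τ (m + 1) m ∘ₗ sgnAT 1 (m + 1)

section RightTau

lemma zsign_add_one_smul {M : Type} [AddCommGroup M] [Module k M] (z : ZMod 2) (x : M) :
    zsign k (z + 1) • x = -(zsign k z • x) := by
  rw [zsign_add, zsign_one, mul_neg_one, neg_smul]

variable {P : BarParts k Γ R} {τ : ∀ n, P.T n →ₗ[k] R.A} (hτ : IsTwistingCochain P τ)
  {ract : ZMod 2 → (∀ n, P.T n →ₗ[k] R.A) → (n j : ℕ) →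
    (R.A ⊗[k] P.T n) →ₗ[k] (R.A ⊗[k] P.T j)} (hR : IsRact P ract)
  {sgnAT : ZMod 2 → (n : ℕ) → (R.A ⊗[k] P.T n) →ₗ[k] (R.A ⊗[k] P.T n)}
  (hS : IsSgnAT P sgnAT)

include hτ hR hS

lemma rightTau_tgen {m : ℕ} {γ₀ : Γ} {a₀ : R.A} {a : ℕ → R.A} {g : ℕ → Γ}
    (h₀ : a₀ ∈ R.deg γ₀) (ha : R.HomogBar (m + 1) g a) :
    rightTau P ract sgnAT τ m (a₀ ⊗ₜ[k] P.tgen (m + 1) a) =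
      zsign k (par γ₀) • ((a₀ * a 0) ⊗ₜ[k] P.tgen m (fun t => a (t + 1))) := by
  rw [rightTau, LinearMap.comp_apply, hS 1 _ γ₀ a₀ a g h₀ ha, map_smul,
    hR.2 1 τ _ m γ₀ a₀ a g h₀ ha (Nat.le_succ m), psign_eq, psign_eq, smul_smul, ← zsign_add,
    Nat.add_sub_cancel_left, hτ.one,
    show GradingGroup.parity (γ₀ + (degSum g (m + 1) - ((m + 1 : ℕ) : Γ))) = _ from par_add _ _,
    show GradingGroup.parity (degSum g (m + 1) - ((m + 1 : ℕ) : Γ)) = _ from par_degSum_sub _ _]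
  congr 2
  rw [par_degSum_sub]
  grind

variable {sgnA : ZMod 2 → R.A →ₗ[k] R.A} (hσ : IsSgnA R sgnA)
  (hA : Submodule.span k {x : R.A | ∃ γ, x ∈ R.deg γ} = ⊤)

include hA

lemma rightTau_lact {lact : ZMod 2 → (∀ n, P.T n →ₗ[k] R.A) → (n i : ℕ) →
      (R.A ⊗[k] P.T n) →ₗ[k] (R.A ⊗[k] P.T i)} (hL : IsLact P lact)
    {γf : Γ} {f : ∀ n, P.T n →ₗ[k] R.A} (hf : HomogOnChains P γf f) (p : ZMod 2) (n m : ℕ) :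
    rightTau P ract sgnAT τ m ∘ₗ lact p f (n + 1) (m + 1) =
      zsign k (par γf) • (lact p f n m ∘ₗ rightTau P ract sgnAT τ n) := by
  rcases lt_or_ge n m with h | h
  · rw [hL.1 _ _ _ _ h, hL.1 _ _ _ _ (Nat.succ_lt_succ h)]
    simp
  obtain ⟨l, rfl⟩ := Nat.exists_eq_add_of_le h
  refine tensor_hom_ext P hA fun γ₀ a₀ a g h₀ ha => ?_
  have ht : R.HomogBar l (fun t => g (t + (m + 1))) (fun t => a (t + (m + 1))) :=
    fun i hi => ha _ (by omega)
  rw [LinearMap.smul_apply, LinearMap.comp_apply, LinearMap.comp_apply,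
    hL.apply_tgen (l := l) (by omega) h₀ ha, map_smul,
    rightTau_tgen hτ hR hS (R.mul_mem (hf l _ _ ht) h₀) (ha.mono (by omega)),
    rightTau_tgen hτ hR hS h₀ ha, map_smul,
    hL.apply_tgen rfl (R.mul_mem h₀ (ha 0 (Nat.succ_pos _))) ha.tail, smul_smul, smul_smul,
    smul_smul, ← zsign_add, ← zsign_add, ← zsign_add, par_add, par_add, par_add, par_degSum_sub,
    barPar_succ', mul_assoc]
  simp only [add_assoc]
  congr 2
  grind

lemma rightTau_lact_tau {lact : ZMod 2 → (∀ n, P.T n →ₗ[k] R.A) → (n i : ℕ) →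
      (R.A ⊗[k] P.T n) →ₗ[k] (R.A ⊗[k] P.T i)} (hL : IsLact P lact) (m : ℕ)
    (ω : R.A ⊗[k] P.T (m + 2)) :
    rightTau P ract sgnAT τ m (lact 1 τ (m + 2) (m + 1) ω) +
      lact 1 τ (m + 1) m (rightTau P ract sgnAT τ (m + 1) ω) = 0 := by
  have h := LinearMap.congr_fun (rightTau_lact hτ hR hS hA hL hτ.homogOnChains 1 (m + 1) m) ω
  rw [par_one, zsign_one, LinearMap.smul_apply, neg_one_smul] at h
  exact eq_neg_iff_add_eq_zero.1 h

include hσ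

lemma rightTau_dOt2 (m : ℕ) (ω : R.A ⊗[k] P.T (m + 2)) :
    rightTau P ract sgnAT τ m (dOt2 P sgnA (m + 1) ω) +
      dOt2 P sgnA m (rightTau P ract sgnAT τ (m + 1) ω) +
        rightTau P ract sgnAT τ m (rightTau P ract sgnAT τ (m + 1) ω) = 0 := by
  have key : rightTau P ract sgnAT τ m ∘ₗ dOt2 P sgnA (m + 1) +
      dOt2 P sgnA m ∘ₗ rightTau P ract sgnAT τ (m + 1) +
        rightTau P ract sgnAT τ m ∘ₗ rightTau P ract sgnAT τ (m + 1) = 0 := by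
    refine tensor_hom_ext P hA fun γ₀ a₀ a g h₀ ha => ?_
    have h₁ := R.mul_mem h₀ (ha 0 (by omega))
    simp only [LinearMap.add_apply, LinearMap.comp_apply, LinearMap.zero_apply]
    rw [dOt2_tmul_tgen P (hσ.apply_one h₀) ha, rightTau_tgen hτ hR hS h₀ ha, map_smul, map_smul,
      dOt2_tmul_tgen P (hσ.apply_one h₁) ha.tail, rightTau_tgen hτ hR hS h₁ ha.tail, map_sum,
      sum_range_succ', map_smul, rightTau_tgen hτ hR hS h₀ (ha.contractChain 0)]
    have h₂ : ∀ j ∈ range m, rightTau P ract sgnAT τ m (zsign k (par γ₀ + barPar g (j + 1 + 1)) •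
        (a₀ ⊗ₜ[k] P.tgen (m + 1) (contractChain a (j + 1)))) =
        -(zsign k (par γ₀) • zsign k (par (γ₀ + g 0) + barPar (fun t => g (t + 1)) (j + 1)) •
          ((a₀ * a 0) ⊗ₜ[k] P.tgen m (contractChain (fun t => a (t + 1)) j))) := by
      intro j _
      rw [map_smul, rightTau_tgen hτ hR hS h₀ (ha.contractChain (j + 1)), neg_eq_zsign_smul (k := k)]
      simp only [smul_smul, ← zsign_add, contractChain_shift a 1 j, add_comm j 1]
      rw [contractChain_of_lt a (by omega), par_add, add_comm 1 j, barPar_succ' g (j + 1)]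
      congr 2
      grind
    rw [sum_congr rfl h₂, sum_neg_distrib, ← smul_sum]
    have h₃ : P.tgen m (fun t => contractChain a 0 (t + 1)) =
        P.tgen m (fun t => a (t + 1 + 1)) := by
      congr 1
    have h₄ : contractChain a 0 0 = a 0 * a 1 := by simp [contractChain]
    rw [h₃, h₄, ← mul_assoc, smul_smul, smul_smul, ← zsign_add, ← zsign_add]
    have h₅ : par γ₀ + par (γ₀ + g 0) = par γ₀ + barPar g (0 + 1) + par γ₀ + 1 := by
      rw [par_add, barPar_succ, barPar_zero]; grind
    rw [h₅, zsign_add_one_smul]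
    simp only [zero_add]
    abel
  exact LinearMap.congr_fun key ω

lemma rightTau_dOt1 (m : ℕ) (ω : R.A ⊗[k] P.T (m + 1)) :
    rightTau P ract sgnAT τ m (dOt1 P sgnA (m + 1) ω) +
      dOt1 P sgnA m (rightTau P ract sgnAT τ m ω) = 0 := by
  have key : rightTau P ract sgnAT τ m ∘ₗ dOt1 P sgnA (m + 1) +
      dOt1 P sgnA m ∘ₗ rightTau P ract sgnAT τ m = 0 := by
    refine tensor_hom_ext P hA fun γ₀ a₀ a g h₀ ha => ?_
    have h₁ := R.mul_mem h₀ (ha 0 (by omega))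
    have h₄ : rightTau P ract sgnAT τ m (R.d a₀ ⊗ₜ[k] P.tgen (m + 1) a) =
        -(zsign k (par γ₀) • ((R.d a₀ * a 0) ⊗ₜ[k] P.tgen m (fun t => a (t + 1)))) := by
      rw [rightTau_tgen hτ hR hS (R.d_deg h₀) ha, par_add, par_one]
      exact zsign_add_one_smul (k := k) (par γ₀) ((R.d a₀ * a 0) ⊗ₜ[k] P.tgen m _)
    simp only [LinearMap.add_apply, LinearMap.comp_apply, LinearMap.zero_apply]
    rw [dOt1_tmul_tgen P (hσ.apply_one h₀) ha, rightTau_tgen hτ hR hS h₀ ha, map_smul, map_add,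
      dOt1_tmul_tgen P (hσ.apply_one h₁) ha.tail, h₄, map_sum,
      sum_range_succ', map_smul,
      rightTau_tgen hτ hR hS h₀ (ha.update (j := 0) (Nat.succ_pos m)), d_mul hσ hA,
      hσ.apply_one h₀]
    have h₂ : ∀ j ∈ range m, rightTau P ract sgnAT τ m
        (zsign k (par γ₀ + (barPar g (j + 1) + 1)) •
          (a₀ ⊗ₜ[k] P.tgen (m + 1) (Function.update a (j + 1) (R.d (a (j + 1)))))) =
        -(zsign k (par γ₀) •
          zsign k (par (γ₀ + g 0) + (barPar (fun t => g (t + 1)) j + 1)) •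
            ((a₀ * a 0) ⊗ₜ[k]
              P.tgen m (Function.update (fun t => a (t + 1)) j (R.d (a (j + 1)))))) := by
      intro j hj
      rw [mem_range] at hj
      rw [map_smul, rightTau_tgen hτ hR hS h₀ (ha.update (by omega)), neg_eq_zsign_smul (k := k)]
      have h₃ : (fun t => Function.update a (j + 1) (R.d (a (j + 1))) (t + 1)) =
          Function.update (fun t => a (t + 1)) j (R.d (a (j + 1))) := by
        funext t
        by_cases h : t = j
        · subst h; simp
        · rw [Function.update_of_ne (by omega), Function.update_of_ne h]
      rw [h₃, Function.update_of_ne (by omega)]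
      simp only [smul_smul, ← zsign_add]
      rw [par_add, barPar_succ' g j]
      congr 2
      grind
    rw [sum_congr rfl h₂, sum_neg_distrib, ← smul_sum]
    have h₃ : P.tgen m (fun t => Function.update a 0 (R.d (a 0)) (t + 1)) =
        P.tgen m (fun t => a (t + 1)) :=
      P.tgen_ext fun t _ => Function.update_of_ne (by omega) _ _
    rw [h₃, Function.update_self, TensorProduct.add_tmul, smul_mul_tmul, smul_add, smul_add,
      smul_smul, smul_smul, ← zsign_add, ← zsign_add, barPar_zero, zero_add,
      add_right_comm (par γ₀) 1, zsign_add_one_smul]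
    abel
  exact LinearMap.congr_fun key ω

lemma rightTau_dOt0_zero (ω : R.A ⊗[k] P.T 0) :
    rightTau P ract sgnAT τ 0 (dOt0 P sgnA 0 ω) = curvR P 0 ω := by
  have key : rightTau P ract sgnAT τ 0 ∘ₗ dOt0 P sgnA 0 = curvR P 0 := by
    refine tensor_hom_ext P hA fun γ₀ a₀ a g h₀ ha => ?_
    rw [LinearMap.comp_apply, dOt0_tmul_tgen P (hσ.apply_one h₀) ha, sum_range_one, map_smul,
      rightTau_tgen hτ hR hS h₀ (ha.insertAt (le_refl 0)), smul_smul, barPar_zero, add_zero,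
      zsign_mul_self, one_smul, curvR, TensorProduct.map_tmul]
    rfl
  exact LinearMap.congr_fun key ω

lemma rightTau_dOt0_succ (m : ℕ) (ω : R.A ⊗[k] P.T (m + 1)) :
    rightTau P ract sgnAT τ (m + 1) (dOt0 P sgnA (m + 1) ω) +
      dOt0 P sgnA m (rightTau P ract sgnAT τ m ω) = curvR P (m + 1) ω := by
  have key : rightTau P ract sgnAT τ (m + 1) ∘ₗ dOt0 P sgnA (m + 1) +
      dOt0 P sgnA m ∘ₗ rightTau P ract sgnAT τ m = curvR P (m + 1) := by
    refine tensor_hom_ext P hA fun γ₀ a₀ a g h₀ ha => ?_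
    have h₁ := R.mul_mem h₀ (ha 0 (by omega))
    simp only [LinearMap.add_apply, LinearMap.comp_apply]
    rw [dOt0_tmul_tgen P (hσ.apply_one h₀) ha, rightTau_tgen hτ hR hS h₀ ha, map_smul,
      dOt0_tmul_tgen P (hσ.apply_one h₁) ha.tail, map_sum, sum_range_succ', map_smul,
      rightTau_tgen hτ hR hS h₀ (ha.insertAt (j := 0) (Nat.zero_le _)), smul_smul, barPar_zero,
      add_zero, zsign_mul_self, one_smul]
    have h₂ : ∀ j ∈ range (m + 1), rightTau P ract sgnAT τ (m + 1)
        (zsign k (par γ₀ + barPar g (j + 1)) •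
          (a₀ ⊗ₜ[k] P.tgen (m + 1 + 1) (insertAt a (j + 1) R.hEl))) =
        -(zsign k (par γ₀) • zsign k (par (γ₀ + g 0) + barPar (fun t => g (t + 1)) j) •
          ((a₀ * a 0) ⊗ₜ[k] P.tgen (m + 1) (insertAt (fun t => a (t + 1)) j R.hEl))) := by
      intro j hj
      rw [mem_range] at hj
      rw [map_smul, rightTau_tgen hτ hR hS h₀ (ha.insertAt (by omega)), neg_eq_zsign_smul (k := k)]
      simp only [smul_smul, ← zsign_add, insertAt_shift a 1 j, add_comm j 1]
      rw [insertAt_of_lt a _ (by omega), par_add, add_comm 1 j, barPar_succ' g j]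
      congr 2
      grind
    rw [sum_congr rfl h₂, sum_neg_distrib, ← smul_sum, neg_add_eq_sub, sub_add_cancel, curvR,
      TensorProduct.map_tmul, insertAt_zero]
    rfl
  exact LinearMap.congr_fun key ω

end RightTau
/-! ### The left action of the twisting cochain -/

section LeftTau

variable {P : BarParts k Γ R} {τ : ∀ n, P.T n →ₗ[k] R.A} (hτ : IsTwistingCochain P τ)
  {lact : ZMod 2 → (∀ n, P.T n →ₗ[k] R.A) → (n i : ℕ) →
    (R.A ⊗[k] P.T n) →ₗ[k] (R.A ⊗[k] P.T i)} (hL : IsLact P lact)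
  {sgnA : ZMod 2 → R.A →ₗ[k] R.A} (hσ : IsSgnA R sgnA)
  (hA : Submodule.span k {x : R.A | ∃ γ, x ∈ R.deg γ} = ⊤)

include hτ hL hσ hA

lemma lactTau_dOt2 (m : ℕ) (ω : R.A ⊗[k] P.T (m + 2)) :
    lact 1 τ (m + 1) m (dOt2 P sgnA (m + 1) ω) + dOt2 P sgnA m (lact 1 τ (m + 2) (m + 1) ω) =
      lact 1 τ (m + 1) m (lact 1 τ (m + 2) (m + 1) ω) := by
  have h := LinearMap.congr_fun
    (lact_dOt2 hσ hA hL (hτ.homogOnChains.hasParity hσ) 1 1 (m + 1) m) ω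
  have h' := LinearMap.congr_fun
    (lact_convP_tau_left hτ hL hA hτ.homogOnChains 1 1 1 (m + 2) m) ω
  have hc : convP P (par (1 : Γ)) τ τ 2 = compD2 P τ 2 := by
    refine LinearMap.ext_on (P.span_tgen 2) ?_
    rintro _ ⟨a, g, ha, rfl⟩
    have h₂ : P.d2 1 (P.tgen 2 a) = _ := P.d2_gen 1 a g ha
    rw [convP_tau_left hτ _ τ ha, hτ.one, compD2, LinearMap.comp_apply, h₂, sum_range_one,
      map_smul, hτ.one, gsign_eq, par_degSum_sub, barPar_succ, barPar_zero, par_one, one_mul,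
      zero_add, zero_add]
    rfl
  rw [LinearMap.add_apply, LinearMap.smul_apply, par_one, zsign_one, neg_one_smul] at h
  rw [hL.congr hA 1 1 rfl hc] at h'
  change _ = _ + lact 1 (compD2 P τ) (m + 2) m ω at h
  rw [h'] at h
  simp only [LinearMap.comp_apply] at h
  rw [h]
  abel

lemma lactTau_dOt1 (m : ℕ) (ω : R.A ⊗[k] P.T (m + 1)) :
    lact 1 τ (m + 1) m (dOt1 P sgnA (m + 1) ω) + dOt1 P sgnA m (lact 1 τ (m + 1) m ω) = 0 := by
  have h := LinearMap.congr_fun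
    (dOt1_lact hσ hA hL (hτ.homogOnChains.hasParity hσ) 1 1 (m + 1) m) ω
  have hc : (fun n => R.d ∘ₗ τ n) 1 = ((-1 : k) • compD1 P τ) 1 := by
    refine LinearMap.ext_on (P.span_tgen 1) ?_
    rintro _ ⟨a, g, ha, rfl⟩
    rw [Pi.smul_apply, LinearMap.smul_apply, compD1, LinearMap.comp_apply, LinearMap.comp_apply,
      P.d1_gen 1 a g ha, sum_range_one, map_smul, hτ.one, hτ.one, gsign_eq,
      par_degSum_sub_succ, barPar_zero, zero_add, zsign_one, smul_smul, neg_one_mul, neg_neg,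
      one_smul, Function.update_self]
  rw [hL.congr hA (f := fun n => R.d ∘ₗ τ n) (f' := (-1 : k) • compD1 P τ) (n := m + 1) (m := m)
    (l := 1) 1 1 rfl hc, hL.map_smul hA, par_one, zsign_one] at h
  simp only [LinearMap.add_apply, LinearMap.smul_apply, LinearMap.comp_apply, neg_one_smul] at h
  rw [add_comm, add_left_injective _ |>.eq_iff.1 (h.trans (add_comm _ _)), neg_add_cancel]

omit hσ in
lemma lact_compD0_tau (m : ℕ) : lact 1 (compD0 P τ) m m = curvL P m := by
  refine tensor_hom_ext P hA fun γ₀ a₀ a g h₀ ha => ?_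
  rw [hL.apply_tgen (l := 0) (add_zero m).symm h₀ ha, compD0, LinearMap.comp_apply, P.d0_gen 0 _
    (fun t => g (t + m)) (fun i hi => absurd hi (Nat.not_lt_zero i)), zero_add,
    sum_range_one, map_smul, hτ.one, gsign_eq, par_degSum_sub, barPar_zero, mul_zero, zsign_zero,
    one_smul, one_smul, curvL, TensorProduct.map_tmul]
  rfl

lemma lactTau_dOt0_zero (ω : R.A ⊗[k] P.T 0) :
    lact 1 τ 1 0 (dOt0 P sgnA 0 ω) = curvL P 0 ω := by
  rw [← lact_compD0_tau hτ hL hA]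
  exact LinearMap.congr_fun (lact_dOt0_zero hσ hA hL 1 1 0) ω

lemma lactTau_dOt0_succ (m : ℕ) (ω : R.A ⊗[k] P.T (m + 1)) :
    lact 1 τ (m + 2) (m + 1) (dOt0 P sgnA (m + 1) ω) + dOt0 P sgnA m (lact 1 τ (m + 1) m ω) =
      curvL P (m + 1) ω := by
  have h := LinearMap.congr_fun
    (lact_dOt0_succ hσ hA hL (hτ.homogOnChains.hasParity hσ) 1 1 (m + 1) m) ω
  rw [lact_compD0_tau hτ hL hA, par_one, zsign_one, LinearMap.add_apply,
    LinearMap.smul_apply, neg_one_smul] at h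
  simp only [LinearMap.comp_apply] at h
  rw [h]
  abel

end LeftTau

/-! ### The deformed differential -/

section Deformed

variable {P : BarParts k Γ R} {τ : ∀ n, P.T n →ₗ[k] R.A} (hτ : IsTwistingCochain P τ)
  {lact : ZMod 2 → (∀ n, P.T n →ₗ[k] R.A) → (n i : ℕ) →
    (R.A ⊗[k] P.T n) →ₗ[k] (R.A ⊗[k] P.T i)} (hL : IsLact P lact)
  {ract : ZMod 2 → (∀ n, P.T n →ₗ[k] R.A) → (n j : ℕ) →
    (R.A ⊗[k] P.T n) →ₗ[k] (R.A ⊗[k] P.T j)} (hR : IsRact P ract)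
  {sgnAT : ZMod 2 → (n : ℕ) → (R.A ⊗[k] P.T n) →ₗ[k] (R.A ⊗[k] P.T n)}
  (hS : IsSgnAT P sgnAT)
  {sgnA : ZMod 2 → R.A →ₗ[k] R.A} (hσ : IsSgnA R sgnA)
  (hA : Submodule.span k {x : R.A | ∃ γ, x ∈ R.deg γ} = ⊤)

lemma bAll_zero (x : ∀ n, R.A ⊗[k] P.T n) :
    bAll P sgnA lact ract sgnAT τ x 0 =
      dOt2 P sgnA 0 (x 1) + dOt1 P sgnA 0 (x 0) - lact 1 τ 1 0 (x 1) +
        rightTau P ract sgnAT τ 0 (x 1) :=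
  congrArg (· - _ + _) (add_zero _)

lemma bAll_succ (x : ∀ n, R.A ⊗[k] P.T n) (n : ℕ) :
    bAll P sgnA lact ract sgnAT τ x (n + 1) =
      dOt2 P sgnA (n + 1) (x (n + 2)) + dOt1 P sgnA (n + 1) (x (n + 1)) +
        dOt0 P sgnA n (x n) - lact 1 τ (n + 2) (n + 1) (x (n + 2)) +
          rightTau P ract sgnAT τ (n + 1) (x (n + 2)) := rfl

include hτ hL hR hS hσ hA

lemma bAll_bAll (x : ∀ n, R.A ⊗[k] P.T n) :
    bAll P sgnA lact ract sgnAT τ (bAll P sgnA lact ract sgnAT τ x) = 0 := by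
  have h₂ := fun n => dOt2_dOt2 hσ hA P n (x (n + 2))
  have l₂ := fun n => lactTau_dOt2 hτ hL hσ hA n (x (n + 2))
  have r₂ := fun n => rightTau_dOt2 hτ hR hS hσ hA n (x (n + 2))
  have c₂ := fun n => rightTau_lact_tau hτ hR hS hA hL n (x (n + 2))
  have h₁ := fun n => dOt2_dOt1 hσ hA P n (x (n + 1))
  have l₁ := fun n => lactTau_dOt1 hτ hL hσ hA n (x (n + 1))
  have r₁ := fun n => rightTau_dOt1 hτ hR hS hσ hA n (x (n + 1))
  have h₀ := fun n => dOt_sq_succ hσ hA P n (x (n + 1))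
  have l₀ := fun n => lactTau_dOt0_succ hτ hL hσ hA n (x (n + 1))
  have r₀ := fun n => rightTau_dOt0_succ hτ hR hS hσ hA n (x (n + 1))
  have e₁ := fun n => dOt1_dOt0 hσ hA P n (x n)
  have e₀ := fun n => dOt0_dOt0 hσ hA P n (x n)
  funext n
  rcases n with _ | _ | n
  · have h := dOt_sq_zero hσ hA P (x 0)
    have l := lactTau_dOt0_zero hτ hL hσ hA (x 0)
    have r := rightTau_dOt0_zero hτ hR hS hσ hA (x 0)
    rw [bAll_zero, bAll_zero, bAll_succ]
    simp only [map_add, map_sub]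
    rw [Pi.zero_apply]
    linear_combination (norm := module) h₂ 0 - l₂ 0 + r₂ 0 - c₂ 0 + h₁ 0 - l₁ 0 + r₁ 0 + h - l + r
  · rw [bAll_succ, bAll_zero, bAll_succ, bAll_succ]
    simp only [map_add, map_sub]
    rw [Pi.zero_apply]
    linear_combination (norm := module) h₂ 1 - l₂ 1 + r₂ 1 - c₂ 1 + h₁ 1 - l₁ 1 + r₁ 1 +
      h₀ 0 - l₀ 0 + r₀ 0 + e₁ 0
  · rw [bAll_succ, bAll_succ, bAll_succ, bAll_succ]
    simp only [map_add, map_sub]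
    rw [Pi.zero_apply]
    linear_combination (norm := module) h₂ (n + 2) - l₂ (n + 2) + r₂ (n + 2) - c₂ (n + 2) +
      h₁ (n + 2) - l₁ (n + 2) + r₁ (n + 2) + h₀ (n + 1) - l₀ (n + 1) + r₀ (n + 1) + e₁ (n + 1) +
        e₀ n

end Deformed
/-! ### The differential graded module structure -/

section Module

variable {P : BarParts k Γ R} {τ : ∀ n, P.T n →ₗ[k] R.A} (hτ : IsTwistingCochain P τ)
  {lact : ZMod 2 → (∀ n, P.T n →ₗ[k] R.A) → (n i : ℕ) →
    (R.A ⊗[k] P.T n) →ₗ[k] (R.A ⊗[k] P.T i)} (hL : IsLact P lact)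
  {ract : ZMod 2 → (∀ n, P.T n →ₗ[k] R.A) → (n j : ℕ) →
    (R.A ⊗[k] P.T n) →ₗ[k] (R.A ⊗[k] P.T j)} (hR : IsRact P ract)
  {sgnAT : ZMod 2 → (n : ℕ) → (R.A ⊗[k] P.T n) →ₗ[k] (R.A ⊗[k] P.T n)}
  (hS : IsSgnAT P sgnAT)
  {sgnA : ZMod 2 → R.A →ₗ[k] R.A} (hσ : IsSgnA R sgnA)
  (hA : Submodule.span k {x : R.A | ∃ γ, x ∈ R.deg γ} = ⊤)
  {γf : Γ} {f : ∀ n, P.T n →ₗ[k] R.A} (hf : HomogOnChains P γf f)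

include hτ hL hA hf in
lemma lact_dTauP (q : ZMod 2) (n m : ℕ) (ω : R.A ⊗[k] P.T n) :
    lact q (dTauP P τ γf f) n m ω =
      lact q (fun n => R.d ∘ₗ f n) n m ω -
        zsign k (par γf) • (lact q (compD2 P f) n m ω + lact q (compD1 P f) n m ω +
          lact q (compD0 P f) n m ω) -
        (lact 1 τ (m + 1) m (lact (par γf) f n (m + 1) ω) -
          zsign k (par γf) • lact q (convP P 1 f τ) n m ω) := by
  have h : dTauP P τ γf f = ((fun n => R.d ∘ₗ f n) -
      zsign k (par γf) • (compD2 P f + compD1 P f + compD0 P f)) -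
        (convP P (par γf) τ f - zsign k (par γf) • convP P 1 f τ) := by
    rw [← compDelta_eq, dTauP, gsign2_eq, par_one, one_mul,
      show GradingGroup.parity (1 : Γ) = 1 from par_one]
    rfl
  rw [h, hL.sub_apply hA, hL.sub_apply hA, hL.sub_apply hA, hL.map_smul hA, hL.map_smul hA,
    hL.map_add hA, hL.map_add hA, lact_convP_tau_left hτ hL hA hf (par γf) q 1]
  rfl

include hτ hL hR hS hσ hA hf

omit hR hS in
lemma deformed_lact_zero (q : ZMod 2) (m : ℕ) (ω : R.A ⊗[k] P.T 0) :
    dOt2 P sgnA m (lact (par γf) f 0 (m + 1) ω) + dOt1 P sgnA m (lact (par γf) f 0 m ω) +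
        (match m with
          | 0 => 0
          | m' + 1 => dOt0 P sgnA m' (lact (par γf) f 0 m' ω)) -
        lact 1 τ (m + 1) m (lact (par γf) f 0 (m + 1) ω) +
        rightTau P ract sgnAT τ m (lact (par γf) f 0 (m + 1) ω) =
      lact q (dTauP P τ γf f) 0 m ω +
        zsign k (par γf) •
          (lact (par γf) f 1 m (dOt0 P sgnA 0 ω) + lact (par γf) f 0 m (dOt1 P sgnA 0 ω)) := by
  have hp := hf.hasParity hσ
  have s : zsign k (par γf) * zsign k (par γf) = 1 := zsign_mul_self k _
  have h₁ := LinearMap.congr_fun (dOt1_lact hσ hA hL hp (par γf) q 0 m) ω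
  have hΔ := lact_dTauP hτ hL hA hf q 0 m ω
  simp only [LinearMap.add_apply, LinearMap.smul_apply, LinearMap.comp_apply] at h₁
  have h₂ : lact (par γf) f 0 (m + 1) ω = 0 := by rw [hL.1 _ _ _ _ (Nat.succ_pos m)]; rfl
  have h₂' : lact q (compD2 P f) 0 m ω = 0 := by
    rcases m with _ | m
    · rw [hL.eq_zero hA (l := 0) rfl rfl]; rfl
    · rw [hL.1 _ _ _ _ (Nat.succ_pos m)]; rfl
  have hc : lact q (convP P 1 f τ) 0 m ω = 0 := LinearMap.congr_fun
    (lact_convP_tau_right_zero hτ hL hA 1 q f m) ω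
  rw [h₂, map_zero, map_zero, map_zero, hΔ, h₂, map_zero, h₂', hc]
  rcases m with _ | m
  · have h₀ := LinearMap.congr_fun
      (lact_dOt0_zero hσ hA hL (f := f) (par γf) q 0) ω
    rw [LinearMap.comp_apply] at h₀
    rw [h₀]
    linear_combination (norm := module) h₁
  · have h₀ := LinearMap.congr_fun
      (lact_dOt0_succ hσ hA hL hp (par γf) q 0 m) ω
    simp only [LinearMap.add_apply, LinearMap.smul_apply, LinearMap.comp_apply] at h₀
    simp only [h₀, smul_add, smul_smul, s, one_smul]
    linear_combination (norm := module) h₁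

lemma deformed_lact_succ (q : ZMod 2) (n m : ℕ) (ω : R.A ⊗[k] P.T (n + 1)) :
    dOt2 P sgnA m (lact (par γf) f (n + 1) (m + 1) ω) + dOt1 P sgnA m (lact (par γf) f (n + 1) m ω) +
        (match m with
          | 0 => 0
          | m' + 1 => dOt0 P sgnA m' (lact (par γf) f (n + 1) m' ω)) -
        lact 1 τ (m + 1) m (lact (par γf) f (n + 1) (m + 1) ω) +
        rightTau P ract sgnAT τ m (lact (par γf) f (n + 1) (m + 1) ω) =
      lact q (dTauP P τ γf f) (n + 1) m ω +
        zsign k (par γf) •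
          (lact (par γf) f (n + 2) m (dOt0 P sgnA (n + 1) ω) +
            lact (par γf) f (n + 1) m (dOt1 P sgnA (n + 1) ω) +
            lact (par γf) f n m (dOt2 P sgnA n ω - lact 1 τ (n + 1) n ω +
              rightTau P ract sgnAT τ n ω)) := by
  have hp := hf.hasParity hσ
  have s : zsign k (par γf) * zsign k (par γf) = 1 := zsign_mul_self k _
  have h₁ := LinearMap.congr_fun (dOt1_lact hσ hA hL hp (par γf) q (n + 1) m) ω
  have hΔ := lact_dTauP hτ hL hA hf q (n + 1) m ω
  simp only [LinearMap.add_apply, LinearMap.smul_apply, LinearMap.comp_apply] at h₁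
  have h₂ := LinearMap.congr_fun (lact_dOt2 hσ hA hL hp (par γf) q n m) ω
  have hl := LinearMap.congr_fun
    (lact_convP_tau_right hτ hL hA (par γf) q 1 f n m) ω
  have hr := LinearMap.congr_fun
    (rightTau_lact hτ hR hS hA hL hf (par γf) n m) ω
  simp only [LinearMap.add_apply, LinearMap.smul_apply, LinearMap.comp_apply] at h₂ hl hr
  simp only [map_add, map_sub]
  rw [hΔ, hl, hr, h₂]
  rcases m with _ | m
  · have h₀ := LinearMap.congr_fun
      (lact_dOt0_zero hσ hA hL (f := f) (par γf) q (n + 1)) ω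
    rw [LinearMap.comp_apply] at h₀
    rw [h₀]
    simp only [smul_add, smul_sub, smul_smul, s, one_smul]
    linear_combination (norm := module) h₁
  · have h₀ := LinearMap.congr_fun
      (lact_dOt0_succ hσ hA hL hp (par γf) q (n + 1) m) ω
    simp only [LinearMap.add_apply, LinearMap.smul_apply, LinearMap.comp_apply] at h₀
    simp only [h₀, smul_add, smul_sub, smul_smul, s, one_smul]
    linear_combination (norm := module) h₁

end Module
/-! ### Comparison with the Hochschild differential -/

section Hochschild

variable {P : BarParts k Γ R} {τ : ∀ n, P.T n →ₗ[k] R.A} (hτ : IsTwistingCochain P τ)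
  {lact : ZMod 2 → (∀ n, P.T n →ₗ[k] R.A) → (n i : ℕ) →
    (R.A ⊗[k] P.T n) →ₗ[k] (R.A ⊗[k] P.T i)} (hL : IsLact P lact)
  {ract : ZMod 2 → (∀ n, P.T n →ₗ[k] R.A) → (n j : ℕ) →
    (R.A ⊗[k] P.T n) →ₗ[k] (R.A ⊗[k] P.T j)} (hR : IsRact P ract)
  {sgnAT : ZMod 2 → (n : ℕ) → (R.A ⊗[k] P.T n) →ₗ[k] (R.A ⊗[k] P.T n)}
  (hS : IsSgnAT P sgnAT)
  {sgnA : ZMod 2 → R.A →ₗ[k] R.A} (hσ : IsSgnA R sgnA)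
  (hA : Submodule.span k {x : R.A | ∃ γ, x ∈ R.deg γ} = ⊤)

lemma par_sub_one (γ : Γ) : par (γ - 1) = par γ + 1 := by
  rw [par, map_sub, show GradingGroup.parity (1 : Γ) = 1 from par_one]
  exact CharTwo.sub_eq_add _ _

include hτ hL hR hS hσ hA in
lemma hochschild_two_eq {n : ℕ} (b : R.A ⊗[k] P.T (n + 1) →ₗ[k] R.A ⊗[k] P.T n)
    (hb : ∀ (γ₀ : Γ) (a₀ : R.A) (a : ℕ → R.A) (g : ℕ → Γ),
      a₀ ∈ R.deg γ₀ → R.HomogBar (n + 1) g a →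
      b (a₀ ⊗ₜ[k] P.tgen (n + 1) a) =
        gsign k γ₀ • ((a₀ * a 0) ⊗ₜ[k] P.tgen n (fun t => a (t + 1))) +
          (∑ j ∈ range n, gsign k (γ₀ + (degSum g (j + 1) - ((j + 1 : ℕ) : Γ))) •
            (a₀ ⊗ₜ[k] P.tgen n (contractChain a j))) -
          gsign2 k (g n - 1) (γ₀ + (degSum g n - (n : Γ))) •
            ((a n * a₀) ⊗ₜ[k] P.tgen n a)) :
    b + lact 1 τ (n + 1) n = dOt2 P sgnA n + rightTau P ract sgnAT τ n := by
  refine tensor_hom_ext P hA fun γ₀ a₀ a g h₀ ha => ?_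
  rw [LinearMap.add_apply, LinearMap.add_apply, hb γ₀ a₀ a g h₀ ha, lact_tau_tgen hτ hL 1 h₀ ha,
    dOt2_tmul_tgen P (hσ.apply_one h₀) ha, rightTau_tgen hτ hR hS h₀ ha, gsign2_eq, par_sub_one,
    par_add, par_degSum_sub, mul_comm, sub_add_cancel, gsign_eq, add_comm]
  congr 1
  refine sum_congr rfl fun j _ => ?_
  rw [gsign_eq, par_add, par_degSum_sub]

include hσ hA in
lemma hochschild_one_eq {n : ℕ} (b : R.A ⊗[k] P.T n →ₗ[k] R.A ⊗[k] P.T n)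
    (hb : ∀ (γ₀ : Γ) (a₀ : R.A) (a : ℕ → R.A) (g : ℕ → Γ),
      a₀ ∈ R.deg γ₀ → R.HomogBar n g a →
      b (a₀ ⊗ₜ[k] P.tgen n a) = (R.d a₀) ⊗ₜ[k] P.tgen n a +
        ∑ j ∈ range n, gsign k (γ₀ + (degSum g j - ((j + 1 : ℕ) : Γ))) •
          (a₀ ⊗ₜ[k] P.tgen n (Function.update a j (R.d (a j))))) :
    b = dOt1 P sgnA n := by
  refine tensor_hom_ext P hA fun γ₀ a₀ a g h₀ ha => ?_
  rw [hb γ₀ a₀ a g h₀ ha, dOt1_tmul_tgen P (hσ.apply_one h₀) ha]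
  congr 1
  refine sum_congr rfl fun j _ => ?_
  rw [gsign_eq, par_add, par_degSum_sub_succ]

include hσ hA in
lemma hochschild_zero_eq {n : ℕ} (b : R.A ⊗[k] P.T n →ₗ[k] R.A ⊗[k] P.T (n + 1))
    (hb : ∀ (γ₀ : Γ) (a₀ : R.A) (a : ℕ → R.A) (g : ℕ → Γ),
      a₀ ∈ R.deg γ₀ → R.HomogBar n g a →
      b (a₀ ⊗ₜ[k] P.tgen n a) = ∑ j ∈ range (n + 1),
        gsign k (γ₀ + (degSum g j - (j : Γ))) •
          (a₀ ⊗ₜ[k] P.tgen (n + 1) (insertAt a j R.hEl))) :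
    b = dOt0 P sgnA n := by
  refine tensor_hom_ext P hA fun γ₀ a₀ a g h₀ ha => ?_
  rw [hb γ₀ a₀ a g h₀ ha, dOt0_tmul_tgen P (hσ.apply_one h₀) ha]
  refine sum_congr rfl fun j _ => ?_
  rw [gsign_eq, par_add, par_degSum_sub]

end Hochschild
/-- Let `k` be a field, `(A, d, h)` a cdga over `k`, and `τ` the
twisting cochain equal to `s⁻¹` on `(ΣA)^{⊗1}` and zero elsewhere.  Then the
endomorphism `d_⊗ − [τ, −]` of `A ⊗_k T` squares to zero and makes `A ⊗_k T` a left
differential graded module over the dga `(Hom_k(T,A), ⋆, d_τ)`; moreover, under the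
identification `A ⊗_k T = Hoch(A)`, the differential `d_⊗ − [τ, −]` coincides with
the Hochschild differential `b = b₂ + b₁ + b₀`. -/
theorem dOt_minus_tau_is_hochschild_differential
    (k Γ : Type) [Field k] [GradingGroup Γ]
    (R : CurvedDGA k Γ) (P : BarParts k Γ R)
    (sgnA : ZMod 2 → R.A →ₗ[k] R.A) (hsgnA : IsSgnA R sgnA)
    (sgnAT : ZMod 2 → (n : ℕ) → (R.A ⊗[k] P.T n) →ₗ[k] (R.A ⊗[k] P.T n))
    (hsgnAT : IsSgnAT P sgnAT)
    (lact : ZMod 2 → (∀ n, P.T n →ₗ[k] R.A) → (n i : ℕ) →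
      (R.A ⊗[k] P.T n) →ₗ[k] (R.A ⊗[k] P.T i)) (hlact : IsLact P lact)
    (ract : ZMod 2 → (∀ n, P.T n →ₗ[k] R.A) → (n j : ℕ) →
      (R.A ⊗[k] P.T n) →ₗ[k] (R.A ⊗[k] P.T j)) (hract : IsRact P ract)
    -- the element `τ` :
    (tauH : ∀ n, P.T n →ₗ[k] R.A)
    (tauH1 : ∀ a : ℕ → R.A, tauH 1 (P.tgen 1 a) = a 0)
    (tauH0 : tauH 0 = 0)
    (tauHS : ∀ n : ℕ, tauH (n + 2) = 0)
    -- the Hochschild differential `b = b₂ + b₁ + b₀` of `Hoch(A) = A ⊗ T` :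
    (bH2 : (n : ℕ) → (R.A ⊗[k] P.T (n + 1)) →ₗ[k] (R.A ⊗[k] P.T n))
    (bH1 : (n : ℕ) → (R.A ⊗[k] P.T n) →ₗ[k] (R.A ⊗[k] P.T n))
    (bH0 : (n : ℕ) → (R.A ⊗[k] P.T n) →ₗ[k] (R.A ⊗[k] P.T (n + 1)))
    (hbH2 : ∀ (n : ℕ) (γ₀ : Γ) (a₀ : R.A) (b : ℕ → R.A) (g : ℕ → Γ),
      a₀ ∈ R.deg γ₀ → R.HomogBar (n + 1) g b →
      bH2 n (a₀ ⊗ₜ[k] P.tgen (n + 1) b) =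
        gsign k γ₀ • ((a₀ * b 0) ⊗ₜ[k] P.tgen n (fun t => b (t + 1))) +
          (∑ j ∈ Finset.range n,
            gsign k (γ₀ + (degSum g (j + 1) - ((j + 1 : ℕ) : Γ))) •
              (a₀ ⊗ₜ[k] P.tgen n (contractChain b j))) -
          gsign2 k (g n - 1) (γ₀ + (degSum g n - (n : Γ))) •
            ((b n * a₀) ⊗ₜ[k] P.tgen n b))
    (hbH1 : ∀ (n : ℕ) (γ₀ : Γ) (a₀ : R.A) (b : ℕ → R.A) (g : ℕ → Γ),
      a₀ ∈ R.deg γ₀ → R.HomogBar n g b →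
      bH1 n (a₀ ⊗ₜ[k] P.tgen n b) =
        (R.d a₀) ⊗ₜ[k] P.tgen n b +
          ∑ j ∈ Finset.range n,
            gsign k (γ₀ + (degSum g j - ((j + 1 : ℕ) : Γ))) •
              (a₀ ⊗ₜ[k] P.tgen n (Function.update b j (R.d (b j)))))
    (hbH0 : ∀ (n : ℕ) (γ₀ : Γ) (a₀ : R.A) (b : ℕ → R.A) (g : ℕ → Γ),
      a₀ ∈ R.deg γ₀ → R.HomogBar n g b →
      bH0 n (a₀ ⊗ₜ[k] P.tgen n b) =
        ∑ j ∈ Finset.range (n + 1),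
          gsign k (γ₀ + (degSum g j - (j : Γ))) •
            (a₀ ⊗ₜ[k] P.tgen (n + 1) (insertAt b j R.hEl))) :
    -- `(d_⊗ − [τ,−])² = 0` :
    (∀ x : ∀ n, R.A ⊗[k] P.T n,
      bAll P sgnA lact ract sgnAT tauH (bAll P sgnA lact ract sgnAT tauH x) = 0) ∧
    -- `A ⊗ T` is a left dg module over `(Hom_k(T,A), ⋆, d_τ)` :
    (∀ (γf : Γ) (f : ∀ n, P.T n →ₗ[k] R.A), HomogMap P γf f →
      ∀ (n m : ℕ) (ω : R.A ⊗[k] P.T n),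
        (dOt2 P sgnA m (lact (GradingGroup.parity γf) f n (m + 1) ω) +
          dOt1 P sgnA m (lact (GradingGroup.parity γf) f n m ω) +
          (match m with
            | 0 => 0
            | m' + 1 => dOt0 P sgnA m' (lact (GradingGroup.parity γf) f n m' ω)) -
          lact 1 tauH (m + 1) m (lact (GradingGroup.parity γf) f n (m + 1) ω) +
          ract 1 tauH (m + 1) m
            (sgnAT 1 (m + 1) (lact (GradingGroup.parity γf) f n (m + 1) ω))) =
        lact (GradingGroup.parity (γf + 1)) (dTauP P tauH γf f) n m ω +
          gsign k γf •
            (lact (GradingGroup.parity γf) f (n + 1) m (dOt0 P sgnA n ω) +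
              lact (GradingGroup.parity γf) f n m (dOt1 P sgnA n ω) +
              (match n, ω with
                | 0, _ => 0
                | n' + 1, ω' =>
                    lact (GradingGroup.parity γf) f n' m
                      (dOt2 P sgnA n' ω' - lact 1 tauH (n' + 1) n' ω' +
                        ract 1 tauH (n' + 1) n' (sgnAT 1 (n' + 1) ω'))))) ∧
    -- `d_⊗ − [τ,−]` is the Hochschild differential `b = b₂ + b₁ + b₀` :
    (∀ x : ∀ n, R.A ⊗[k] P.T n,
      bAll P sgnA lact ract sgnAT tauH x =
        fun n => bH2 n (x (n + 1)) + bH1 n (x n) +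
          (match n with
            | 0 => 0
            | m + 1 => bH0 m (x m))) := by
  have hA := span_homogeneous_eq_top P tauH tauH1
  have hτ : IsTwistingCochain P tauH := ⟨tauH1, tauH0, tauHS⟩
  refine ⟨bAll_bAll hτ hlact hract hsgnAT hsgnA hA, fun γf f hf n m ω => ?_, fun x => ?_⟩
  · rcases n with _ | n
    · exact (deformed_lact_zero hτ hlact hsgnA hA hf.homogOnChains (par (γf + 1)) m ω).trans
        (congrArg (lact (par (γf + 1)) (dTauP P tauH γf f) 0 m ω + zsign k (par γf) • ·)
          (add_zero _).symm)
    · exact deformed_lact_succ hτ hlact hract hsgnAT hsgnA hA hf.homogOnChains _ n m ω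
  · have h₂ := fun n => LinearMap.congr_fun
      (hochschild_two_eq hτ hlact hract hsgnAT hsgnA hA (bH2 n) (hbH2 n)) (x (n + 1))
    simp only [LinearMap.add_apply] at h₂
    funext n
    rw [hochschild_one_eq hsgnA hA (bH1 n) (hbH1 n)]
    rcases n with _ | n
    · rw [bAll_zero, eq_sub_of_add_eq (h₂ 0)]
      simp only [add_zero]
      abel
    · rw [bAll_succ, eq_sub_of_add_eq (h₂ (n + 1))]
      simp only [hochschild_zero_eq hsgnA hA (bH0 n) (hbH0 n)]
      abel

end
end

section
/- Let k be a field of characteristic 0 and 𝒞 a curved differential Γ-graded category over k. Then, as maps H̄och^{II}(𝒞)[[v]] → (𝒞/[𝒞,𝒞])[[v]], one has v·(d̄ ∘ φ) = −v·(φ ∘ b₂) + φ ∘ B, where b₂ is the bar (composition) part of the Hochschild differential, B is the Connes operator, and d̄ is the map induced on 𝒞/[𝒞,𝒞] by the differentials of 𝒞. (Indeed both identities φ∘B = v·β and φ∘b₂ = −γ hold, where β and γ denote the summands of d̄∘φ obtained by differentiating the leading entry a₀ and by differentiating the entries d(aᵢ), respectively.) -/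
noncomputable section

open Finset

/-- A curved differential `Γ`-graded category over `k`, presented through its
"category algebra": `E` is an ambient unital `k`-algebra containing all the
morphism spaces `Hom X Y` (composition being the multiplication of `E`),
`deg γ` is the subspace of homogeneous elements of degree `γ`, `diff` is the
family of degree-one differentials `δ`, and `curv X ∈ Hom X X` are the degree-two
curvature elements, satisfying `δ(h_X) = 0` and `δ²(f) = h_Y f − f h_X`. -/
structure CdgCategory (k : Type) [Field k] (Γ : Type) [GradingGroup Γ] where
  Obj : Type
  E : Type
  [ringE : Ring E]
  [algE : Algebra k E]
  Hom : Obj → Obj → Submodule k E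
  deg : Γ → Submodule k E
  idm : Obj → E
  diff : E →ₗ[k] E
  curv : Obj → E
  idm_mem : ∀ X, idm X ∈ Hom X X
  idm_deg : ∀ X, idm X ∈ deg 0
  mul_hom_mem : ∀ {X Y Z : Obj} {f g : E}, f ∈ Hom Y Z → g ∈ Hom X Y → f * g ∈ Hom X Z
  mul_deg_mem : ∀ {γ γ' : Γ} {f g : E}, f ∈ deg γ → g ∈ deg γ' → f * g ∈ deg (γ + γ')
  idm_comp : ∀ {X Y : Obj} {g : E}, g ∈ Hom X Y → idm Y * g = g
  comp_idm : ∀ {X Y : Obj} {g : E}, g ∈ Hom X Y → g * idm X = g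
  diff_hom : ∀ {X Y : Obj} {f : E}, f ∈ Hom X Y → diff f ∈ Hom X Y
  diff_deg : ∀ {γ : Γ} {f : E}, f ∈ deg γ → diff f ∈ deg (γ + 1)
  diff_leibniz : ∀ {γ : Γ} {f : E}, f ∈ deg γ → ∀ g : E,
      diff (f * g) = diff f * g + gsign k γ • (f * diff g)
  curv_mem : ∀ X, curv X ∈ Hom X X
  curv_deg : ∀ X, curv X ∈ deg (2 : Γ)
  diff_sq : ∀ {X Y : Obj} {f : E}, f ∈ Hom X Y → diff (diff f) = curv Y * f - f * curv X
  diff_curv : ∀ X, diff (curv X) = 0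

attribute [instance] CdgCategory.ringE CdgCategory.algE

variable {k Γ : Type} [Field k] [GradingGroup Γ]

/-- `a 0, …, a n` is a cyclically composable chain of morphisms for the objects
`X 0, …, X n` (with `X (n+1) = X 0`), i.e. `aᵢ : X_{i+1} → X_i`. -/
def CdgCategory.Composable (C : CdgCategory k Γ) (n : ℕ)
    (X : ℕ → C.Obj) (a : ℕ → C.E) : Prop :=
  ∀ i ≤ n, a i ∈ C.Hom (cyc n X (i + 1)) (X i)

/-- Each `a i` (for `i ≤ n`) is homogeneous of degree `g i`. -/
def CdgCategory.Homog (C : CdgCategory k Γ) (n : ℕ) (g : ℕ → Γ) (a : ℕ → C.E) : Prop :=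
  ∀ i ≤ n, a i ∈ C.deg (g i)

/-- A model of the weight components of the reduced Hochschild complex of the second
kind `H̄och^{II}(C)` of a cdg category `C` : `W n` models the weight-`n` component,
`gen n X a` models the chain `a₀[ā₁|⋯|āₙ]` (for cyclically composable morphisms
`aᵢ : X_{i+1} → X_i`, `X_{n+1} = X₀`), and `H̄och^{II}(C) = ∏ₙ Wₙ`. -/
structure RedHochCore (k Γ : Type) [Field k] [GradingGroup Γ] (C : CdgCategory k Γ) where
  W : ℕ → Type
  [addW : ∀ n, AddCommGroup (W n)]
  [modW : ∀ n, Module k (W n)]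
  gen : (n : ℕ) → (ℕ → C.Obj) → (ℕ → C.E) → W n
  gen_ext : ∀ {n : ℕ} {X X' : ℕ → C.Obj} {a a' : ℕ → C.E},
      (∀ i ≤ n, X i = X' i) → (∀ i ≤ n, a i = a' i) → gen n X a = gen n X' a'
  gen_add : ∀ (n : ℕ) (X : ℕ → C.Obj) (a : ℕ → C.E) (i : ℕ), i ≤ n → ∀ x y : C.E,
      gen n X (Function.update a i (x + y)) =
        gen n X (Function.update a i x) + gen n X (Function.update a i y)
  gen_smul : ∀ (n : ℕ) (X : ℕ → C.Obj) (a : ℕ → C.E) (i : ℕ), i ≤ n → ∀ (c : k) (x : C.E),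
      gen n X (Function.update a i (c • x)) = c • gen n X (Function.update a i x)
  span_gen : ∀ n : ℕ, Submodule.span k
      {w : W n | ∃ X a g, C.Composable n X a ∧ C.Homog n g a ∧ w = gen n X a} = ⊤
  gen_reduced : ∀ (n : ℕ) (X : ℕ → C.Obj) (a : ℕ → C.E) (i : ℕ),
      1 ≤ i → i ≤ n → a i = C.idm (X i) → gen n X a = 0

attribute [instance] RedHochCore.addW RedHochCore.modW

variable {C : CdgCategory k Γ}

/-- The statement that `b₂` (the bar part of the Hochschild differential, including
the cyclic term) satisfies its defining formula on homogeneous composable chains. -/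
def IsB2 (H : RedHochCore k Γ C) (b2 : (n : ℕ) → H.W (n + 1) →ₗ[k] H.W n) : Prop :=
  ∀ (n : ℕ) (X : ℕ → C.Obj) (a : ℕ → C.E) (g : ℕ → Γ),
    C.Composable (n + 1) X a → C.Homog (n + 1) g a →
    b2 n (H.gen (n + 1) X a) =
      (∑ j ∈ Finset.range (n + 1), gsign k (degSum g (j + 1) - (j : Γ)) •
          H.gen n (dropIdx X j) (contractChain a j))
      - gsign2 k (g (n + 1) - 1) (degSum g (n + 1) - (n : Γ)) •
          H.gen n (fun i => if i = 0 then X (n + 1) else X i)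
                (fun i => if i = 0 then a (n + 1) * a 0 else a i)

/-- The statement that `B` is the Connes cyclic operator of the reduced complex,
`B(a₀[ā₁|⋯|āₙ]) = ∑ₗ ± 1[ā_l|⋯|āₙ|ā₀|⋯|ā_{l−1}]`, with its Koszul signs. -/
def IsConnesB (H : RedHochCore k Γ C) (B : (n : ℕ) → H.W n →ₗ[k] H.W (n + 1)) : Prop :=
  ∀ (n : ℕ) (X : ℕ → C.Obj) (a : ℕ → C.E) (g : ℕ → Γ),
    C.Composable n X a → C.Homog n g a →
    B n (H.gen n X a) = ∑ l ∈ Finset.range (n + 1),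
      gsign2 k ((∑ t ∈ Finset.Ico l (n + 1), g t) - ((n - l + 1 : ℕ) : Γ))
               (degSum g l - (l : Γ)) •
        H.gen (n + 1) (fun i => if i = 0 then cyc n X l else cyc n X (l + i - 1))
                      (fun i => if i = 0 then C.idm (cyc n X l)
                                else a ((l + i - 1) % (n + 1)))

/-- The word `a₀ h₁^{j₀} d(a₁) h₂^{j₁} ⋯ hₙ^{j_{n−1}} d(aₙ) h₀^{jₙ}` appearing in the
definition of the map `φ`. -/
def phiWord (C : CdgCategory k Γ) (n : ℕ) (X : ℕ → C.Obj) (a : ℕ → C.E) (v : ℕ → ℕ) :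
    C.E :=
  match n with
  | 0 => a 0 * (C.curv (X 0)) ^ (v 0)
  | m + 1 =>
      a 0 * (C.curv (cyc (m + 1) X 1)) ^ (v 0) *
        chainProd
          (fun t => C.diff (a (t + 1)) * (C.curv (cyc (m + 1) X (t + 2))) ^ (v (t + 1))) m

/-- The statement that the `k[v]`-linear map `φ : H̄och^{II}(𝒞)[[v]] → (𝒞/[𝒞,𝒞])[[v]]`
is given on chains by
`φ(a₀[a₁|⋯|aₙ]) = ∑_{j₀,…,jₙ ≥ 0} (a₀ h₁^{j₀} d(a₁) ⋯ d(aₙ) h₀^{jₙ} / (J+n)!) v^{J+n}`.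
Here `phi n : W n →ₗ Q[[v]]` is the component of `φ` on weight-`n` chains, a power
series in `v` being modelled as the function recording its coefficients. -/
def IsPhi {Q : Type} [AddCommGroup Q] [Module k Q]
    (H : RedHochCore k Γ C) (q : C.E →ₗ[k] Q)
    (phi : (n : ℕ) → H.W n →ₗ[k] (ℕ → Q)) : Prop :=
  ∀ (n : ℕ) (X : ℕ → C.Obj) (a : ℕ → C.E) (g : ℕ → Γ),
    C.Composable n X a → C.Homog n g a →
    phi n (H.gen n X a) = fun p =>
      if n ≤ p then
        ((p.factorial : k))⁻¹ •
          ∑ v ∈ Finset.Nat.antidiagonalTuple (n + 1) (p - n),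
            q (phiWord C n X a (extTuple v))
      else 0

section Signs

theorem negOnePow_zmod_add (x y : ZMod 2) :
    (-1 : k) ^ (x + y).val = (-1 : k) ^ x.val * (-1 : k) ^ y.val := by
  have h : ((x + y).val : ZMod 2) = ((x.val + y.val : ℕ) : ZMod 2) := by simp
  rw [← pow_add]
  refine neg_one_pow_congr ?_
  rw [ZMod.natCast_eq_natCast_iff'] at h
  rw [Nat.even_iff, Nat.even_iff, h]

theorem gsign_add (γ γ' : Γ) : gsign k (γ + γ') = gsign k γ * gsign k γ' := by
  simp only [gsign, map_add, negOnePow_zmod_add]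

theorem gsign2_add_left (γ γ' γ'' : Γ) :
    gsign2 k (γ + γ') γ'' = gsign2 k γ γ'' * gsign2 k γ' γ'' := by
  simp only [gsign2, map_add, add_mul, negOnePow_zmod_add]

theorem gsign2_comm (γ γ' : Γ) : gsign2 k γ γ' = gsign2 k γ' γ := by
  simp only [gsign2, mul_comm]

theorem gsign2_zero_right (γ : Γ) : gsign2 k γ 0 = 1 := by
  simp [gsign2]

theorem gsign2_one_left (γ : Γ) : gsign2 k 1 γ = gsign k γ := by
  simp [gsign2, gsign, GradingGroup.parity_one]

theorem gsign_zero : gsign k (0 : Γ) = 1 := by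
  simp [gsign]

theorem gsign_one : gsign k (1 : Γ) = -1 := by
  simp [gsign, GradingGroup.parity_one, ZMod.val_one]

theorem gsign_mul_self (γ : Γ) : gsign k γ * gsign k γ = 1 := by
  simp only [gsign, ← mul_pow, neg_mul_neg, one_mul, one_pow]

theorem gsign2_mul_self (γ γ' : Γ) : gsign2 k γ γ' * gsign2 k γ γ' = 1 := by
  simp only [gsign2, ← mul_pow, neg_mul_neg, one_mul, one_pow]

theorem parity_nsmul_two (j : ℕ) : GradingGroup.parity (j • (2 : Γ)) = 0 := by
  have h : (2 : Γ) = 1 + 1 := one_add_one_eq_two.symm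
  rw [map_nsmul, h, map_add, CharTwo.add_self_eq_zero, smul_zero]

theorem gsign_add_nsmul_two (γ : Γ) (j : ℕ) : gsign k (γ + j • (2 : Γ)) = gsign k γ := by
  simp only [gsign, map_add, parity_nsmul_two, add_zero]

theorem gsign2_add_nsmul_two (γ γ' : Γ) (i j : ℕ) :
    gsign2 k (γ + i • (2 : Γ)) (γ' + j • (2 : Γ)) = gsign2 k γ γ' := by
  simp only [gsign2, map_add, parity_nsmul_two, add_zero]

theorem gsign_add_sub_one_mul (γ γ' : Γ) :
    gsign k (γ + (γ' - 1)) * gsign k γ' = -gsign k γ := by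
  have h : gsign k (γ + (γ' - 1)) * gsign k (1 : Γ) = gsign k γ * gsign k γ' := by
    rw [← gsign_add, ← gsign_add]; congr 1; abel
  rw [gsign_one, mul_neg_one, neg_eq_iff_eq_neg] at h
  rw [h, neg_mul, mul_assoc, gsign_mul_self, mul_one]

theorem gsign2_sub_one_mul (γ γ' : Γ) :
    gsign2 k (γ - 1) γ' * gsign2 k γ γ' = gsign k γ' := by
  have h : gsign2 k (γ - 1) γ' * gsign2 k 1 γ' = gsign2 k γ γ' := by
    rw [← gsign2_add_left, sub_add_cancel]
  rw [← h, ← mul_assoc, gsign2_mul_self, one_mul, gsign2_one_left]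

end Signs

section SeqProd

/-- The ordered product `y 0 * y 1 * ⋯ * y (n - 1)`. -/
def seqProd {R : Type} [Monoid R] (y : ℕ → R) : ℕ → R
  | 0 => 1
  | n + 1 => seqProd y n * y n

theorem seqProd_congr {R : Type} [Monoid R] {y z : ℕ → R} {n : ℕ}
    (h : ∀ i < n, y i = z i) : seqProd y n = seqProd z n := by
  induction n with
  | zero => rfl
  | succ n ih => rw [seqProd, seqProd, ih fun i hi => h i (hi.trans n.lt_succ_self),
      h n n.lt_succ_self]

theorem seqProd_add {R : Type} [Monoid R] (y : ℕ → R) (m n : ℕ) :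
    seqProd y (m + n) = seqProd y m * seqProd (fun i => y (m + i)) n := by
  induction n with
  | zero => simp [seqProd]
  | succ n ih => rw [← add_assoc, seqProd, ih, mul_assoc, seqProd]

theorem seqProd_succ' {R : Type} [Monoid R] (y : ℕ → R) (n : ℕ) :
    seqProd y (n + 1) = y 0 * seqProd (fun i => y (i + 1)) n := by
  rw [add_comm n 1, seqProd_add]
  simp [seqProd, add_comm]

theorem seqProd_X_mul {R : Type} [Semiring R] (f : ℕ → PowerSeries R) (n : ℕ) :
    seqProd (fun i => PowerSeries.X * f i) n = PowerSeries.X ^ n * seqProd f n := by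
  induction n with
  | zero => simp [seqProd]
  | succ n ih =>
    rw [seqProd, seqProd, ih, pow_succ, mul_assoc, ← mul_assoc _ PowerSeries.X (f n),
      (PowerSeries.commute_X (seqProd f n)).eq, mul_assoc, mul_assoc]

theorem chainProd_eq_seqProd {R : Type} [Monoid R] (f : ℕ → R) (n : ℕ) :
    chainProd f n = seqProd f (n + 1) := by
  induction n with
  | zero => simp [chainProd, seqProd]
  | succ n ih => rw [chainProd, ih]; rfl

theorem sum_antidiagonalTuple_succ {M : Type} [AddCommMonoid M] (n m : ℕ)
    (F : (Fin (n + 1) → ℕ) → M) :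
    ∑ v ∈ Finset.Nat.antidiagonalTuple (n + 1) m, F v =
      ∑ ij ∈ antidiagonal m, ∑ v ∈ Finset.Nat.antidiagonalTuple n ij.2,
        F (Fin.cons ij.1 v) := by
  rw [Finset.sum_sigma']
  refine Finset.sum_bij' (fun v _ => ⟨(v 0, ∑ i, Fin.tail v i), Fin.tail v⟩)
    (fun s _ => Fin.cons s.1.1 s.2) ?_ ?_ ?_ ?_ ?_
  · intro v hv
    simpa [Finset.Nat.mem_antidiagonalTuple, Fin.sum_univ_succ, Fin.tail] using hv
  · rintro ⟨⟨i, j⟩, v⟩ hv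
    simp only [mem_sigma, Finset.HasAntidiagonal.mem_antidiagonal,
      Finset.Nat.mem_antidiagonalTuple] at hv
    simp [Finset.Nat.mem_antidiagonalTuple, Fin.sum_univ_succ, hv.1, hv.2]
  · intro v _
    simp
  · rintro ⟨⟨i, j⟩, v⟩ hv
    simp only [mem_sigma, Finset.HasAntidiagonal.mem_antidiagonal,
      Finset.Nat.mem_antidiagonalTuple] at hv
    simp [hv.2]
  · intro v _
    simp

theorem extTuple_cons_zero {n : ℕ} (i : ℕ) (v : Fin (n + 1) → ℕ) :
    extTuple (Fin.cons i v : Fin (n + 2) → ℕ) 0 = i := by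
  simp [extTuple]

theorem extTuple_cons_succ {n : ℕ} (i : ℕ) (v : Fin (n + 1) → ℕ) (t : ℕ) :
    extTuple (Fin.cons i v : Fin (n + 2) → ℕ) (t + 1) = extTuple v t := by
  simp only [extTuple, Nat.add_lt_add_iff_right]
  split_ifs with h
  · exact Fin.cons_succ (α := fun _ => ℕ) i v ⟨t, h⟩
  · rfl

theorem coeff_seqProd_mk {R : Type} [Semiring R] (f : ℕ → ℕ → R) (n m : ℕ) :
    PowerSeries.coeff m (seqProd (fun t => PowerSeries.mk (f t)) (n + 1)) =
      ∑ v ∈ Finset.Nat.antidiagonalTuple (n + 1) m,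
        seqProd (fun t => f t (extTuple v t)) (n + 1) := by
  induction n generalizing f m with
  | zero => simp [seqProd, extTuple]
  | succ n ih =>
    rw [seqProd_succ', PowerSeries.coeff_mul, sum_antidiagonalTuple_succ]
    refine Finset.sum_congr rfl fun ij _ => ?_
    rw [ih, PowerSeries.coeff_mk, Finset.mul_sum]
    refine Finset.sum_congr rfl fun v _ => ?_
    rw [seqProd_succ' _ (n + 1), extTuple_cons_zero]
    simp only [extTuple_cons_succ]

end SeqProd

namespace CdgCategory

open PowerSeries (coeff X coeff_mk coeff_mul)

theorem diff_idm (C : CdgCategory k Γ) (x : C.Obj) : C.diff (C.idm x) = 0 := by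
  have h := C.diff_leibniz (C.idm_deg x) (C.idm x)
  rw [C.idm_comp (C.idm_mem x), C.comp_idm (C.diff_hom (C.idm_mem x)),
    C.idm_comp (C.diff_hom (C.idm_mem x)), gsign_zero, one_smul] at h
  exact left_eq_add.mp h

/-- A power series whose `j`-th coefficient is a morphism `x → y` of degree `γ + 2j`; thus it is
homogeneous of degree `γ` when the formal variable has degree `-2`. -/
def IsMorphismSeries (C : CdgCategory k Γ) (x y : C.Obj) (γ : Γ) (A : PowerSeries C.E) : Prop :=
  ∀ j, coeff j A ∈ C.Hom x y ∧ coeff j A ∈ C.deg (γ + j • (2 : Γ))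

theorem IsMorphismSeries.mul {x y z : C.Obj} {γ γ' : Γ} {A B : PowerSeries C.E}
    (hA : C.IsMorphismSeries y z γ A) (hB : C.IsMorphismSeries x y γ' B) :
    C.IsMorphismSeries x z (γ + γ') (A * B) := by
  intro j
  rw [coeff_mul]
  refine ⟨Submodule.sum_mem _ fun p _ => C.mul_hom_mem (hA _).1 (hB _).1,
    Submodule.sum_mem _ fun p hp => ?_⟩
  have h : γ + γ' + j • (2 : Γ) = (γ + p.1 • (2 : Γ)) + (γ' + p.2 • (2 : Γ)) := by
    rw [← Finset.HasAntidiagonal.mem_antidiagonal.mp hp, add_smul]; abel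
  rw [h]
  exact C.mul_deg_mem (hA _).2 (hB _).2

theorem isMorphismSeries_C {x y : C.Obj} {γ : Γ} {f : C.E} (hf : f ∈ C.Hom x y)
    (hf' : f ∈ C.deg γ) : C.IsMorphismSeries x y γ (PowerSeries.C f) := by
  intro j
  rw [PowerSeries.coeff_C]
  split_ifs with h
  · subst h; simpa using ⟨hf, hf'⟩
  · exact ⟨Submodule.zero_mem _, Submodule.zero_mem _⟩

theorem isMorphismSeries_X_mul_C {x y : C.Obj} {γ : Γ} {f : C.E} (hf : f ∈ C.Hom x y)
    (hf' : f ∈ C.deg (γ + 2)) : C.IsMorphismSeries x y γ (X * PowerSeries.C f) := by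
  rintro (_ | j)
  · simp
  · rw [PowerSeries.coeff_succ_X_mul, PowerSeries.coeff_C]
    split_ifs with h
    · subst h; simpa using ⟨hf, hf'⟩
    · exact ⟨Submodule.zero_mem _, Submodule.zero_mem _⟩

/-- The geometric series `∑ h_x^j t^j` in `End x`. -/
def curvSeries (C : CdgCategory k Γ) (x : C.Obj) : PowerSeries C.E :=
  PowerSeries.mk fun j => C.idm x * C.curv x ^ j

theorem isMorphismSeries_curvSeries (x : C.Obj) :
    C.IsMorphismSeries x x 0 (C.curvSeries x) := by
  intro j
  rw [curvSeries, coeff_mk]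
  induction j with
  | zero => simpa using ⟨C.idm_mem x, C.idm_deg x⟩
  | succ j ih =>
    rw [pow_succ, ← mul_assoc]
    refine ⟨C.mul_hom_mem ih.1 (C.curv_mem x), ?_⟩
    rw [succ_nsmul, ← add_assoc]
    exact C.mul_deg_mem ih.2 (C.curv_deg x)

theorem C_mul_curvSeries {x y : C.Obj} {f : C.E} (hf : f ∈ C.Hom x y) :
    PowerSeries.C f * C.curvSeries x = PowerSeries.mk fun j => f * C.curv x ^ j := by
  ext j
  rw [PowerSeries.coeff_C_mul, curvSeries, coeff_mk, coeff_mk, ← mul_assoc, C.comp_idm hf]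

theorem curvSeries_mul_curvSeries (x : C.Obj) :
    C.curvSeries x * C.curvSeries x = PowerSeries.mk fun j => ((j + 1 : ℕ) : k) • (C.idm x * C.curv x ^ j) := by
  ext j
  rw [coeff_mul, coeff_mk, Finset.sum_congr rfl (g := fun _ => C.idm x * C.curv x ^ j)]
  · rw [Finset.sum_const, Finset.Nat.card_antidiagonal, Nat.cast_smul_eq_nsmul]
  · intro p hp
    have h := (isMorphismSeries_curvSeries x p.1).1
    rw [← Finset.HasAntidiagonal.mem_antidiagonal.mp hp]
    rw [curvSeries, coeff_mk] at h ⊢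
    rw [coeff_mk, ← mul_assoc, C.comp_idm h, mul_assoc, pow_add]

theorem curv_mul_idm (x : C.Obj) : C.curv x * C.idm x = C.idm x * C.curv x := by
  rw [C.comp_idm (C.curv_mem x), C.idm_comp (C.curv_mem x)]

theorem X_mul_C_curv_mul_curvSeries (x : C.Obj) :
    X * PowerSeries.C (C.curv x) * C.curvSeries x =
      C.curvSeries x - PowerSeries.C (C.idm x) := by
  ext (_ | j)
  · simp [mul_assoc, curvSeries]
  · rw [mul_assoc, PowerSeries.coeff_succ_X_mul, PowerSeries.coeff_C_mul, map_sub, curvSeries,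
      coeff_mk, coeff_mk, PowerSeries.coeff_C, if_neg j.succ_ne_zero, sub_zero, ← mul_assoc,
      curv_mul_idm, mul_assoc, ← pow_succ']

theorem curvSeries_mul_X_mul_C_curv (x : C.Obj) :
    C.curvSeries x * (X * PowerSeries.C (C.curv x)) =
      C.curvSeries x - PowerSeries.C (C.idm x) := by
  rw [← mul_assoc, (PowerSeries.commute_X _).eq]
  ext (_ | j)
  · simp [mul_assoc, curvSeries]
  · rw [mul_assoc, PowerSeries.coeff_succ_X_mul, PowerSeries.coeff_mul_C, map_sub, curvSeries,
      coeff_mk, coeff_mk, PowerSeries.coeff_C, if_neg j.succ_ne_zero, sub_zero, mul_assoc,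
      ← pow_succ]

theorem curvSeries_mul_diff_diff_mul_curvSeries {x y : C.Obj} {f : C.E} (hf : f ∈ C.Hom x y) :
    C.curvSeries y * (X * PowerSeries.C (C.diff (C.diff f))) * C.curvSeries x =
      C.curvSeries y * PowerSeries.C f - PowerSeries.C f * C.curvSeries x := by
  have h1 : C.curvSeries y * (X * PowerSeries.C (C.curv y * f)) * C.curvSeries x =
      C.curvSeries y * PowerSeries.C f * C.curvSeries x - PowerSeries.C f * C.curvSeries x := by
    rw [map_mul, ← mul_assoc X, ← mul_assoc, curvSeries_mul_X_mul_C_curv, sub_mul, sub_mul,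
      ← map_mul, C.idm_comp hf]
  have h2 : C.curvSeries y * (X * PowerSeries.C (f * C.curv x)) * C.curvSeries x =
      C.curvSeries y * PowerSeries.C f * C.curvSeries x - C.curvSeries y * PowerSeries.C f := by
    rw [map_mul, ← mul_assoc X, ← (PowerSeries.commute_X (PowerSeries.C f)).eq, mul_assoc _ X,
      ← mul_assoc, mul_assoc, X_mul_C_curv_mul_curvSeries, mul_sub, mul_assoc _ _ (PowerSeries.C _),
      ← map_mul, C.comp_idm hf]
  rw [C.diff_sq hf, map_sub, mul_sub, mul_sub, sub_mul, h1, h2]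
  abel

/-- The differential of `C`, applied coefficientwise. -/
def diffSeries (C : CdgCategory k Γ) (A : PowerSeries C.E) : PowerSeries C.E :=
  PowerSeries.mk fun j => C.diff (coeff j A)

theorem diffSeries_mul {x y : C.Obj} {γ : Γ} {A : PowerSeries C.E}
    (hA : C.IsMorphismSeries x y γ A) (B : PowerSeries C.E) :
    C.diffSeries (A * B) = C.diffSeries A * B + gsign k γ • (A * C.diffSeries B) := by
  ext j
  simp only [diffSeries, coeff_mk, map_add, PowerSeries.coeff_smul, coeff_mul, map_sum,
    Finset.smul_sum, ← Finset.sum_add_distrib]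
  refine Finset.sum_congr rfl fun p _ => ?_
  rw [C.diff_leibniz (hA p.1).2, gsign_add_nsmul_two]

theorem diffSeries_C (f : C.E) :
    C.diffSeries (PowerSeries.C f) = PowerSeries.C (C.diff f) := by
  ext j
  rw [diffSeries, coeff_mk, PowerSeries.coeff_C, PowerSeries.coeff_C]
  split_ifs <;> simp

theorem diffSeries_X_mul_C (f : C.E) :
    C.diffSeries (X * PowerSeries.C f) = X * PowerSeries.C (C.diff f) := by
  ext (_ | j)
  · simp [diffSeries]
  · rw [diffSeries, coeff_mk, PowerSeries.coeff_succ_X_mul, PowerSeries.coeff_succ_X_mul,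
      PowerSeries.coeff_C, PowerSeries.coeff_C]
    split_ifs <;> simp

theorem diffSeries_curvSeries (x : C.Obj) : C.diffSeries (C.curvSeries x) = 0 := by
  ext j
  rw [diffSeries, coeff_mk, map_zero]
  induction j with
  | zero => simp [curvSeries, diff_idm]
  | succ j ih =>
    have h := (isMorphismSeries_curvSeries x j).2
    rw [curvSeries, coeff_mk] at ih h ⊢
    rw [pow_succ, ← mul_assoc, C.diff_leibniz h, ih, C.diff_curv, mul_zero, smul_zero,
      zero_mul, add_zero]

/-- The Euler operator `t d/dt`. -/
def eulerSeries (C : CdgCategory k Γ) (A : PowerSeries C.E) : PowerSeries C.E :=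
  PowerSeries.mk fun j => (j : k) • coeff j A

theorem eulerSeries_mul (A B : PowerSeries C.E) :
    C.eulerSeries (A * B) = C.eulerSeries A * B + A * C.eulerSeries B := by
  ext j
  simp only [eulerSeries, coeff_mk, map_add, coeff_mul, Finset.smul_sum,
    ← Finset.sum_add_distrib]
  refine Finset.sum_congr rfl fun p hp => ?_
  rw [← Finset.HasAntidiagonal.mem_antidiagonal.mp hp, smul_mul_assoc, mul_smul_comm, ← add_smul,
    Nat.cast_add]

theorem eulerSeries_X_mul_C_mul_curvSeries (f : C.E) (x : C.Obj) :
    C.eulerSeries (X * PowerSeries.C f * C.curvSeries x) =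
      X * PowerSeries.C f * C.curvSeries x * C.curvSeries x := by
  rw [mul_assoc _ (C.curvSeries x), curvSeries_mul_curvSeries]
  ext (_ | j)
  · simp [eulerSeries, mul_assoc]
  · rw [eulerSeries, coeff_mk, mul_assoc, mul_assoc, PowerSeries.coeff_succ_X_mul,
      PowerSeries.coeff_succ_X_mul, PowerSeries.coeff_C_mul, PowerSeries.coeff_C_mul, coeff_mk,
      curvSeries, coeff_mk, mul_smul_comm]

theorem IsMorphismSeries.map_coeff_mul_comm {Q : Type} [AddCommGroup Q] [Module k Q]
    {q : C.E →ₗ[k] Q}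
    (q_cyclic : ∀ {X Y : C.Obj} {γ γ' : Γ} {x y : C.E},
      x ∈ C.Hom Y X → y ∈ C.Hom X Y → x ∈ C.deg γ → y ∈ C.deg γ' →
      q (x * y) = gsign2 k γ γ' • q (y * x))
    {x y : C.Obj} {γ γ' : Γ} {A B : PowerSeries C.E}
    (hA : C.IsMorphismSeries y x γ A) (hB : C.IsMorphismSeries x y γ' B) (p : ℕ) :
    q (coeff p (A * B)) = gsign2 k γ γ' • q (coeff p (B * A)) := by
  rw [coeff_mul, coeff_mul, map_sum, map_sum, Finset.smul_sum]
  refine Finset.sum_equiv (Equiv.prodComm ℕ ℕ) (fun ij => by simp [add_comm]) fun ij _ => ?_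
  rw [q_cyclic (hA _).1 (hB _).1 (hA _).2 (hB _).2, gsign2_add_nsmul_two]
  rfl

end CdgCategory

namespace CdgCategory

open PowerSeries (coeff X coeff_mk coeff_mul)

/-- The factor `t · d(aᵢ) · ∑ h^j t^j`, with `h` the curvature of the source `W (i + 1)` of `aᵢ`. -/
def stepSeries (C : CdgCategory k Γ) (W : ℕ → C.Obj) (a : ℕ → C.E) (i : ℕ) : PowerSeries C.E :=
  X * PowerSeries.C (C.diff (a i)) * C.curvSeries (W (i + 1))

/-- The generating series of the words `a₀ h₁^{j₀} d(a₁) h₂^{j₁} ⋯ d(aₙ) h_{n+1}^{jₙ}`, the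
exponent of the variable being `n + j₀ + ⋯ + jₙ`. -/
def wordSeries (C : CdgCategory k Γ) (n : ℕ) (W : ℕ → C.Obj) (a : ℕ → C.E) : PowerSeries C.E :=
  PowerSeries.C (a 0) * C.curvSeries (W 1) * seqProd (fun i => C.stepSeries W a (i + 1)) n

/-- The morphisms `aᵢ : W (i + 1) → W i`, for `i ≤ n`, are homogeneous of degree `g i`. -/
def IsChain (C : CdgCategory k Γ) (n : ℕ) (W : ℕ → C.Obj) (g : ℕ → Γ) (a : ℕ → C.E) : Prop :=
  ∀ i ≤ n, a i ∈ C.Hom (W (i + 1)) (W i) ∧ a i ∈ C.deg (g i)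

variable {W : ℕ → C.Obj} {a : ℕ → C.E} {g : ℕ → Γ} {n : ℕ}

theorem IsChain.mono (h : C.IsChain n W g a) {m : ℕ} (hm : m ≤ n) : C.IsChain m W g a :=
  fun i hi => h i (hi.trans hm)

theorem IsChain.isMorphismSeries_step (h : C.IsChain n W g a) {i : ℕ} (hi : i ≤ n) :
    C.IsMorphismSeries (W (i + 1)) (W i) (g i - 1) (C.stepSeries W a i) := by
  rw [← add_zero (g i - 1)]
  refine (isMorphismSeries_X_mul_C (C.diff_hom (h i hi).1) ?_).mul (isMorphismSeries_curvSeries _)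
  rw [← one_add_one_eq_two, ← add_assoc, sub_add_cancel]
  exact C.diff_deg (h i hi).2

theorem IsChain.mul_seqProd (h : C.IsChain n W g a) {w : C.Obj} {γ : Γ} {A : PowerSeries C.E}
    {l : ℕ} (hA : C.IsMorphismSeries (W l) w γ A) (r : ℕ) (hr : l + r ≤ n + 1) :
    C.IsMorphismSeries (W (l + r)) w (γ + ∑ i ∈ range r, (g (l + i) - 1))
      (A * seqProd (fun i => C.stepSeries W a (l + i)) r) := by
  induction r with
  | zero => simpa [seqProd] using hA
  | succ r ih =>
    rw [seqProd, ← mul_assoc, sum_range_succ, ← add_assoc γ]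
    exact (ih (by omega)).mul (h.isMorphismSeries_step (by omega : l + r ≤ n))

theorem wordSeries_add (m r : ℕ) : C.wordSeries (m + r) W a =
    C.wordSeries m W a * seqProd (fun i => C.stepSeries W a (m + 1 + i)) r := by
  rw [wordSeries, seqProd_add, ← mul_assoc, ← wordSeries]
  simp only [add_right_comm]

theorem wordSeries_succ (m : ℕ) : C.wordSeries (m + 1) W a =
    C.wordSeries m W a * C.stepSeries W a (m + 1) := by
  rw [wordSeries, seqProd, ← mul_assoc, ← wordSeries]

theorem wordSeries_congr {W' : ℕ → C.Obj} {a' : ℕ → C.E}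
    (hW : ∀ i ≤ n, W (i + 1) = W' (i + 1)) (ha : ∀ i ≤ n, a i = a' i) :
    C.wordSeries n W a = C.wordSeries n W' a' := by
  rw [wordSeries, wordSeries, ha 0 n.zero_le, hW 0 n.zero_le]
  congr 1
  refine seqProd_congr fun i hi => ?_
  rw [stepSeries, stepSeries, ha _ hi, hW _ hi]

theorem IsChain.isMorphismSeries_word (h : C.IsChain n W g a) :
    C.IsMorphismSeries (W (n + 1)) (W 0) (degSum g (n + 1) - (n : Γ)) (C.wordSeries n W a) := by
  induction n with
  | zero =>
    simpa [wordSeries, seqProd, degSum] using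
      (isMorphismSeries_C (h 0 le_rfl).1 (h 0 le_rfl).2).mul (isMorphismSeries_curvSeries _)
  | succ n ih =>
    have e : degSum g (n + 1 + 1) - ((n + 1 : ℕ) : Γ) =
        (degSum g (n + 1) - (n : Γ)) + (g (n + 1) - 1) := by
      rw [degSum, sum_range_succ, ← degSum, Nat.cast_succ]; abel
    rw [wordSeries_succ, e]
    exact (ih (h.mono n.le_succ)).mul (h.isMorphismSeries_step le_rfl)

/-- The part of `wordSeries n W a` before the last curvature series. -/
def wordInit (C : CdgCategory k Γ) (W : ℕ → C.Obj) (a : ℕ → C.E) : ℕ → PowerSeries C.E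
  | 0 => PowerSeries.C (a 0)
  | m + 1 => C.wordSeries m W a * (X * PowerSeries.C (C.diff (a (m + 1))))

theorem wordInit_mul_curvSeries (m : ℕ) :
    C.wordInit W a m * C.curvSeries (W (m + 1)) = C.wordSeries m W a := by
  cases m with
  | zero => simp [wordInit, wordSeries, seqProd]
  | succ m => rw [wordInit, wordSeries_succ, stepSeries, mul_assoc]

/-- A word with `a (j + 1)` placed to the left of the curvature series of its source. -/
def wordLeft (C : CdgCategory k Γ) (n : ℕ) (W : ℕ → C.Obj) (a : ℕ → C.E) (j : ℕ) :
    PowerSeries C.E :=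
  C.wordInit W a j * PowerSeries.C (a (j + 1)) * C.curvSeries (W (j + 2)) *
    seqProd (fun i => C.stepSeries W a (j + 2 + i)) (n - j)

/-- A word with `a (j + 1)` placed to the right of the curvature series of its target. -/
def wordRight (C : CdgCategory k Γ) (n : ℕ) (W : ℕ → C.Obj) (a : ℕ → C.E) (j : ℕ) :
    PowerSeries C.E :=
  C.wordSeries j W a * PowerSeries.C (a (j + 1)) *
    seqProd (fun i => C.stepSeries W a (j + 2 + i)) (n - j)

theorem IsChain.diffSeries_stepSeries (h : C.IsChain n W g a) {i : ℕ} (hi : i ≤ n) :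
    C.diffSeries (C.stepSeries W a i) =
      X * PowerSeries.C (C.diff (C.diff (a i))) * C.curvSeries (W (i + 1)) := by
  have h1 : C.IsMorphismSeries (W (i + 1)) (W i) (g i - 1)
      (X * PowerSeries.C (C.diff (a i))) := by
    refine isMorphismSeries_X_mul_C (C.diff_hom (h i hi).1) ?_
    rw [← one_add_one_eq_two, ← add_assoc, sub_add_cancel]
    exact C.diff_deg (h i hi).2
  rw [stepSeries, diffSeries_mul h1, diffSeries_curvSeries, mul_zero, smul_zero,
    add_zero, diffSeries_X_mul_C]

theorem IsChain.wordSeries_mul_diffSeries_stepSeries (h : C.IsChain n W g a) {j : ℕ}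
    (hj : j + 1 ≤ n) :
    C.wordSeries j W a * C.diffSeries (C.stepSeries W a (j + 1)) =
      C.wordSeries j W a * PowerSeries.C (a (j + 1)) -
        C.wordInit W a j * PowerSeries.C (a (j + 1)) * C.curvSeries (W (j + 2)) := by
  rw [h.diffSeries_stepSeries hj, ← wordInit_mul_curvSeries, mul_assoc _ (C.curvSeries _),
    ← mul_assoc (C.curvSeries _), curvSeries_mul_diff_diff_mul_curvSeries (h _ hj).1, mul_sub]
  simp only [mul_assoc]

theorem IsChain.diffSeries_wordSeries (h : C.IsChain n W g a) {m : ℕ} (hm : m ≤ n) :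
    C.diffSeries (C.wordSeries m W a) =
      PowerSeries.C (C.diff (a 0)) * C.curvSeries (W 1) *
          seqProd (fun i => C.stepSeries W a (i + 1)) m +
        ∑ j ∈ range m, gsign k (degSum g (j + 1) - (j : Γ)) •
          (C.wordRight (m - 1) W a j - C.wordLeft (m - 1) W a j) := by
  induction m with
  | zero =>
    simp [wordSeries, seqProd, diffSeries_C, diffSeries_curvSeries,
      diffSeries_mul (isMorphismSeries_C (h 0 hm).1 (h 0 hm).2)]
  | succ m ih =>
    rw [wordSeries_succ, diffSeries_mul (h.mono (m.le_succ.trans hm)).isMorphismSeries_word,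
      ih (m.le_succ.trans hm), h.wordSeries_mul_diffSeries_stepSeries hm, add_mul, sum_mul,
      sum_range_succ, seqProd, ← mul_assoc, add_assoc]
    congr 2
    · refine sum_congr rfl fun j hj => ?_
      obtain ⟨r, rfl⟩ := Nat.exists_eq_add_of_lt (mem_range.mp hj)
      have e1 : j + r + 1 - 1 - j = r := by omega
      have e2 : j + r + 1 + 1 - 1 - j = r + 1 := by omega
      have e3 : C.stepSeries W a (j + r + 1 + 1) = C.stepSeries W a (j + 2 + r) := by
        congr 1; omega
      simp only [wordRight, wordLeft, e1, e2, e3, seqProd, smul_mul_assoc, sub_mul, mul_assoc]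
    · simp [wordRight, wordLeft, seqProd]

theorem C_smul (c : k) (f : C.E) : PowerSeries.C (c • f) = c • PowerSeries.C f := by
  ext j
  rw [PowerSeries.coeff_smul, PowerSeries.coeff_C, PowerSeries.coeff_C]
  split_ifs <;> simp

theorem wordSeries_contract_zero (n : ℕ) :
    C.wordSeries n (dropIdx W 0) (contractChain a 0) = C.wordLeft n W a 0 := by
  rw [wordSeries, wordLeft, wordInit, ← map_mul]
  congr 1
  refine seqProd_congr fun i _ => ?_
  rw [add_comm 2 i]
  simp [stepSeries, dropIdx, contractChain]

theorem IsChain.wordSeries_contract_succ (h : C.IsChain (n + 1) W g a) {j : ℕ} (hj : j < n) :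
    C.wordSeries n (dropIdx W (j + 1)) (contractChain a (j + 1)) =
      C.wordLeft n W a (j + 1) + gsign k (g (j + 1)) • C.wordRight n W a j := by
  obtain ⟨r, rfl⟩ := Nat.exists_eq_add_of_lt hj
  have e0 : j + r + 1 = j + 1 + r := by omega
  have e1 : j + 1 + r - (j + 1) = r := by omega
  have e2 : j + 1 + r - j = r + 1 := by omega
  rw [e0, wordSeries_add, wordSeries_succ, wordLeft, wordRight, e1, e2, seqProd_succ', wordInit]
  have hw : C.wordSeries j (dropIdx W (j + 1)) (contractChain a (j + 1)) =
      C.wordSeries j W a := by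
    refine wordSeries_congr (fun i hi => ?_) fun i hi => ?_
    · simp [dropIdx, hi]
    · simp [contractChain, Nat.lt_succ_of_le hi]
  have hs : C.stepSeries (dropIdx W (j + 1)) (contractChain a (j + 1)) (j + 1) =
      X * PowerSeries.C (C.diff (a (j + 1) * a (j + 2))) * C.curvSeries (W (j + 3)) := by
    simp [stepSeries, dropIdx, contractChain]
  have hp : seqProd (fun i => C.stepSeries (dropIdx W (j + 1)) (contractChain a (j + 1))
      (j + 1 + 1 + i)) r = seqProd (fun i => C.stepSeries W a (j + 3 + i)) r := by
    refine seqProd_congr fun i _ => ?_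
    have h1 : ¬ j + 1 + 1 + i < j + 1 := by omega
    have h2 : j + 1 + 1 + i ≠ j + 1 := by omega
    have h3 : ¬ j + 3 + i ≤ j + 1 := by omega
    have h4 : j + 1 + 1 + i + 1 = j + 3 + i := by omega
    simp only [stepSeries, dropIdx, contractChain, if_neg h1, if_neg h2, if_neg h3, h4]
  have hq : (fun i => C.stepSeries W a (j + 2 + (i + 1))) =
      fun i => C.stepSeries W a (j + 3 + i) := by
    funext i; congr 1; omega
  have hx : ∀ (f : C.E) (A : PowerSeries C.E),
      PowerSeries.C f * (X * A) = X * (PowerSeries.C f * A) := fun f A => by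
    rw [← mul_assoc, (PowerSeries.commute_X _).eq, mul_assoc]
  rw [hw, hs, hp, hq, C.diff_leibniz (h _ (by omega)).2, map_add, C_smul, stepSeries]
  simp only [map_mul, mul_add, add_mul, smul_mul_assoc, mul_smul_comm, mul_assoc, hx, add_zero]

theorem IsChain.sum_wordSeries_contract (h : C.IsChain (n + 1) W g a) {m : ℕ} (hm : m ≤ n) :
    ∑ j ∈ range (m + 1), gsign k (degSum g (j + 1) - (j : Γ)) •
        C.wordSeries n (dropIdx W j) (contractChain a j) =
      ∑ j ∈ range (m + 1), gsign k (degSum g (j + 1) - (j : Γ)) •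
          (C.wordLeft n W a j - C.wordRight n W a j) +
        gsign k (degSum g (m + 1) - (m : Γ)) • C.wordRight n W a m := by
  induction m with
  | zero => simp [wordSeries_contract_zero, smul_sub]
  | succ m ih =>
    have e : degSum g (m + 1 + 1) - ((m + 1 : ℕ) : Γ) =
        (degSum g (m + 1) - (m : Γ)) + (g (m + 1) - 1) := by
      rw [degSum, sum_range_succ, ← degSum, Nat.cast_succ]; abel
    rw [sum_range_succ, ih (m.le_succ.trans hm), h.wordSeries_contract_succ hm, smul_add,
      smul_smul, sum_range_succ _ (m + 1), e, gsign_add_sub_one_mul, neg_smul, smul_sub]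
    abel

theorem eulerSeries_stepSeries (i : ℕ) :
    C.eulerSeries (C.stepSeries W a i) = C.stepSeries W a i * C.curvSeries (W (i + 1)) :=
  eulerSeries_X_mul_C_mul_curvSeries _ _

theorem eulerSeries_seqProd (m : ℕ) :
    C.eulerSeries (seqProd (C.stepSeries W a) m) =
      ∑ i ∈ range m, seqProd (C.stepSeries W a) (i + 1) * C.curvSeries (W (i + 1)) *
        seqProd (fun j => C.stepSeries W a (i + 1 + j)) (m - 1 - i) := by
  induction m with
  | zero =>
    ext (_ | j) <;> simp [seqProd, eulerSeries, PowerSeries.coeff_one]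
  | succ m ih =>
    rw [seqProd, eulerSeries_mul, ih, sum_mul, sum_range_succ, eulerSeries_stepSeries]
    congr 1
    · refine sum_congr rfl fun j hj => ?_
      obtain ⟨r, rfl⟩ := Nat.exists_eq_add_of_lt (mem_range.mp hj)
      have e1 : j + r + 1 - 1 - j = r := by omega
      have e2 : j + r + 1 + 1 - 1 - j = r + 1 := by omega
      have e3 : C.stepSeries W a (j + r + 1) = C.stepSeries W a (j + 1 + r) := by
        congr 1; omega
      simp only [e1, e2, e3, seqProd, mul_assoc]
    · simp [seqProd, mul_assoc]

end CdgCategory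

section Cyclic

variable {α : Type}

theorem cyc_of_le {m i : ℕ} (X : ℕ → α) (h : i ≤ m) : cyc m X i = X i := by
  rw [cyc, Nat.mod_eq_of_lt (Nat.lt_succ_of_le h)]

theorem cyc_succ_self (m : ℕ) (X : ℕ → α) : cyc m X (m + 1) = X 0 := by
  rw [cyc, Nat.mod_self]

theorem cyc_dropIdx (X : ℕ → α) {n i j : ℕ} (hj : j ≤ n) (hi : i ≤ n + 1) :
    cyc n (dropIdx X j) i = dropIdx (cyc (n + 1) X) j i := by
  rcases hi.lt_or_eq with hi | rfl
  · rw [cyc_of_le _ (Nat.le_of_lt_succ hi), dropIdx, dropIdx, cyc_of_le _ hi.le,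
      cyc_of_le _ (Nat.succ_le_of_lt hi)]
  · rw [cyc_succ_self, dropIdx, dropIdx, if_pos j.zero_le, if_neg (by omega), cyc_succ_self]

theorem cyc_rotate (X : ℕ → α) (n l : ℕ) {i : ℕ} (hi : i ≤ n + 1) :
    cyc (n + 1) (fun i => if i = 0 then cyc n X l else cyc n X (l + i - 1)) (i + 1) =
      cyc n X (l + i) := by
  rcases hi.lt_or_eq with hi | rfl
  · rw [cyc_of_le _ hi, if_neg i.succ_ne_zero, Nat.add_succ_sub_one]
  · rw [cyc_succ_self, if_pos rfl, cyc, cyc, Nat.add_mod_right]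

theorem cyc_mod_add_one (X : ℕ → α) (n i : ℕ) : cyc n X (i % (n + 1) + 1) = cyc n X (i + 1) := by
  rw [cyc, cyc, Nat.mod_add_mod]

end Cyclic

namespace CdgCategory

open PowerSeries (coeff X coeff_mk coeff_mul)

variable {n : ℕ} {O : ℕ → C.Obj} {a : ℕ → C.E} {g : ℕ → Γ}

theorem Composable.isChain (ha : C.Composable n O a) (hg : C.Homog n g a) :
    C.IsChain n (cyc n O) g a := fun i hi =>
  ⟨by simpa only [cyc_of_le O hi] using ha i hi, hg i hi⟩

theorem IsChain.composable (h : C.IsChain n (cyc n O) g a) : C.Composable n O a := fun i hi => by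
  simpa only [cyc_of_le O hi] using (h i hi).1

theorem IsChain.homog (h : C.IsChain n (cyc n O) g a) : C.Homog n g a := fun i hi => (h i hi).2

theorem IsChain.congr {W W' : ℕ → C.Obj} (h : C.IsChain n W g a)
    (hW : ∀ i ≤ n + 1, W' i = W i) : C.IsChain n W' g a := fun i hi => by
  rw [hW i (by omega), hW (i + 1) (by omega)]
  exact h i hi

theorem IsChain.contract {W : ℕ → C.Obj} (h : C.IsChain (n + 1) W g a) {j : ℕ} (hj : j ≤ n) :
    C.IsChain n (dropIdx W j)
      (fun i => if i < j then g i else if i = j then g j + g (j + 1) else g (i + 1))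
      (contractChain a j) := by
  intro i hi
  rcases lt_trichotomy i j with hij | rfl | hij
  · simpa [dropIdx, contractChain, hij, hij.le, Nat.succ_le_of_lt hij] using h i (by omega)
  · simpa [dropIdx, contractChain] using
      And.intro (C.mul_hom_mem (h i (by omega)).1 (h (i + 1) (by omega)).1)
        (C.mul_deg_mem (h i (by omega)).2 (h (i + 1) (by omega)).2)
  · have h1 : ¬ i < j := by omega
    have h2 : i ≠ j := by omega
    have h3 : ¬ i ≤ j := by omega
    have h4 : ¬ i + 1 ≤ j := by omega
    simpa only [dropIdx, contractChain, if_neg h1, if_neg h2, if_neg h3, if_neg h4] using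
      h (i + 1) (by omega)

theorem phiWord_eq_seqProd (n : ℕ) (O : ℕ → C.Obj) (a : ℕ → C.E) (v : ℕ → ℕ) :
    phiWord C n O a v = seqProd (fun t =>
      (if t = 0 then a 0 else C.diff (a t)) * C.curv (cyc n O (t + 1)) ^ v t) (n + 1) := by
  cases n with
  | zero => simp [phiWord, seqProd, cyc_succ_self]
  | succ m => simp [phiWord, chainProd_eq_seqProd, seqProd_succ' _ (m + 1)]

theorem IsChain.wordSeries_eq {W : ℕ → C.Obj} (h : C.IsChain n W g a) :
    C.wordSeries n W a = X ^ n * seqProd (fun t => PowerSeries.mk fun j =>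
      (if t = 0 then a 0 else C.diff (a t)) * C.curv (W (t + 1)) ^ j) (n + 1) := by
  rw [wordSeries, C_mul_curvSeries (h 0 n.zero_le).1, seqProd_succ', ← mul_assoc,
    ← (PowerSeries.commute_X_pow _ n).eq, mul_assoc, ← seqProd_X_mul]
  simp only [if_pos]
  congr 1
  refine seqProd_congr fun i hi => ?_
  rw [stepSeries, mul_assoc, C_mul_curvSeries (C.diff_hom (h (i + 1) hi).1)]
  simp

theorem IsChain.rotate (h : C.IsChain n (cyc n O) g a) {l : ℕ} :
    C.IsChain (n + 1)
      (cyc (n + 1) fun i => if i = 0 then cyc n O l else cyc n O (l + i - 1))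
      (fun i => if i = 0 then 0 else g ((l + i - 1) % (n + 1)))
      (fun i => if i = 0 then C.idm (cyc n O l) else a ((l + i - 1) % (n + 1))) := by
  rintro (_ | i) hi
  · rw [cyc_rotate O n l (Nat.zero_le _), cyc_of_le _ (Nat.zero_le _)]
    exact ⟨C.idm_mem _, C.idm_deg _⟩
  · rw [cyc_rotate O n l hi, cyc_rotate O n l (by omega)]
    have hi' := h ((l + i) % (n + 1)) (Nat.le_of_lt_succ (Nat.mod_lt _ n.succ_pos))
    rw [cyc_mod_add_one] at hi'
    simpa [cyc, ← add_assoc] using hi'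

theorem C_idm_mul_curvSeries (x : C.Obj) :
    PowerSeries.C (C.idm x) * C.curvSeries x = C.curvSeries x := by
  ext j
  rw [PowerSeries.coeff_C_mul, C.idm_comp (isMorphismSeries_curvSeries x j).1]

theorem wordSeries_rotate {l : ℕ} (hl : l ≤ n) :
    C.wordSeries (n + 1)
      (cyc (n + 1) fun i => if i = 0 then cyc n O l else cyc n O (l + i - 1))
      (fun i => if i = 0 then C.idm (cyc n O l) else a ((l + i - 1) % (n + 1))) =
    C.curvSeries (cyc n O l) *
      seqProd (fun i => C.stepSeries (cyc n O) a (l + i)) (n + 1 - l) *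
      seqProd (C.stepSeries (cyc n O) a) l := by
  have hs : ∀ i ≤ n, C.stepSeries
      (cyc (n + 1) fun i => if i = 0 then cyc n O l else cyc n O (l + i - 1))
      (fun i => if i = 0 then C.idm (cyc n O l) else a ((l + i - 1) % (n + 1))) (i + 1) =
      C.stepSeries (cyc n O) a ((l + i) % (n + 1)) := by
    intro i hi
    rw [stepSeries, stepSeries, cyc_rotate O n l (Nat.succ_le_succ hi), cyc_mod_add_one]
    rfl
  have hn : n + 1 - l + l = n.succ := by omega
  rw [wordSeries, seqProd_congr fun i hi => hs i (Nat.le_of_lt_succ hi),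
    cyc_rotate O n l (Nat.zero_le _), if_pos rfl, add_zero, C_idm_mul_curvSeries, mul_assoc]
  congr 1
  refine (congrArg (seqProd _) hn.symm).trans ((seqProd_add _ _ _).trans ?_)
  congr 1
  · refine seqProd_congr fun i hi => ?_
    rw [Nat.mod_eq_of_lt (by omega)]
  · refine seqProd_congr fun i hi => ?_
    rw [show l + (n + 1 - l + i) = i + (n + 1) by omega, Nat.add_mod_right,
      Nat.mod_eq_of_lt (by omega)]

theorem IsChain.isMorphismSeries_seqProd {W : ℕ → C.Obj} (h : C.IsChain n W g a) {m : ℕ}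
    (hm : m ≤ n) :
    C.IsMorphismSeries (W (m + 1)) (W 0) (degSum g (m + 1) - ((m + 1 : ℕ) : Γ))
      (seqProd (C.stepSeries W a) (m + 1)) := by
  have h1 := h.mul_seqProd (h.isMorphismSeries_step n.zero_le) m (by omega)
  have e : degSum g (m + 1) - ((m + 1 : ℕ) : Γ) =
      g 0 - 1 + ∑ i ∈ range m, (g (0 + 1 + i) - 1) := by
    rw [degSum, sum_range_succ', sum_sub_distrib, sum_const, card_range, nsmul_one, Nat.cast_succ]
    simp only [zero_add, add_comm 1]
    abel
  rw [e, seqProd_succ', add_comm m 1]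
  simpa only [zero_add, add_comm 1] using h1

theorem IsChain.isMorphismSeries_curvSeries_mul_seqProd {W : ℕ → C.Obj} (h : C.IsChain n W g a)
    {l : ℕ} (hl : l ≤ n) :
    C.IsMorphismSeries (W (n + 1)) (W l)
      ((∑ t ∈ Finset.Ico l (n + 1), g t) - ((n - l + 1 : ℕ) : Γ))
      (C.curvSeries (W l) * seqProd (fun i => C.stepSeries W a (l + i)) (n + 1 - l)) := by
  have h1 := h.mul_seqProd (isMorphismSeries_curvSeries (W l)) (n + 1 - l) (by omega)
  rw [show l + (n + 1 - l) = n + 1 by omega, zero_add, sum_sub_distrib, sum_const, card_range,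
    nsmul_one] at h1
  rwa [sum_Ico_eq_sum_range, show n - l + 1 = n + 1 - l by omega]

theorem IsChain.sum_map_coeff_rotate {Q : Type} [AddCommGroup Q] [Module k Q] {q : C.E →ₗ[k] Q}
    (q_cyclic : ∀ {X Y : C.Obj} {γ γ' : Γ} {x y : C.E},
      x ∈ C.Hom Y X → y ∈ C.Hom X Y → x ∈ C.deg γ → y ∈ C.deg γ' →
      q (x * y) = gsign2 k γ γ' • q (y * x))
    (h : C.IsChain n (cyc n O) g a) (p : ℕ) :
    ∑ l ∈ range (n + 1), gsign2 k ((∑ t ∈ Finset.Ico l (n + 1), g t) - ((n - l + 1 : ℕ) : Γ))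
        (degSum g l - (l : Γ)) • q (coeff p (C.curvSeries (cyc n O l) *
          seqProd (fun i => C.stepSeries (cyc n O) a (l + i)) (n + 1 - l) *
          seqProd (C.stepSeries (cyc n O) a) l)) =
      q (coeff p (C.eulerSeries (seqProd (C.stepSeries (cyc n O) a) (n + 1)))) := by
  have hW : cyc n O (n + 1) = cyc n O 0 := by rw [cyc_succ_self, cyc_of_le _ n.zero_le]
  rw [eulerSeries_seqProd, map_sum, map_sum, sum_range_succ', sum_range_succ _ n]
  congr 1
  · refine sum_congr rfl fun l hl => ?_
    have hl := mem_range.mp hl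
    have h1 := h.isMorphismSeries_curvSeries_mul_seqProd (l := l + 1) hl
    rw [hW] at h1
    rw [h1.map_coeff_mul_comm q_cyclic (h.isMorphismSeries_seqProd hl.le), smul_smul,
      gsign2_mul_self, one_smul, ← mul_assoc, show n + 1 - (l + 1) = n + 1 - 1 - l by omega]
  · have h1 := h.isMorphismSeries_seqProd le_rfl
    rw [hW] at h1
    have e : degSum g 0 - ((0 : ℕ) : Γ) = 0 := by simp [degSum]
    simp only [zero_add]
    rw [e, gsign2_zero_right, one_smul, Nat.sub_zero, seqProd, mul_one,
      (isMorphismSeries_curvSeries _).map_coeff_mul_comm q_cyclic h1, gsign2_comm,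
      gsign2_zero_right, one_smul, Nat.add_sub_cancel, Nat.sub_self, seqProd, mul_one, hW]

end CdgCategory

section Phi

open PowerSeries (coeff X)

variable {H : RedHochCore k Γ C} {Q : Type} [AddCommGroup Q] [Module k Q] {q : C.E →ₗ[k] Q}
  {phi : (n : ℕ) → H.W n →ₗ[k] (ℕ → Q)} {n : ℕ} {O : ℕ → C.Obj} {a : ℕ → C.E} {g : ℕ → Γ}

theorem RedHochCore.linearMap_ext {M : Type} [AddCommGroup M] [Module k M]
    {f f' : H.W n →ₗ[k] M}
    (h : ∀ O a g, C.IsChain n (cyc n O) g a → f (H.gen n O a) = f' (H.gen n O a)) : f = f' := by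
  refine LinearMap.ext_on (H.span_gen n) ?_
  rintro _ ⟨O, a, g, ha, hg, rfl⟩
  exact h O a g (ha.isChain hg)

theorem IsPhi.apply_gen (hphi : IsPhi H q phi) (h : C.IsChain n (cyc n O) g a) (p : ℕ) :
    phi n (H.gen n O a) p =
      ((p.factorial : k))⁻¹ • q (coeff p (C.wordSeries n (cyc n O) a)) := by
  rw [hphi n O a g h.composable h.homog, h.wordSeries_eq, PowerSeries.coeff_X_pow_mul']
  dsimp only
  split_ifs with hp
  · rw [coeff_seqProd_mk, map_sum]
    simp only [CdgCategory.phiWord_eq_seqProd]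
  · rw [map_zero, smul_zero]

theorem IsPhi.apply_b2 (hphi : IsPhi H q phi)
    (q_cyclic : ∀ {X Y : C.Obj} {γ γ' : Γ} {x y : C.E},
      x ∈ C.Hom Y X → y ∈ C.Hom X Y → x ∈ C.deg γ → y ∈ C.deg γ' →
      q (x * y) = gsign2 k γ γ' • q (y * x))
    {b2 : (n : ℕ) → H.W (n + 1) →ₗ[k] H.W n} (hb2 : IsB2 H b2)
    (h : C.IsChain (n + 1) (cyc (n + 1) O) g a) (p : ℕ) :
    phi n (b2 n (H.gen (n + 1) O a)) p = ((p.factorial : k))⁻¹ • q (coeff p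
      (∑ j ∈ range (n + 1), gsign k (degSum g (j + 1) - (j : Γ)) •
        (C.wordLeft n (cyc (n + 1) O) a j - C.wordRight n (cyc (n + 1) O) a j))) := by
  have h1 : ∀ j ≤ n, phi n (H.gen n (dropIdx O j) (contractChain a j)) p =
      ((p.factorial : k))⁻¹ • q (coeff p
        (C.wordSeries n (dropIdx (cyc (n + 1) O) j) (contractChain a j))) := by
    intro j hj
    rw [hphi.apply_gen ((h.contract hj).congr fun i hi => cyc_dropIdx O hj hi)]
    rw [CdgCategory.wordSeries_congr (fun i hi => cyc_dropIdx O hj (Nat.succ_le_succ hi))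
      fun _ _ => rfl]
  set O' : ℕ → C.Obj := fun i => if i = 0 then O (n + 1) else O i with hO'
  set a' : ℕ → C.E := fun i => if i = 0 then a (n + 1) * a 0 else a i with ha'
  have hW : ∀ i ≤ n, cyc n O' (i + 1) = cyc (n + 1) O (i + 1) := by
    intro i hi
    rcases hi.lt_or_eq with hi | rfl
    · rw [cyc_of_le _ hi, cyc_of_le _ (by omega), hO']
      exact if_neg i.succ_ne_zero
    · rw [cyc_succ_self, cyc_of_le _ le_rfl]
      rfl
  have hn := h (n + 1) le_rfl
  have hn' : C.IsMorphismSeries (cyc (n + 1) O 0) (cyc (n + 1) O (n + 1)) (g (n + 1))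
      (PowerSeries.C (a (n + 1))) := by
    refine CdgCategory.isMorphismSeries_C ?_ hn.2
    have := hn.1
    rwa [cyc_succ_self] at this
  have hlast : C.IsChain n (cyc n O') (fun i => if i = 0 then g (n + 1) + g 0 else g i) a' := by
    rintro (_ | i) hi
    · rw [hW 0 hi, cyc_of_le _ hi]
      have h0 := h 0 (by omega)
      refine ⟨?_, C.mul_deg_mem hn.2 h0.2⟩
      have := C.mul_hom_mem hn.1 (by rw [cyc_succ_self]; exact h0.1)
      rwa [cyc_of_le _ le_rfl] at this
    · rw [hW _ hi, hW i (by omega)]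
      exact h (i + 1) (by omega)
  have hword : C.wordSeries n (cyc n O') a' =
      PowerSeries.C (a (n + 1)) * C.wordSeries n (cyc (n + 1) O) a := by
    rw [CdgCategory.wordSeries, CdgCategory.wordSeries, ← mul_assoc, ← mul_assoc, ← map_mul,
      hW 0 n.zero_le]
    congr 1
    refine seqProd_congr fun i hi => ?_
    rw [CdgCategory.stepSeries, CdgCategory.stepSeries, hW _ hi]
    rfl
  have hright : C.wordRight n (cyc (n + 1) O) a n =
      C.wordSeries n (cyc (n + 1) O) a * PowerSeries.C (a (n + 1)) := by
    simp [CdgCategory.wordRight, seqProd]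
  have hs := congrArg (fun A => ((p.factorial : k))⁻¹ • q (coeff p A))
    (h.sum_wordSeries_contract le_rfl)
  rw [hb2 n O a g h.composable h.homog, map_sub, map_sum, map_smul, Pi.sub_apply, Pi.smul_apply,
    Finset.sum_apply, hphi.apply_gen hlast, hword,
    hn'.map_coeff_mul_comm q_cyclic (h.mono n.le_succ).isMorphismSeries_word, ← hright]
  rw [Finset.sum_congr rfl fun j hj => by
    rw [map_smul, Pi.smul_apply, h1 j (Nat.le_of_lt_succ (mem_range.mp hj))]]
  rw [smul_comm _ ((p.factorial : k))⁻¹, smul_smul (gsign2 k _ _), gsign2_sub_one_mul,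
    sub_eq_iff_eq_add]
  simp only [map_add, smul_add, map_sum, PowerSeries.coeff_smul, map_smul, Finset.smul_sum] at hs ⊢
  simp only [smul_comm _ ((p.factorial : k))⁻¹] at hs ⊢
  exact hs

theorem IsPhi.dbar_apply_gen (hphi : IsPhi H q phi) {dbar : Q →ₗ[k] Q}
    (dbar_q : ∀ (X : C.Obj) (x : C.E), x ∈ C.Hom X X → dbar (q x) = q (C.diff x))
    (h : C.IsChain n (cyc n O) g a) (p : ℕ) :
    dbar (phi n (H.gen n O a) p) =
      ((p.factorial : k))⁻¹ • q (coeff p (C.diffSeries (C.wordSeries n (cyc n O) a))) := by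
  have hw := (h.isMorphismSeries_word p).1
  rw [cyc_succ_self, cyc_of_le _ n.zero_le] at hw
  rw [hphi.apply_gen h, map_smul, dbar_q _ _ hw, CdgCategory.diffSeries, PowerSeries.coeff_mk]

theorem IsPhi.apply_connesB [CharZero k] (hphi : IsPhi H q phi)
    (q_cyclic : ∀ {X Y : C.Obj} {γ γ' : Γ} {x y : C.E},
      x ∈ C.Hom Y X → y ∈ C.Hom X Y → x ∈ C.deg γ → y ∈ C.deg γ' →
      q (x * y) = gsign2 k γ γ' • q (y * x))
    {B : (n : ℕ) → H.W n →ₗ[k] H.W (n + 1)} (hB : IsConnesB H B)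
    (h : C.IsChain n (cyc n O) g a) (p : ℕ) :
    phi (n + 1) (B n (H.gen n O a)) (p + 1) = ((p.factorial : k))⁻¹ • q (coeff p
      (PowerSeries.C (C.diff (a 0)) * C.curvSeries (cyc n O 1) *
        seqProd (fun i => C.stepSeries (cyc n O) a (i + 1)) n)) := by
  have hp : ((p + 1 : ℕ) : k) ≠ 0 := Nat.cast_ne_zero.mpr p.succ_ne_zero
  rw [hB n O a g h.composable h.homog, map_sum, Finset.sum_apply]
  rw [Finset.sum_congr rfl fun l hl => by
    rw [map_smul, Pi.smul_apply, hphi.apply_gen h.rotate,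
      CdgCategory.wordSeries_rotate (Nat.le_of_lt_succ (mem_range.mp hl)),
      smul_comm _ (((p + 1).factorial : k))⁻¹]]
  rw [← Finset.smul_sum, h.sum_map_coeff_rotate q_cyclic, CdgCategory.eulerSeries,
    PowerSeries.coeff_mk, map_smul, smul_smul, Nat.factorial_succ, Nat.cast_mul, mul_inv_rev,
    mul_assoc, inv_mul_cancel₀ hp, mul_one, seqProd_succ', CdgCategory.stepSeries, mul_assoc X,
    mul_assoc X, PowerSeries.coeff_succ_X_mul]

theorem IsPhi.coeff_zero (hphi : IsPhi H q phi) (x : H.W (n + 1)) : phi (n + 1) x 0 = 0 := by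
  have e : LinearMap.proj (R := k) (φ := fun _ => Q) 0 ∘ₗ phi (n + 1) = 0 :=
    RedHochCore.linearMap_ext fun O a g h => by
      rw [LinearMap.comp_apply, LinearMap.proj_apply, hphi _ O a g h.composable h.homog]
      simp
  exact LinearMap.congr_fun e x

theorem IsPhi.dbar_apply [CharZero k] (hphi : IsPhi H q phi)
    (q_cyclic : ∀ {X Y : C.Obj} {γ γ' : Γ} {x y : C.E},
      x ∈ C.Hom Y X → y ∈ C.Hom X Y → x ∈ C.deg γ → y ∈ C.deg γ' →
      q (x * y) = gsign2 k γ γ' • q (y * x))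
    {dbar : Q →ₗ[k] Q}
    (dbar_q : ∀ (X : C.Obj) (x : C.E), x ∈ C.Hom X X → dbar (q x) = q (C.diff x))
    {b2 : (n : ℕ) → H.W (n + 1) →ₗ[k] H.W n} (hb2 : IsB2 H b2)
    {B : (n : ℕ) → H.W n →ₗ[k] H.W (n + 1)} (hB : IsConnesB H B) (x : H.W (n + 1)) (p : ℕ) :
    dbar (phi (n + 1) x p) = -phi n (b2 n x) p + phi (n + 2) (B (n + 1) x) (p + 1) := by
  let ev : ℕ → (ℕ → Q) →ₗ[k] Q := LinearMap.proj
  have e : dbar ∘ₗ ev p ∘ₗ phi (n + 1) =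
      -(ev p ∘ₗ phi n ∘ₗ b2 n) + ev (p + 1) ∘ₗ phi (n + 2) ∘ₗ B (n + 1) := by
    refine RedHochCore.linearMap_ext fun O a g h => ?_
    change dbar (phi (n + 1) _ p) = -phi n (b2 n _) p + phi (n + 2) (B (n + 1) _) (p + 1)
    rw [hphi.dbar_apply_gen dbar_q h, hphi.apply_b2 q_cyclic hb2 h,
      hphi.apply_connesB q_cyclic hB h, h.diffSeries_wordSeries le_rfl, Nat.add_sub_cancel,
      map_add, map_add, smul_add, add_comm, ← smul_neg, ← map_neg, ← map_neg, ← sum_neg_distrib]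
    simp only [← smul_neg, neg_sub]
  exact LinearMap.congr_fun e x

theorem IsPhi.dbar_apply_zero [CharZero k] (hphi : IsPhi H q phi)
    (q_cyclic : ∀ {X Y : C.Obj} {γ γ' : Γ} {x y : C.E},
      x ∈ C.Hom Y X → y ∈ C.Hom X Y → x ∈ C.deg γ → y ∈ C.deg γ' →
      q (x * y) = gsign2 k γ γ' • q (y * x))
    {dbar : Q →ₗ[k] Q}
    (dbar_q : ∀ (X : C.Obj) (x : C.E), x ∈ C.Hom X X → dbar (q x) = q (C.diff x))
    {B : (n : ℕ) → H.W n →ₗ[k] H.W (n + 1)} (hB : IsConnesB H B) (x : H.W 0) (p : ℕ) :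
    dbar (phi 0 x p) = phi 1 (B 0 x) (p + 1) := by
  let ev : ℕ → (ℕ → Q) →ₗ[k] Q := LinearMap.proj
  have e : dbar ∘ₗ ev p ∘ₗ phi 0 = ev (p + 1) ∘ₗ phi 1 ∘ₗ B 0 := by
    refine RedHochCore.linearMap_ext fun O a g h => ?_
    change dbar (phi 0 _ p) = phi 1 (B 0 _) (p + 1)
    rw [hphi.dbar_apply_gen dbar_q h, hphi.apply_connesB q_cyclic hB h,
      h.diffSeries_wordSeries le_rfl, range_zero, sum_empty, add_zero]
  exact LinearMap.congr_fun e x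

end Phi

/-- Let `k` be a field of characteristic `0` and `𝒞` a curved
differential `Γ`-graded category over `k`.  Then, as maps
`H̄och^{II}(𝒞)[[v]] → (𝒞/[𝒞,𝒞])[[v]]`, one has `v·(d̄ ∘ φ) = −v·(φ ∘ b₂) + φ ∘ B`
(stated componentwise on weight-`(n+1)` and weight-`0` chains, coefficientwise in the
degree `−2` formal variable `v`).  Here `Q` models `𝒞/[𝒞,𝒞]` — the quotient of
`⊕_X End(X)` by graded commutators, via the projection `q`, with induced differential
`d̄` — `b₂` is the bar part of the Hochschild differential, `B` is the Connes
operator, and `φ` is given by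
`φ(a₀[a₁|⋯|aₙ]) = ∑ (a₀ h₁^{j₀} d(a₁) ⋯ d(aₙ) h₀^{jₙ}/(J+n)!) v^{J+n} mod [𝒞,𝒞]`. -/
theorem phi_b2_ConnesB
    (k Γ : Type) [Field k] [CharZero k] [GradingGroup Γ]
    (C : CdgCategory k Γ) (H : RedHochCore k Γ C)
    (b2 : (n : ℕ) → H.W (n + 1) →ₗ[k] H.W n) (hb2 : IsB2 H b2)
    (B : (n : ℕ) → H.W n →ₗ[k] H.W (n + 1)) (hB : IsConnesB H B)
    -- the quotient `Q = 𝒞/[𝒞,𝒞]` :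
    (Q : Type) [AddCommGroup Q] [Module k Q] (q : C.E →ₗ[k] Q)
    (q_span : Submodule.span k
      {y : Q | ∃ (X : C.Obj) (x : C.E), x ∈ C.Hom X X ∧ y = q x} = ⊤)
    (q_cyclic : ∀ {X Y : C.Obj} {γ γ' : Γ} {x y : C.E},
      x ∈ C.Hom Y X → y ∈ C.Hom X Y → x ∈ C.deg γ → y ∈ C.deg γ' →
      q (x * y) = gsign2 k γ γ' • q (y * x))
    -- the induced differential `d̄` on `𝒞/[𝒞,𝒞]` :
    (dbar : Q →ₗ[k] Q)
    (dbar_q : ∀ (X : C.Obj) (x : C.E), x ∈ C.Hom X X → dbar (q x) = q (C.diff x))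
    -- the map `φ` :
    (phi : (n : ℕ) → H.W n →ₗ[k] (ℕ → Q)) (hphi : IsPhi H q phi) :
    (∀ (n : ℕ) (x : H.W (n + 1)) (p : ℕ),
      (if p = 0 then 0 else dbar (phi (n + 1) x (p - 1))) =
        -(if p = 0 then 0 else phi n (b2 n x) (p - 1)) + phi (n + 2) (B (n + 1) x) p) ∧
    (∀ (x : H.W 0) (p : ℕ),
      (if p = 0 then 0 else dbar (phi 0 x (p - 1))) = phi 1 (B 0 x) p) := by
  refine ⟨fun n x p => ?_, fun x p => ?_⟩
  · cases p with
    | zero => simp [hphi.coeff_zero]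
    | succ p => simpa using hphi.dbar_apply q_cyclic dbar_q hb2 hB x p
  · cases p with
    | zero => simp [hphi.coeff_zero]
    | succ p => simpa using hphi.dbar_apply_zero q_cyclic dbar_q hB x p

end
end
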